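/- Let N and r be positive integers and i ∈ {0, 1, …, N−1}. Suppose K is a compact interval with non-empty interior contained in Λ = {x ∈ ℝ : lim_{j→∞} discr X_{jN+i}(x) exists and is negative}. Assume lim_{j→∞} a_{(j+1)N+i−1}/a_{jN+i−1} = 1, that (X_{jN+i} restricted to K : j ∈ ℕ) belongs to 𝒟_r(K, GL(2,ℝ)) with uniform limit 𝒳 on K, and that ∑_{j=1}^∞ 1/a_{jN+i−1} = ∞. Let μ be the unique probability measure on ℝ with ∫ p_n p_m dμ = δ_{nm} for all n, m (unique since ∑_n 1/a_n = ∞). Then the restriction of μ to K is absolutely continuous with a continuous strictly positive density w, and lim_{n→∞} sup_{x∈K} | ( ∑_{j=1}^{n+1} 1/a_{jN+i−1} )^{−1} · ∑_{j=0}^n p_{jN+i}(x)² − |[𝒳(x)]_{2,1}| / (π w(x) √(−discr 𝒳(x))) | = 0. -/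

import Mathlib

open Filter Topology MeasureTheory Real

attribute [local instance] Matrix.normedAddCommGroup

noncomputable section

abbrev Mat2 := Matrix (Fin 2) (Fin 2) ℝ

/-- The transfer matrix `B_n(x)` built from the Jacobi parameters `(a_n)`, `(b_n)`. -/
def Bmat (a b : ℕ → ℝ) (n : ℕ) (x : ℝ) : Mat2 :=
  !![0, 1; -(a (n - 1)) / a n, (x - b n) / a n]

/-- Product in decreasing index order: `prodD C n0 len = C (n0+len-1) ⋯ C n0`. -/
def prodD (C : ℕ → Mat2) (n0 : ℕ) : ℕ → Mat2
  | 0 => 1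
  | (len + 1) => C (n0 + len) * prodD C n0 len

/-- `N`-step transfer matrix `X_n(x) = B_{n+N-1}(x) ⋯ B_n(x)`. -/
def Xmat (a b : ℕ → ℝ) (N n : ℕ) (x : ℝ) : Mat2 :=
  prodD (fun j => Bmat a b j x) n N

/-- Discriminant of a `2×2` matrix. -/
def discr (M : Mat2) : ℝ := (Matrix.trace M) ^ 2 - 4 * M.det

/-- The orthonormal polynomials `p_n` associated to `(a_n)`, `(b_n)`. -/
def opoly (a b : ℕ → ℝ) : ℕ → ℝ → ℝ
  | 0 => fun _ => 1
  | 1 => fun x => (x - b 0) / a 0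
  | (n + 2) => fun x =>
      ((x - b (n + 1)) * opoly a b (n + 1) x - a n * opoly a b n x) / a (n + 1)

/-- Iterated forward difference of a sequence. -/
def iterDiff {E : Type*} [AddCommGroup E] (f : ℕ → E) : ℕ → ℕ → E
  | 0, n => f n
  | (j + 1), n => iterDiff f j (n + 1) - iterDiff f j n

/-- Membership in the Stolz class `𝒟_r(K, GL(2,ℝ))`. -/
def memDK (r : ℕ) (K : Set ℝ) (F : ℕ → ℝ → Mat2) : Prop :=
  (∃ C, ∀ n, ∀ x ∈ K, ‖F n x‖ ≤ C) ∧
    (∀ n, ∀ x ∈ K, IsUnit (F n x)) ∧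
    ∀ m ∈ Finset.Icc 1 r,
      Summable fun n : ℕ => (⨆ x : K, ‖iterDiff F m n (x : ℝ)‖) ^ ((r : ℝ) / m)

section
open Asymptotics

open Asymptotics

section Cls

variable {E : Type*} [NormedCommRing E]

/-- forward difference -/
def fdiff {E : Type*} [AddCommGroup E] (f : ℕ → E) : ℕ → E := fun n => f (n + 1) - f n

lemma iterDiff_fdiff {E : Type*} [AddCommGroup E] (f : ℕ → E) (m : ℕ) :
    ∀ n, iterDiff f (m + 1) n = iterDiff (fdiff f) m n := by
  induction m with
  | zero => intro n; rfl
  | succ m ih =>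
    intro n
    show iterDiff f (m + 1) (n + 1) - iterDiff f (m + 1) n = _
    rw [ih, ih]; rfl

lemma iterDiff_add {E : Type*} [AddCommGroup E] (f g : ℕ → E) (m : ℕ) :
    ∀ n, iterDiff (fun n => f n + g n) m n = iterDiff f m n + iterDiff g m n := by
  induction m with
  | zero => intro n; rfl
  | succ m ih =>
    intro n
    simp only [iterDiff, ih]; abel

lemma iterDiff_map {E F : Type*} [AddCommGroup E] [AddCommGroup F] (φ : E →+ F) (f : ℕ → E)
    (m : ℕ) : ∀ n, iterDiff (fun n => φ (f n)) m n = φ (iterDiff f m n) := by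
  induction m with
  | zero => intro n; rfl
  | succ m ih =>
    intro n
    simp only [iterDiff, ih, map_sub]

lemma iterDiff_shift {E : Type*} [AddCommGroup E] (f : ℕ → E) (m : ℕ) :
    ∀ n, iterDiff (fun n => f (n + 1)) m n = iterDiff f m (n + 1) := by
  induction m with
  | zero => intro n; rfl
  | succ m ih =>
    intro n
    simp only [iterDiff, ih]

lemma iterDiff_congr {E : Type*} [AddCommGroup E] {f g : ℕ → E} (h : f =ᶠ[atTop] g) (m : ℕ) :
    (fun n => iterDiff f m n) =ᶠ[atTop] (fun n => iterDiff g m n) := by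
  induction m with
  | zero => exact h
  | succ m ih =>
    filter_upwards [ih, (tendsto_add_atTop_nat 1).eventually ih] with n h1 h2
    simp only [iterDiff]
    rw [h1, h2]

/-- The control sequence. -/
structure Ctrl (ε : ℕ → ℝ) (r : ℕ) : Prop where
  nonneg : ∀ n, 0 ≤ ε n
  tend : Tendsto ε atTop (𝓝 0)
  shift : ∀ n, ε (n + 1) ≤ 2 * ε n
  rpos : 0 < r

def Cls (ε : ℕ → ℝ) (r M k : ℕ) (f : ℕ → E) : Prop :=
  ∀ m ≤ M, (fun n => iterDiff f m n) =O[atTop] (fun n => ε n ^ (min (k + m) r))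

variable {ε : ℕ → ℝ} {r : ℕ}

lemma Ctrl.pow_le (h : Ctrl ε r) {s t : ℕ} (hst : t ≤ s) :
    (fun n => ε n ^ s) =O[atTop] (fun n => ε n ^ t) := by
  apply IsBigO.of_bound 1
  filter_upwards [h.tend.eventually (gt_mem_nhds zero_lt_one)] with n hn
  rw [one_mul, Real.norm_of_nonneg (pow_nonneg (h.nonneg n) _),
    Real.norm_of_nonneg (pow_nonneg (h.nonneg n) _)]
  exact pow_le_pow_of_le_one (h.nonneg n) hn.le hst

lemma Ctrl.shift_pow (h : Ctrl ε r) (s : ℕ) :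
    (fun n => ε (n + 1) ^ s) =O[atTop] (fun n => ε n ^ s) := by
  apply IsBigO.of_bound (2 ^ s)
  filter_upwards with n
  rw [Real.norm_of_nonneg (pow_nonneg (h.nonneg _) _),
    Real.norm_of_nonneg (pow_nonneg (h.nonneg n) _), ← mul_pow]
  exact pow_le_pow_left₀ (h.nonneg _) (h.shift n) _

lemma Cls.add {M k : ℕ} {f g : ℕ → E} (hf : Cls ε r M k f) (hg : Cls ε r M k g) :
    Cls ε r M k (fun n => f n + g n) := by
  intro m hm
  simp only [iterDiff_add]
  exact (hf m hm).add (hg m hm)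

lemma Cls.neg {M k : ℕ} {f : ℕ → E} (hf : Cls ε r M k f) :
    Cls ε r M k (fun n => - f n) := by
  intro m hm
  have : (fun n => iterDiff (fun n => - f n) m n) = fun n => - iterDiff f m n := by
    funext n
    exact iterDiff_map (negAddMonoidHom : E →+ E) f m n
  rw [this]
  exact (hf m hm).neg_left

lemma Cls.sub {M k : ℕ} {f g : ℕ → E} (hf : Cls ε r M k f) (hg : Cls ε r M k g) :
    Cls ε r M k (fun n => f n - g n) := by
  simpa only [sub_eq_add_neg] using hf.add hg.neg

lemma Cls.starr [StarRing E] [NormedStarGroup E] {M k : ℕ} {f : ℕ → E} (hf : Cls ε r M k f) :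
    Cls ε r M k (fun n => star (f n)) := by
  intro m hm
  have : (fun n => iterDiff (fun n => star (f n)) m n) = fun n => star (iterDiff f m n) := by
    funext n
    exact iterDiff_map (starAddEquiv : E ≃+ E).toAddMonoidHom f m n
  rw [this]
  refine IsBigO.congr_left (hf m hm).norm_left ?_ |>.of_norm_left
  intro n; simp

lemma Cls.shift (h : Ctrl ε r) {M k : ℕ} {f : ℕ → E} (hf : Cls ε r M k f) :
    Cls ε r M k (fun n => f (n + 1)) := by
  intro m hm
  simp only [iterDiff_shift]
  exact ((hf m hm).comp_tendsto (tendsto_add_atTop_nat 1)).trans (h.shift_pow _)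

lemma Cls.congr {M k : ℕ} {f g : ℕ → E} (hf : Cls ε r M k f) (hfg : f =ᶠ[atTop] g) :
    Cls ε r M k g := fun m hm => (hf m hm).congr' (iterDiff_congr hfg m) EventuallyEq.rfl

lemma Cls.diff {M k : ℕ} {f : ℕ → E} (hf : Cls ε r (M + 1) k f) :
    Cls ε r M (k + 1) (fdiff f) := by
  intro m hm
  have := hf (m + 1) (by omega)
  simp only [iterDiff_fdiff] at this
  rwa [show k + 1 + m = k + (m + 1) by ring]

lemma Cls.of_diff {M k : ℕ} {f : ℕ → E} (h0 : f =O[atTop] (fun n => ε n ^ (min k r)))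
    (hf : Cls ε r M (k + 1) (fdiff f)) : Cls ε r (M + 1) k f := by
  intro m hm
  cases m with
  | zero => exact h0
  | succ m =>
    have := hf m (by omega)
    simp only [iterDiff_fdiff]
    rwa [show k + (m + 1) = k + 1 + m by ring]

lemma Cls.mono (h : Ctrl ε r) {M M' k k' : ℕ} {f : ℕ → E} (hf : Cls ε r M k f) (hk : k' ≤ k)
    (hM : M' ≤ M) : Cls ε r M' k' f := fun m hm =>
  (hf m (hm.trans hM)).trans (h.pow_le (by omega))

lemma Cls.mul (h : Ctrl ε r) {M : ℕ} : ∀ {k l : ℕ} {f g : ℕ → E}, Cls ε r M k f → Cls ε r M l g →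
    Cls ε r M (k + l) (fun n => f n * g n) := by
  have key : ∀ m : ℕ, ∀ {k l : ℕ} {f g : ℕ → E}, Cls ε r m k f → Cls ε r m l g →
    (fun n => iterDiff (fun n => f n * g n) m n) =O[atTop] (fun n => ε n ^ (min (k + l + m) r)) := by
    intro m
    induction m with
    | zero =>
      intro k l f g hf hg
      have := (hf 0 le_rfl).mul (hg 0 le_rfl)
      simp only [iterDiff, add_zero, ← pow_add] at this ⊢
      exact this.trans (h.pow_le (by omega))
    | succ m ih =>
      intro k l f g hf hg
      have e : (fdiff fun n => f n * g n) =
          fun n => f (n + 1) * fdiff g n + fdiff f n * g n := by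
        funext n; simp only [fdiff]; ring
      simp only [iterDiff_fdiff, e, iterDiff_add]
      have h1 := ih ((hf.shift h).mono h le_rfl (Nat.le_succ m)) hg.diff
      have h2 := ih hf.diff (hg.mono h le_rfl (Nat.le_succ m))
      rw [show k + l + (m + 1) = k + (l + 1) + m by ring]
      rw [show k + 1 + l + m = k + (l + 1) + m by ring] at h2
      exact h1.add h2
  intro k l f g hf hg m hm
  exact key m (hf.mono h le_rfl hm) (hg.mono h le_rfl hm)

/-- order-k class, all difference orders -/
def CA (ε : ℕ → ℝ) (r k : ℕ) (f : ℕ → E) : Prop := ∀ M, Cls ε r M k f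

lemma CA.add {k : ℕ} {f g : ℕ → E} (hf : CA ε r k f) (hg : CA ε r k g) :
    CA ε r k (fun n => f n + g n) := fun M => (hf M).add (hg M)
lemma CA.sub {k : ℕ} {f g : ℕ → E} (hf : CA ε r k f) (hg : CA ε r k g) :
    CA ε r k (fun n => f n - g n) := fun M => (hf M).sub (hg M)
lemma CA.neg {k : ℕ} {f : ℕ → E} (hf : CA ε r k f) :
    CA ε r k (fun n => - f n) := fun M => (hf M).neg
lemma CA.starr [StarRing E] [NormedStarGroup E] {k : ℕ} {f : ℕ → E} (hf : CA ε r k f) :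
    CA ε r k (fun n => star (f n)) := fun M => (hf M).starr
lemma CA.shift (h : Ctrl ε r) {k : ℕ} {f : ℕ → E} (hf : CA ε r k f) :
    CA ε r k (fun n => f (n + 1)) := fun M => (hf M).shift h
lemma CA.congr {k : ℕ} {f g : ℕ → E} (hf : CA ε r k f) (hfg : f =ᶠ[atTop] g) :
    CA ε r k g := fun M => (hf M).congr hfg
lemma CA.diff {k : ℕ} {f : ℕ → E} (hf : CA ε r k f) :
    CA ε r (k + 1) (fun n => f (n + 1) - f n) := fun M => (hf (M + 1)).diff
lemma CA.mono (h : Ctrl ε r) {k k' : ℕ} {f : ℕ → E} (hf : CA ε r k f) (hk : k' ≤ k) :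
    CA ε r k' f := fun M => (hf M).mono h hk le_rfl
lemma CA.mul (h : Ctrl ε r) {k l : ℕ} {f g : ℕ → E} (hf : CA ε r k f) (hg : CA ε r l g) :
    CA ε r (k + l) (fun n => f n * g n) := fun M => (hf M).mul h (hg M)
lemma CA.mul0 (h : Ctrl ε r) {k : ℕ} {f g : ℕ → E} (hf : CA ε r k f) (hg : CA ε r 0 g) :
    CA ε r k (fun n => f n * g n) := hf.mul h hg
lemma CA.const (c : E) : CA ε r 0 (fun _ => c) := by
  intro M m _
  cases m with
  | zero => simpa using! isBigO_const_const c (one_ne_zero (α := ℝ)) atTop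
  | succ m =>
    have : ∀ m n, iterDiff (fun _ : ℕ => c) (m + 1) n = 0 := by
      intro m
      induction m with
      | zero => intro n; simp [iterDiff]
      | succ m ih => intro n; rw [iterDiff, ih, ih, sub_zero]
    simp only [this]
    exact isBigO_zero _ _
lemma CA.tendsto_zero (h : Ctrl ε r) {k : ℕ} {f : ℕ → E} (hf : CA ε r k f) (hk : 0 < k) :
    Tendsto f atTop (𝓝 0) := by
  have := hf 0 0 le_rfl
  simp only [iterDiff, add_zero] at this
  refine this.trans_tendsto ?_
  have h0 : min k r ≠ 0 := by have := h.rpos; omega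
  simpa [h0] using h.tend.pow (min k r)

lemma CA.inv [CompleteSpace E] (h : Ctrl ε r) {f : ℕ → E} (hf : CA ε r 0 f) {f0 : E}
    (hlim : Tendsto f atTop (𝓝 f0)) (hu : IsUnit f0) : CA ε r 0 (fun n => Ring.inverse (f n)) := by
  obtain ⟨U, rfl⟩ := hu
  have hinv : Tendsto (fun n => Ring.inverse (f n)) atTop (𝓝 (Ring.inverse (U : E))) :=
    (NormedRing.inverse_continuousAt U).tendsto.comp hlim
  have hun : ∀ᶠ n in atTop, IsUnit (f n) :=
    hlim.eventually (Units.isOpen.mem_nhds U.isUnit)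
  have hb : (fun n => Ring.inverse (f n)) =O[atTop] (fun n => ε n ^ (min 0 r)) := by
    simpa using! hinv.isBigO_one ℝ
  intro M
  induction M with
  | zero =>
    intro m hm
    obtain rfl : m = 0 := by omega
    exact hb
  | succ M ih =>
    refine Cls.of_diff hb ?_
    have := (((ih.shift h).mul h ih).mul h (hf (M + 1)).diff).neg
    refine (this.mono h (by omega) le_rfl).congr ?_
    filter_upwards [hun, (tendsto_add_atTop_nat 1).eventually hun] with n h1 h2
    have e1 := Ring.mul_inverse_cancel _ h1
    have e2 := Ring.mul_inverse_cancel _ h2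
    simp only [fdiff]
    linear_combination (Ring.inverse (f (n+1))) * e1 - (Ring.inverse (f n)) * e2

lemma CA.sqrt [CompleteSpace E] (h : Ctrl ε r) {f s : ℕ → E} (hf : CA ε r 0 f) {s0 : E}
    (hlim : Tendsto s atTop (𝓝 s0)) (hu : IsUnit (s0 + s0)) (hs : ∀ᶠ n in atTop, s n * s n = f n) :
    CA ε r 0 s := by
  have hb : s =O[atTop] (fun n => ε n ^ (min 0 r)) := by
    simpa using! hlim.isBigO_one ℝ
  have hlim2 : Tendsto (fun n => s (n + 1) + s n) atTop (𝓝 (s0 + s0)) :=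
    (hlim.comp (tendsto_add_atTop_nat 1)).add hlim
  obtain ⟨U, hU⟩ := hu
  rw [← hU] at hlim2
  have hinv : Tendsto (fun n => Ring.inverse (s (n + 1) + s n)) atTop (𝓝 (Ring.inverse (U : E))) :=
    (NormedRing.inverse_continuousAt U).tendsto.comp hlim2
  have hun : ∀ᶠ n in atTop, IsUnit (s (n + 1) + s n) :=
    hlim2.eventually (Units.isOpen.mem_nhds U.isUnit)
  have hbi : (fun n => Ring.inverse (s (n + 1) + s n)) =O[atTop] (fun n => ε n ^ (min 0 r)) := by
    simpa using! hinv.isBigO_one ℝ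
  have both : ∀ M, Cls ε r M 0 s ∧ Cls ε r M 0 (fun n => Ring.inverse (s (n + 1) + s n)) := by
    intro M
    induction M with
    | zero =>
      constructor
      · intro m hm
        obtain rfl : m = 0 := by omega
        exact hb
      · intro m hm
        obtain rfl : m = 0 := by omega
        exact hbi
    | succ M ih =>
      have h1 : Cls ε r (M + 1) 0 s := by
        refine Cls.of_diff hb ?_
        have := (hf (M + 1)).diff.mul h ih.2
        refine this.congr ?_
        filter_upwards [hun, hs, (tendsto_add_atTop_nat 1).eventually hs] with n h1 h2 h3
        have e1 := Ring.mul_inverse_cancel _ h1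
        simp only [fdiff, ← h2, ← h3]
        linear_combination (s (n + 1) - s n) * e1
      refine ⟨h1, ?_⟩
      refine Cls.of_diff hbi ?_
      have h2 := ((h1.shift h).add h1).diff
      have := (((ih.2.shift h).mul h ih.2).mul h h2).neg
      refine (this.mono h (by omega) le_rfl).congr ?_
      filter_upwards [hun, (tendsto_add_atTop_nat 1).eventually hun] with n h1 h2
      have e1 := Ring.mul_inverse_cancel _ h1
      have e2 := Ring.mul_inverse_cancel _ h2
      simp only [fdiff]
      linear_combination (Ring.inverse (s (n + 1 + 1) + s (n+1))) * e1
        - (Ring.inverse (s (n + 1) + s n)) * e2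
  exact fun M => (both M).1

end Cls

section Stage

variable {E : Type*} [NormedCommRing E] [StarRing E] [NormedStarGroup E] [CompleteSpace E]
variable {ε : ℕ → ℝ} {r : ℕ}

/-- Stage `k` of the diagonalization. -/
def Stg (ε : ℕ → ℝ) (r : ℕ) (A B C D : ℕ → E) (p0 q0 l0 : E) (k : ℕ) : Prop :=
  ∃ p q a b : ℕ → E, Tendsto p atTop (𝓝 p0) ∧ Tendsto q atTop (𝓝 q0) ∧ Tendsto a atTop (𝓝 l0) ∧
    CA ε r 0 a ∧ CA ε r k b ∧
    (∀ᶠ n in atTop, p (n + 1) * A n + q (n + 1) * C n = a n * p n + b n * star (p n) ∧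
      p (n + 1) * B n + q (n + 1) * D n = a n * q n + b n * star (q n))

lemma tendsto_inverse_unit {f : ℕ → E} {f0 : E} (hlim : Tendsto f atTop (𝓝 f0)) (hu : IsUnit f0) :
    Tendsto (fun n => Ring.inverse (f n)) atTop (𝓝 (Ring.inverse f0)) := by
  obtain ⟨U, rfl⟩ := hu
  exact (NormedRing.inverse_continuousAt U).tendsto.comp hlim

lemma eventually_unit {f : ℕ → E} {f0 : E} (hlim : Tendsto f atTop (𝓝 f0)) (hu : IsUnit f0) :
    ∀ᶠ n in atTop, IsUnit (f n) := by
  obtain ⟨U, rfl⟩ := hu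
  exact hlim.eventually (Units.isOpen.mem_nhds U.isUnit)

lemma stage_succ (h : Ctrl ε r) {A B C D : ℕ → E}
    (hA : ∀ n, star (A n) = A n) (hB : ∀ n, star (B n) = B n) (hC : ∀ n, star (C n) = C n)
    (hD : ∀ n, star (D n) = D n) {p0 q0 l0 : E} (hl : IsUnit (l0 - star l0)) {k : ℕ} (hk : 0 < k)
    (hs : Stg ε r A B C D p0 q0 l0 k) : Stg ε r A B C D p0 q0 l0 (k + 1) := by
  obtain ⟨p, q, a, b, hp, hq, ha, hca, hcb, hrel⟩ := hs
  have hb := hcb.tendsto_zero h hk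
  have hia : Tendsto (fun n => a n - star (a n)) atTop (𝓝 (l0 - star l0)) := ha.sub ha.star
  have cinv : CA ε r 0 (fun n => Ring.inverse (a n - star (a n))) :=
    (hca.sub hca.starr).inv h hia hl
  set g : ℕ → E := fun n => b n * Ring.inverse (a n - star (a n)) with hg
  have cg : CA ε r k g := hcb.mul0 h cinv
  have tg : Tendsto g atTop (𝓝 0) := cg.tendsto_zero h hk
  have tg1 : Tendsto (fun n => g (n + 1)) atTop (𝓝 0) := tg.comp (tendsto_add_atTop_nat 1)
  have cg0 : CA ε r 0 g := cg.mono h (Nat.zero_le _)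
  have cb0 : CA ε r 0 b := hcb.mono h (Nat.zero_le _)
  have td : Tendsto (fun n => 1 - g n * star (g n)) atTop (𝓝 1) := by
    simpa using (tg.mul tg.star).const_sub 1
  set H : ℕ → E := fun n => Ring.inverse (1 - g n * star (g n)) with hH
  have cH : CA ε r 0 H := ((CA.const 1).sub (cg0.mul0 h cg0.starr)).inv h td isUnit_one
  have tH : Tendsto H atTop (𝓝 1) := by
    simpa using tendsto_inverse_unit td isUnit_one
  refine ⟨fun n => p n + g n * star (p n), fun n => q n + g n * star (q n),
    fun n => (a n + g (n + 1) * star (b n) - (b n + g (n + 1) * star (a n)) * star (g n)) * H n,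
    fun n => ((g (n + 1) - g n) * star (a n) - g (n + 1) * (g n * star (b n))) * H n,
    ?_, ?_, ?_, ?_, ?_, ?_⟩
  · simpa using hp.add (tg.mul hp.star)
  · simpa using hq.add (tg.mul hq.star)
  · simpa using ((ha.add (tg1.mul hb.star)).sub ((hb.add (tg1.mul ha.star)).mul tg.star)).mul tH
  · exact (((hca.add ((cg0.shift h).mul0 h cb0.starr)).sub
      ((cb0.add ((cg0.shift h).mul0 h hca.starr)).mul0 h cg0.starr)).mul0 h cH)
  · refine CA.mul0 h (CA.sub (cg.diff.mul0 h hca.starr) ?_) cH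
    have := (cg.shift h).mul h (cg.mul0 h cb0.starr)
    exact this.mono h (by omega)
  · filter_upwards [hrel, eventually_unit hia hl, eventually_unit td isUnit_one] with n h1 h2 h3
    obtain ⟨h1, h1'⟩ := h1
    have e1 := Ring.mul_inverse_cancel _ h2
    have e2 := Ring.mul_inverse_cancel _ h3
    have eg : b n = (a n - star (a n)) * g n := by
      simp only [hg]; linear_combination (- b n) * e1
    have s1 := congrArg star h1
    have s1' := congrArg star h1'
    simp only [star_add, star_mul', star_star, hA, hB, hC, hD] at s1 s1'
    change (1 - g n * star (g n)) * H n = 1 at e2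
    simp only [star_add, star_mul', star_star]
    generalize H n = HH at *
    generalize g (n + 1) = g1 at *
    generalize star (b n) = sb at *
    generalize star (a n) = sa at *
    generalize star (g n) = sg at *
    generalize star (p n) = sp at *
    generalize star (q n) = sq at *
    constructor
    · linear_combination h1 + g1 * s1
        - ((a n + g1 * sb) * p n + (b n + g1 * sa) * sp) * e2 
        + HH * (sp + sg * p n) * eg
    · linear_combination h1' + g1 * s1'
        - ((a n + g1 * sb) * q n + (b n + g1 * sa) * sq) * e2 
        + HH * (sq + sg * q n) * eg

lemma stage_one (h : Ctrl ε r) {A B C D p q l : ℕ → E} {A0 B0 C0 D0 p0 q0 l0 : E}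
    (cA : CA ε r 0 A) (cB : CA ε r 0 B) (cC : CA ε r 0 C) (cD : CA ε r 0 D)
    (cp : CA ε r 0 p) (cq : CA ε r 0 q) (cl : CA ε r 0 l)
    (tp : Tendsto p atTop (𝓝 p0)) (tq : Tendsto q atTop (𝓝 q0)) (tl : Tendsto l atTop (𝓝 l0))
    (tA : Tendsto A atTop (𝓝 A0)) (tB : Tendsto B atTop (𝓝 B0)) (tC : Tendsto C atTop (𝓝 C0))
    (tD : Tendsto D atTop (𝓝 D0))
    (hu : IsUnit (p0 * star q0 - star p0 * q0))
    (hrel : ∀ᶠ n in atTop, p n * A n + q n * C n = l n * p n ∧ p n * B n + q n * D n = l n * q n) :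
    Stg ε r A B C D p0 q0 l0 1 := by
  have td : Tendsto (fun n => p n * star (q n) - star (p n) * q n) atTop
      (𝓝 (p0 * star q0 - star p0 * q0)) := (tp.mul tq.star).sub (tp.star.mul tq)
  have cd : CA ε r 0 (fun n => p n * star (q n) - star (p n) * q n) :=
    (cp.mul0 h cq.starr).sub (cp.starr.mul0 h cq)
  set d : ℕ → E := fun n => Ring.inverse (p n * star (q n) - star (p n) * q n) with hd
  have cid : CA ε r 0 d := cd.inv h td hu
  have tid := tendsto_inverse_unit td hu
  set R1 : ℕ → E := fun n => (p (n + 1) - p n) * A n + (q (n + 1) - q n) * C n with hR1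
  set R2 : ℕ → E := fun n => (p (n + 1) - p n) * B n + (q (n + 1) - q n) * D n with hR2
  have c1 : CA ε r 1 R1 := (cp.diff.mul0 h cA).add (cq.diff.mul0 h cC)
  have c2 : CA ε r 1 R2 := (cp.diff.mul0 h cB).add (cq.diff.mul0 h cD)
  have ce : CA ε r 1 (fun n => (R1 n * star (q n) - R2 n * star (p n)) * d n) :=
    ((c1.mul0 h cq.starr).sub (c2.mul0 h cp.starr)).mul0 h cid
  have cb : CA ε r 1 (fun n => (R2 n * p n - R1 n * q n) * d n) :=
    ((c2.mul0 h cp).sub (c1.mul0 h cq)).mul0 h cid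
  refine ⟨p, q, fun n => l n + (R1 n * star (q n) - R2 n * star (p n)) * d n, _, tp, tq, ?_, ?_,
    cb, ?_⟩
  · simpa using tl.add (ce.tendsto_zero h one_pos)
  · exact cl.add (ce.mono h (by omega))
  · filter_upwards [hrel, eventually_unit td hu] with n h1 h2
    obtain ⟨h1, h1'⟩ := h1
    have e1 := Ring.mul_inverse_cancel _ h2
    change _ * d n = 1 at e1
    generalize d n = dd at *
    simp only [hR1, hR2]
    constructor
    · linear_combination h1 - ((p (n + 1) - p n) * A n + (q (n + 1) - q n) * C n) * e1
    · linear_combination h1' - ((p (n + 1) - p n) * B n + (q (n + 1) - q n) * D n) * e1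

lemma stage_all (h : Ctrl ε r) {A B C D : ℕ → E}
    (hA : ∀ n, star (A n) = A n) (hB : ∀ n, star (B n) = B n) (hC : ∀ n, star (C n) = C n)
    (hD : ∀ n, star (D n) = D n) {p0 q0 l0 : E} (hl : IsUnit (l0 - star l0))
    (hs : Stg ε r A B C D p0 q0 l0 1) : Stg ε r A B C D p0 q0 l0 r := by
  have : ∀ k, Stg ε r A B C D p0 q0 l0 (k + 1) := by
    intro k
    induction k with
    | zero => exact hs
    | succ k ih => exact stage_succ h hA hB hC hD hl (Nat.succ_pos k) ih
  obtain ⟨k, hk⟩ : ∃ k, r = k + 1 := ⟨r - 1, by have := h.rpos; omega⟩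
  rw [hk]
  simpa only [hk] using this k

end Stage

section Ces

lemma weight_littleO {w : ℕ → ℝ} (hw : ∀ n, 0 < w n)
    (hr : Tendsto (fun n => w (n + 1) / w n) atTop (𝓝 1))
    (hW : Tendsto (fun n => ∑ j ∈ Finset.range n, w j) atTop atTop) :
    w =o[atTop] (fun n => ∑ j ∈ Finset.range n, w j) := by
  have h1 : (fun n => w (n + 1) - w n) =o[atTop] w := by
    rw [isLittleO_iff_tendsto (fun n hn => absurd hn (hw n).ne')]
    have := hr.sub_const 1
    rw [sub_self] at this
    refine this.congr (fun n => ?_)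
    have := (hw n).ne'
    field_simp
  have h2 := h1.sum_range (fun n => (hw n).le) hW
  simp only [Finset.sum_range_sub] at h2
  have h3 : (fun _ : ℕ => w 0) =o[atTop] (fun n => ∑ j ∈ Finset.range n, w j) := by
    rw [isLittleO_const_left]
    right
    exact tendsto_norm_atTop_atTop.comp hW
  simpa using h2.add h3

lemma cesaro_zero {E : Type*} [NormedAddCommGroup E] [NormedSpace ℝ E] {w : ℕ → ℝ}
    (hw : ∀ n, 0 < w n)
    (hW : Tendsto (fun n => ∑ j ∈ Finset.range n, w j) atTop atTop) {h : ℕ → E}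
    (hh : Tendsto h atTop (𝓝 0)) :
    (fun n => ∑ j ∈ Finset.range n, w j • h j) =o[atTop] (fun n => ∑ j ∈ Finset.range n, w j) := by
  have h1 : (fun n => w n • h n) =o[atTop] w := by
    have := (isBigO_refl w atTop).smul_isLittleO ((isLittleO_one_iff ℝ).2 hh)
    simpa using this
  exact h1.sum_range (fun n => (hw n).le) hW

lemma cesaro_osc {E : Type*} [NormedCommRing E] [NormedAlgebra ℝ E] {w : ℕ → ℝ}
    (hw : ∀ n, 0 < w n) (hr : Tendsto (fun n => w (n + 1) / w n) atTop (𝓝 1))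
    (hW : Tendsto (fun n => ∑ j ∈ Finset.range n, w j) atTop atTop) {h : ℕ → E} {κ : E}
    (hb : h =O[atTop] (fun _ => (1 : ℝ)))
    (hh : Tendsto (fun n => h (n + 1) - κ * h n) atTop (𝓝 0)) (hκ : IsUnit (1 - κ)) :
    (fun n => ∑ j ∈ Finset.range n, w j • h j) =o[atTop] (fun n => ∑ j ∈ Finset.range n, w j) := by
  have h1 : (fun n => w (n + 1) - w n) =o[atTop] w := by
    rw [isLittleO_iff_tendsto (fun n hn => absurd hn (hw n).ne')]
    have := hr.sub_const 1
    rw [sub_self] at this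
    refine this.congr (fun n => ?_)
    have := (hw n).ne'
    field_simp
  have hb1 : (fun n => h (n + 1)) =O[atTop] (fun _ => (1 : ℝ)) :=
    hb.comp_tendsto (tendsto_add_atTop_nat 1)
  have h2 : (fun n => (w (n + 1) - w n) • h (n + 1)) =o[atTop] w := by
    simpa using h1.smul_isBigO hb1
  have h3 : (fun n => w n • (h (n + 1) - κ * h n)) =o[atTop] w := by
    have := (isBigO_refl w atTop).smul_isLittleO ((isLittleO_one_iff ℝ).2 hh)
    simpa using this
  have h4 := (h2.add h3).sum_range (fun n => (hw n).le) hW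
  have hwo := weight_littleO hw hr hW
  have h5 : (fun n => w n • h n) =o[atTop] (fun n => ∑ j ∈ Finset.range n, w j) := by
    simpa using hwo.smul_isBigO hb
  have h6 : (fun _ : ℕ => w 0 • h 0) =o[atTop] (fun n => ∑ j ∈ Finset.range n, w j) := by
    rw [isLittleO_const_left]
    right
    exact tendsto_norm_atTop_atTop.comp hW
  have h7 := (h4.sub h5).add h6
  obtain ⟨U, hU⟩ := hκ
  have h8 := h7.const_mul_left ((U⁻¹ : Eˣ) : E)
  refine h8.congr_left (fun n => ?_)
  have e : ∀ n, ∑ x ∈ Finset.range n, ((w (x + 1) - w x) • h (x + 1) + w x • (h (x + 1) - κ * h x))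
      - w n • h n + w 0 • h 0 = (1 - κ) * ∑ j ∈ Finset.range n, w j • h j := by
    intro n
    induction n with
    | zero => simp
    | succ n ih =>
      rw [Finset.sum_range_succ, Finset.sum_range_succ, mul_add, ← ih]
      simp only [sub_smul, smul_sub, sub_mul, one_mul, mul_smul_comm]
      abel
  show ((U⁻¹ : Eˣ) : E) * _ = _
  rw [e, ← hU, ← mul_assoc, Units.inv_mul, one_mul]

end Ces

section Dyn

variable {T : Type*} [TopologicalSpace T] [CompactSpace T]

lemma log_conv {ρ : ℕ → C(T, ℝ)} {β : ℕ → ℝ} (hβ : Summable β)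
    (h : ∀ᶠ n in atTop, ∀ x, 0 < ρ n x ∧ ρ (n + 1) x ≤ (1 + β n) * ρ n x ∧
      ρ n x ≤ (1 + β n) * ρ (n + 1) x) :
    ∃ G : C(T, ℝ), (∀ x, 0 < G x) ∧ Tendsto ρ atTop (𝓝 G) := by
  obtain ⟨J, hJ⟩ := eventually_atTop.1 h
  let L : ℕ → C(T, ℝ) := fun n => ⟨fun x => Real.log (ρ (n + J) x), by
    apply Continuous.log (by fun_prop)
    intro x
    exact (hJ (n + J) (by omega) x).1.ne'⟩
  have hd : ∀ n, dist (L n) (L n.succ) ≤ |β (n + J)| := by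
    intro n
    rw [ContinuousMap.dist_le (abs_nonneg _)]
    intro x
    have h0 := hJ (n + J) (by omega) x
    have h1 := hJ (n + 1 + J) (by omega) x
    rw [show n + J + 1 = n + 1 + J by ring] at h0
    obtain ⟨h0, h2, h3⟩ := h0
    have h1 := h1.1
    show dist (Real.log (ρ (n + J) x)) (Real.log (ρ (n + 1 + J) x)) ≤ _
    rw [Real.dist_eq, ← Real.log_div h0.ne' h1.ne', abs_le]
    constructor
    · have := Real.log_le_sub_one_of_pos (div_pos h1 h0)
      rw [Real.log_div h1.ne' h0.ne'] at this
      rw [Real.log_div h0.ne' h1.ne']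
      have h4 : ρ (n + 1 + J) x / ρ (n + J) x ≤ 1 + β (n + J) := by
        rw [div_le_iff₀ h0]; exact h2
      have := le_abs_self (β (n + J))
      linarith
    · have := Real.log_le_sub_one_of_pos (div_pos h0 h1)
      have h4 : ρ (n + J) x / ρ (n + 1 + J) x ≤ 1 + β (n + J) := by
        rw [div_le_iff₀ h1]; exact h3
      have := le_abs_self (β (n + J))
      linarith
  have hc : CauchySeq L := cauchySeq_of_dist_le_of_summable _ hd
    ((summable_nat_add_iff J).2 hβ.abs)
  obtain ⟨L0, hL0⟩ := cauchySeq_tendsto_of_complete hc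
  let ex : C(ℝ, ℝ) := ⟨Real.exp, Real.continuous_exp⟩
  refine ⟨ex.comp L0, fun x => Real.exp_pos _, ?_⟩
  rw [← tendsto_add_atTop_iff_nat J]
  have := ((ContinuousMap.continuous_postcomp ex).tendsto L0).comp hL0
  refine this.congr (fun n => ?_)
  ext x
  exact Real.exp_log (hJ (n + J) (by omega) x).1

end Dyn

section Dyn2

variable {T : Type*} [TopologicalSpace T] [CompactSpace T]

def cR (G : C(T, ℝ)) : C(T, ℂ) := (⟨Complex.ofReal, Complex.continuous_ofReal⟩ : C(ℝ, ℂ)).comp G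

lemma cR_tendsto {ρ : ℕ → C(T, ℝ)} {G : C(T, ℝ)} (h : Tendsto ρ atTop (𝓝 G)) :
    Tendsto (fun n => cR (ρ n)) atTop (𝓝 (cR G)) :=
  ((ContinuousMap.continuous_postcomp
    (⟨Complex.ofReal, Complex.continuous_ofReal⟩ : C(ℝ, ℂ))).tendsto G).comp h

def nrm (f : C(T, ℂ)) : C(T, ℝ) := (⟨fun z => ‖z‖, continuous_norm⟩ : C(ℂ, ℝ)).comp f

lemma nrm_tendsto {ρ : ℕ → C(T, ℂ)} {G : C(T, ℂ)} (h : Tendsto ρ atTop (𝓝 G)) :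
    Tendsto (fun n => nrm (ρ n)) atTop (𝓝 (nrm G)) :=
  ((ContinuousMap.continuous_postcomp
    (⟨fun z => ‖z‖, continuous_norm⟩ : C(ℂ, ℝ))).tendsto G).comp h

/-- pointwise two-sided estimate for one step -/
lemma one_step {A B y yp d dp al alp : ℝ} (hA : 1 / 2 ≤ A) (hB0 : 0 ≤ B) (hB : B ≤ 1 / 8)
    (hy : 0 < y) (hd : 0 < d) (hdp : 0 < dp) (hal : 0 < al) (halp : 0 < alp)
    (h1 : yp ≤ (A + B) * y) (h2 : (A - B) * y ≤ yp)
    (hdet : dp * (al / alp) = (A ^ 2 - B ^ 2) * d) :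
    alp * yp ^ 2 / dp ≤ (1 + 6 * B) * (al * y ^ 2 / d) ∧
    al * y ^ 2 / d ≤ (1 + 6 * B) * (alp * yp ^ 2 / dp) := by
  have hm : 0 < A - B := by linarith
  have hp : 0 < A + B := by linarith
  have hypos : 0 < yp := lt_of_lt_of_le (mul_pos hm hy) h2
  have hdp' : dp = (A - B) * (A + B) * d * alp / al := by
    field_simp at hdet ⊢
    linarith
  have key : alp * yp ^ 2 / dp = al * yp ^ 2 / ((A - B) * (A + B) * d) := by
    rw [hdp']; field_simp
  rw [key]
  have h3 : (A + B) ≤ (1 + 6 * B) * (A - B) := by nlinarith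
  constructor
  · rw [div_le_iff₀ (by positivity)]
    have : (1 + 6 * B) * (al * y ^ 2 / d) * ((A - B) * (A + B) * d) =
      al * (((1 + 6 * B) * (A - B)) * (A + B) * y ^ 2) := by field_simp
    rw [this]
    apply mul_le_mul_of_nonneg_left _ hal.le
    calc yp ^ 2 ≤ ((A + B) * y) ^ 2 := pow_le_pow_left₀ hypos.le h1 2
      _ = (A + B) * ((A + B) * y ^ 2) := by ring
      _ ≤ ((1 + 6 * B) * (A - B)) * ((A + B) * y ^ 2) :=
        mul_le_mul_of_nonneg_right h3 (by positivity)
      _ = _ := by ring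
  · rw [div_le_iff₀ hd]
    have : (1 + 6 * B) * (al * yp ^ 2 / ((A - B) * (A + B) * d)) * d =
      al * ((1 + 6 * B) * yp ^ 2 / ((A - B) * (A + B))) := by field_simp
    rw [this]
    apply mul_le_mul_of_nonneg_left _ hal.le
    rw [le_div_iff₀ (by positivity)]
    calc y ^ 2 * ((A - B) * (A + B)) ≤ y ^ 2 * ((A - B) * ((1 + 6 * B) * (A - B))) := by gcongr
      _ = (1 + 6 * B) * ((A - B) * y) ^ 2 := by ring
      _ ≤ (1 + 6 * B) * yp ^ 2 := by gcongr

lemma bdd_of_mul_star {Y : ℕ → C(T, ℂ)} {Z : C(T, ℂ)}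
    (h : Tendsto (fun n => Y n * star (Y n)) atTop (𝓝 Z)) : Y =O[atTop] (fun _ => (1 : ℝ)) := by
  have h1 : Tendsto (fun n => ‖Y n‖) atTop (𝓝 (√ ‖Z‖)) := by
    have := (continuous_sqrt.tendsto _).comp h.norm
    refine this.congr (fun n => ?_)
    simp only [Function.comp]
    rw [CStarRing.norm_self_mul_star, Real.sqrt_mul_self (norm_nonneg _)]
  exact (h1.isBigO_one ℝ).of_norm_left

lemma dyn1 {A B C D p q a b V1 V2 : ℕ → C(T, ℂ)} {p0 q0 l0 : C(T, ℂ)} {α : ℕ → ℝ}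
    (hA : ∀ n, star (A n) = A n) (hB : ∀ n, star (B n) = B n) (hC : ∀ n, star (C n) = C n)
    (hD : ∀ n, star (D n) = D n) (hV1 : ∀ n, star (V1 n) = V1 n) (hV2 : ∀ n, star (V2 n) = V2 n)
    (tp : Tendsto p atTop (𝓝 p0)) (tq : Tendsto q atTop (𝓝 q0)) (ta : Tendsto a atTop (𝓝 l0))
    (hb : Summable fun n => ‖b n‖)
    (hrel : ∀ᶠ n in atTop, p (n + 1) * A n + q (n + 1) * C n = a n * p n + b n * star (p n) ∧
      p (n + 1) * B n + q (n + 1) * D n = a n * q n + b n * star (q n))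
    (hl0 : ∀ x, ‖l0 x‖ = 1) (hu : ∀ x, (star p0 * q0 - p0 * star q0) x ≠ 0)
    (hα : ∀ n, 0 < α n) (hratio : Tendsto (fun n => α (n + 1) / α n) atTop (𝓝 1))
    (hdet : ∀ᶠ n in atTop, ∀ x, (A n * D n - B n * C n) x = ((α n / α (n + 1) : ℝ) : ℂ))
    (hV : ∀ᶠ n in atTop, V1 (n + 1) = A n * V1 n + B n * V2 n ∧
      V2 (n + 1) = C n * V1 n + D n * V2 n)
    (hV0 : ∀ᶠ n in atTop, ∀ x, V1 n x ≠ 0 ∨ V2 n x ≠ 0) :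
    ∃ G : C(T, ℝ), (∀ x, 0 < G x) ∧
      (fun n => (√ (α n)) • V1 n) =O[atTop] (fun _ => (1 : ℝ)) ∧
      (fun n => (√ (α n)) • V2 n) =O[atTop] (fun _ => (1 : ℝ)) ∧
      Tendsto (fun n => (p0 * ((√ (α n)) • V1 n) + q0 * ((√ (α n)) • V2 n)) *
        star (p0 * ((√ (α n)) • V1 n) + q0 * ((√ (α n)) • V2 n))) atTop (𝓝 (cR G)) ∧
      Tendsto (fun n => (p0 * ((√ (α (n + 1))) • V1 (n + 1)) + q0 * ((√ (α (n + 1))) • V2 (n + 1)))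
        - l0 * (p0 * ((√ (α n)) • V1 n) + q0 * ((√ (α n)) • V2 n))) atTop (𝓝 0) := by
  set d : ℕ → C(T, ℂ) := fun n => star (p n) * q n - p n * star (q n) with hd
  set d0 : C(T, ℂ) := star p0 * q0 - p0 * star q0 with hd0
  have hud : IsUnit d0 := ContinuousMap.isUnit_iff_forall_ne_zero _ |>.2 hu
  have td : Tendsto d atTop (𝓝 d0) := (tp.star.mul tq).sub (tp.mul tq.star)
  have hun := eventually_unit td hud
  have hnz : ∀ᶠ n in atTop, ∀ x, d n x ≠ 0 :=
    hun.mono (fun n h => (ContinuousMap.isUnit_iff_forall_ne_zero _).1 h)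
  have tb : Tendsto b atTop (𝓝 0) := by
    rw [tendsto_zero_iff_norm_tendsto_zero]; exact hb.tendsto_atTop_zero
  set y : ℕ → C(T, ℂ) := fun n => p n * V1 n + q n * V2 n with hy
  have hyrec : ∀ᶠ n in atTop, y (n + 1) = a n * y n + b n * star (y n) := by
    filter_upwards [hrel, hV] with n h1 h2
    simp only [hy, h2.1, h2.2, star_add, star_mul', hV1, hV2]
    linear_combination V1 n * h1.1 + V2 n * h1.2
  have hdrec : ∀ᶠ n in atTop, d (n + 1) * (A n * D n - B n * C n) =
      (a n * star (a n) - b n * star (b n)) * d n := by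
    filter_upwards [hrel] with n h1
    obtain ⟨h1, h2⟩ := h1
    have s1 := congrArg star h1
    have s2 := congrArg star h2
    simp only [star_add, star_mul', star_star, hA, hB, hC, hD] at s1 s2
    simp only [hd]
    linear_combination (star (p (n + 1)) * A n + star (q (n + 1)) * C n) * h2
      - (star (p (n + 1)) * B n + star (q (n + 1)) * D n) * h1
      + (a n * q n + b n * star (q n)) * s1 - (a n * p n + b n * star (p n)) * s2
  have hynz : ∀ᶠ n in atTop, ∀ x, y n x ≠ 0 := by
    filter_upwards [hnz, hV0] with n h1 h2 x h3
    have r1 := congrArg (fun f : C(T, ℂ) => f x) (hV1 n)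
    have r2 := congrArg (fun f : C(T, ℂ) => f x) (hV2 n)
    simp only [ContinuousMap.star_apply] at r1 r2
    have h4 := congrArg star h3
    have h5 := h1 x
    simp only [hy, hd, ContinuousMap.add_apply, ContinuousMap.mul_apply, ContinuousMap.sub_apply,
      ContinuousMap.star_apply, star_add, star_mul', star_zero, r1, r2] at h3 h4 h5
    rcases h2 x with h | h
    · apply h
      apply (mul_eq_zero.1 (_ : (star (p n x) * q n x - p n x * star (q n x)) * V1 n x = 0)).resolve_left h5
      linear_combination (-star (q n x)) * h3 + q n x * h4
    · apply h
      apply (mul_eq_zero.1 (_ : (star (p n x) * q n x - p n x * star (q n x)) * V2 n x = 0)).resolve_left h5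
      linear_combination (star (p n x)) * h3 - p n x * h4
  classical
  let ρ : ℕ → C(T, ℝ) := fun n => if h : ∀ x, d n x ≠ 0 then
    ⟨fun x => α n * ‖y n x‖ ^ 2 / ‖d n x‖, by
      apply Continuous.div (by fun_prop) (by fun_prop)
      intro x; exact norm_ne_zero_iff.2 (h x)⟩ else 0
  have hρ : ∀ n, (∀ x, d n x ≠ 0) → ∀ x, ρ n x = α n * ‖y n x‖ ^ 2 / ‖d n x‖ := by
    intro n h x
    simp only [ρ, dif_pos h]
    rfl
  have hlog : ∀ᶠ n in atTop, ∀ x, 0 < ρ n x ∧ ρ (n + 1) x ≤ (1 + 6 * ‖b n‖) * ρ n x ∧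
      ρ n x ≤ (1 + 6 * ‖b n‖) * ρ (n + 1) x := by
    have eb : ∀ᶠ n in atTop, ‖b n‖ ≤ 1 / 8 := by
      have := tb.norm
      rw [norm_zero] at this
      exact (this.eventually (gt_mem_nhds (by norm_num : (0:ℝ) < 1 / 8))).mono (fun n h => le_of_lt h)
    have ea : ∀ᶠ n in atTop, ‖a n - l0‖ ≤ 1 / 2 := by
      have := (ta.sub_const l0).norm
      rw [sub_self, norm_zero] at this
      exact (this.eventually (gt_mem_nhds (by norm_num : (0:ℝ) < 1 / 2))).mono (fun n h => le_of_lt h)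
    filter_upwards [eb, ea, hnz, (tendsto_add_atTop_nat 1).eventually hnz, hynz, hyrec, hdrec, hdet]
      with n h1 h2 h3 h4 h5 h6 h7 h8 x
    have hax : 1 / 2 ≤ ‖a n x‖ := by
      have e1 : ‖a n x - l0 x‖ ≤ 1 / 2 := ((a n - l0).norm_coe_le_norm x).trans h2
      have e2 := norm_sub_norm_le (l0 x) (a n x)
      rw [hl0, norm_sub_rev] at e2
      linarith
    have hbx : ‖b n x‖ ≤ ‖b n‖ := (b n).norm_coe_le_norm x
    have hyx : y (n + 1) x = a n x * y n x + b n x * star (y n x) := by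
      have := congrArg (fun f : C(T, ℂ) => f x) h6
      simpa using! this
    have hdx : ‖d (n + 1) x‖ * (α n / α (n + 1)) = (‖a n x‖ ^ 2 - ‖b n x‖ ^ 2) * ‖d n x‖ := by
      have h9 := congrArg (fun f : C(T, ℂ) => f x) h7
      simp only [ContinuousMap.mul_apply] at h9
      rw [h8 x] at h9
      have h10 := congrArg (fun z : ℂ => ‖z‖) h9
      simp only [norm_mul, ContinuousMap.sub_apply, ContinuousMap.mul_apply,
        ContinuousMap.star_apply] at h10
      rw [Complex.norm_real, Real.norm_of_nonneg (div_pos (hα _) (hα _)).le] at h10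
      rw [h10]
      congr 1
      have : a n x * star (a n x) - b n x * star (b n x) =
          ((‖a n x‖ ^ 2 - ‖b n x‖ ^ 2 : ℝ) : ℂ) := by
        have e1 := Complex.mul_conj' (a n x)
        have e2 := Complex.mul_conj' (b n x)
        push_cast
        rw [← e1, ← e2]; rfl
      rw [this, Complex.norm_real, Real.norm_of_nonneg]
      have := norm_nonneg (b n x)
      nlinarith
    have key := one_step (A := ‖a n x‖) (B := ‖b n x‖) (y := ‖y n x‖) (yp := ‖y (n + 1) x‖)
      (d := ‖d n x‖) (dp := ‖d (n + 1) x‖) (al := α n) (alp := α (n + 1)) hax (norm_nonneg _)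
      (hbx.trans h1) (norm_pos_iff.2 (h5 x)) (norm_pos_iff.2 (h3 x)) (norm_pos_iff.2 (h4 x))
      (hα _) (hα _) ?_ ?_ hdx
    · rw [hρ n h3, hρ (n + 1) h4]
      have p1 : 0 < α n * ‖y n x‖ ^ 2 / ‖d n x‖ :=
        div_pos (mul_pos (hα n) (pow_pos (norm_pos_iff.2 (h5 x)) 2)) (norm_pos_iff.2 (h3 x))
      have p2 : 0 ≤ α (n + 1) * ‖y (n + 1) x‖ ^ 2 / ‖d (n + 1) x‖ :=
        div_nonneg (mul_nonneg (hα _).le (by positivity)) (norm_nonneg _)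
      refine ⟨p1, key.1.trans ?_, key.2.trans ?_⟩
      · apply mul_le_mul_of_nonneg_right _ p1.le; linarith
      · apply mul_le_mul_of_nonneg_right _ p2; linarith
    · rw [hyx]
      refine (norm_add_le _ _).trans ?_
      rw [norm_mul, norm_mul, norm_star, add_mul]
    · rw [hyx]
      have := norm_sub_le_norm_add (a n x * y n x) (b n x * star (y n x))
      rw [norm_mul, norm_mul, norm_star] at this
      linarith
  obtain ⟨G0, hG0, tG0⟩ := log_conv (hb.mul_left 6) hlog
  set G : C(T, ℝ) := G0 * nrm d0 with hG
  set Y : ℕ → C(T, ℂ) := fun n => (√ (α n)) • y n with hY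
  have tY : Tendsto (fun n => Y n * star (Y n)) atTop (𝓝 (cR G)) := by
    refine (cR_tendsto (tG0.mul (nrm_tendsto td))).congr' ?_
    filter_upwards [hnz] with n hn
    ext x
    show ((ρ n x * ‖d n x‖ : ℝ) : ℂ) = (√ (α n) • y n x) * star (√ (α n) • y n x)
    rw [hρ n hn x, div_mul_cancel₀ _ (norm_ne_zero_iff.2 (hn x))]
    rw [star_smul, smul_mul_smul_comm]
    have e1 := Complex.mul_conj' (y n x)
    simp only [star_trivial]
    rw [Real.mul_self_sqrt (hα n).le, Complex.real_smul]
    push_cast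
    rw [← e1]; rfl
  have bY := bdd_of_mul_star tY
  have bsY : (fun n => star (Y n)) =O[atTop] (fun _ => (1 : ℝ)) := by
    refine IsBigO.of_norm_left ?_
    simpa using bY.norm_left
  have tinv := tendsto_inverse_unit td hud
  have bU2 : (fun n => (√ (α n)) • V2 n) =O[atTop] (fun _ => (1 : ℝ)) := by
    have h1 : (fun n => Ring.inverse (d n) * (star (p n) * Y n - p n * star (Y n))) =O[atTop]
        (fun _ => (1 : ℝ)) := by
      simpa using (tinv.isBigO_one ℝ).mul (((tp.star.isBigO_one ℝ).mul bY).sub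
        ((tp.isBigO_one ℝ).mul bsY))
    refine h1.congr' ?_ EventuallyEq.rfl
    filter_upwards [hun] with n hn
    have e := Ring.inverse_mul_cancel _ hn
    simp only [hY, star_smul, star_trivial, hy, star_add, star_mul', hV1, hV2]
    have : star (p n) * √(α n) • (p n * V1 n + q n * V2 n) -
        p n * √(α n) • (star (p n) * V1 n + star (q n) * V2 n) = d n * √(α n) • V2 n := by
      simp only [mul_smul_comm, ← smul_sub]
      congr 1
      simp only [hd]; ring
    rw [this, ← mul_assoc, e, one_mul]
  have bU1 : (fun n => (√ (α n)) • V1 n) =O[atTop] (fun _ => (1 : ℝ)) := by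
    have h1 : (fun n => Ring.inverse (d n) * (q n * star (Y n) - star (q n) * Y n)) =O[atTop]
        (fun _ => (1 : ℝ)) := by
      simpa using (tinv.isBigO_one ℝ).mul (((tq.isBigO_one ℝ).mul bsY).sub
        ((tq.star.isBigO_one ℝ).mul bY))
    refine h1.congr' ?_ EventuallyEq.rfl
    filter_upwards [hun] with n hn
    have e := Ring.inverse_mul_cancel _ hn
    simp only [hY, star_smul, star_trivial, hy, star_add, star_mul', hV1, hV2]
    have : q n * √(α n) • (star (p n) * V1 n + star (q n) * V2 n) -
        star (q n) * √(α n) • (p n * V1 n + q n * V2 n) = d n * √(α n) • V1 n := by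
      simp only [mul_smul_comm, ← smul_sub]
      congr 1
      simp only [hd]; ring
    rw [this, ← mul_assoc, e, one_mul]
  set Z : ℕ → C(T, ℂ) := fun n => p0 * ((√ (α n)) • V1 n) + q0 * ((√ (α n)) • V2 n) with hZ
  have tZY : Tendsto (fun n => Z n - Y n) atTop (𝓝 0) := by
    have h1 : (fun n => p0 - p n) =o[atTop] (fun _ => (1 : ℝ)) := by
      rw [isLittleO_one_iff]; simpa using tp.const_sub p0
    have h2 : (fun n => q0 - q n) =o[atTop] (fun _ => (1 : ℝ)) := by
      rw [isLittleO_one_iff]; simpa using tq.const_sub q0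
    have h3 := (h1.mul_isBigO bU1).add (h2.mul_isBigO bU2)
    simp only [one_mul] at h3
    refine ((isLittleO_one_iff ℝ).1 h3).congr (fun n => ?_)
    simp only [hZ, hY, hy, smul_add, ← mul_smul_comm]
    ring
  have bsc : Tendsto (fun n => √ (α (n + 1) / α n)) atTop (𝓝 1) := by
    have := hratio.sqrt
    rwa [Real.sqrt_one] at this
  have tYr : Tendsto (fun n => Y (n + 1) - l0 * Y n) atTop (𝓝 0) := by
    have h1 : (fun n => (√ (α (n + 1) / α n)) • a n - l0) =o[atTop] (fun _ => (1 : ℝ)) := by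
      rw [isLittleO_one_iff]; simpa using (bsc.smul ta).sub_const l0
    have h2 : (fun n => (√ (α (n + 1) / α n)) • b n) =o[atTop] (fun _ => (1 : ℝ)) := by
      rw [isLittleO_one_iff]; simpa using (bsc.smul tb)
    have h3 := (h1.mul_isBigO bY).add (h2.mul_isBigO bsY)
    simp only [one_mul] at h3
    refine ((isLittleO_one_iff ℝ).1 h3).congr' ?_
    filter_upwards [hyrec] with n hn
    have e : √ (α (n + 1)) = √ (α (n + 1) / α n) * √ (α n) := by
      rw [← Real.sqrt_mul (div_pos (hα _) (hα _)).le, div_mul_cancel₀ _ (hα n).ne']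
    simp only [hY]
    rw [hn, e]
    ext x
    simp only [star_smul, star_trivial, ContinuousMap.add_apply, ContinuousMap.sub_apply,
      ContinuousMap.mul_apply, ContinuousMap.smul_apply, Complex.real_smul]
    push_cast
    ring
  refine ⟨G, ?_, bU1, bU2, ?_, ?_⟩
  · intro x
    exact mul_pos (hG0 x) (norm_pos_iff.2 (hu x))
  · have bZ : Z =O[atTop] (fun _ => (1 : ℝ)) := by
      have := bY.add (tZY.isBigO_one ℝ)
      simpa using this
    have o1 : (fun n => Z n - Y n) =o[atTop] (fun _ => (1 : ℝ)) := (isLittleO_one_iff ℝ).2 tZY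
    have o2 : (fun n => star (Z n - Y n)) =o[atTop] (fun _ => (1 : ℝ)) := by
      rw [isLittleO_one_iff]; simpa using tZY.star
    have h3 := (o1.mul_isBigO bsY).add (bZ.mul_isLittleO o2)
    simp only [one_mul] at h3
    have := ((isLittleO_one_iff ℝ).1 h3).add tY
    rw [zero_add] at this
    refine this.congr (fun n => ?_)
    rw [star_sub]; ring
  · have h1 := (tZY.comp (tendsto_add_atTop_nat 1)).add (tYr.sub (tZY.const_mul l0))
    simp only [mul_zero, sub_zero, add_zero] at h1
    refine h1.congr (fun n => ?_)
    simp only [Function.comp]; ring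

end Dyn2

section CtrlEx

lemma smooth_majorant {δ : ℕ → ℝ} (h0 : ∀ n, 0 ≤ δ n) (hs : Summable δ) :
    ∃ D : ℕ → ℝ, (∀ n, δ n ≤ D n) ∧ Summable D ∧ ∀ n, D (n + 1) ≤ 2 * D n := by
  have hle : ∀ n, δ n ≤ ∑' k, δ k := fun n => hs.le_tsum n (fun j _ => h0 j)
  set S := ∑' k, δ k with hS
  have hg : Summable (fun k : ℕ => (1 / 2 : ℝ) ^ k * S) :=
    (summable_geometric_of_lt_one (by norm_num) (by norm_num)).mul_right S
  have hsk : ∀ n, Summable (fun k : ℕ => (1 / 2 : ℝ) ^ k * δ (n + k)) := by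
    intro n
    refine Summable.of_nonneg_of_le (fun k => mul_nonneg (by positivity) (h0 _)) (fun k => ?_) hg
    exact mul_le_mul_of_nonneg_left (hle _) (by positivity)
  set D : ℕ → ℝ := fun n => ∑' k : ℕ, (1 / 2 : ℝ) ^ k * δ (n + k) with hD
  have hD0 : ∀ n, 0 ≤ D n := fun n => tsum_nonneg (fun k => mul_nonneg (by positivity) (h0 _))
  have hrec : ∀ n, D n = δ n + D (n + 1) / 2 := by
    intro n
    simp only [hD]
    rw [(hsk n).tsum_eq_zero_add]
    simp only [pow_zero, one_mul, add_zero]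
    congr 1
    rw [← tsum_div_const]
    refine tsum_congr (fun k => ?_)
    rw [show n + 1 + k = n + (k + 1) by ring]
    ring
  have hDb : ∀ n, D n ≤ 2 * S := by
    intro n
    have h1 : D n ≤ ∑' k : ℕ, (1 / 2 : ℝ) ^ k * S :=
      (hsk n).tsum_le_tsum (fun k => mul_le_mul_of_nonneg_left (hle _) (by positivity)) hg
    rw [tsum_mul_right, tsum_geometric_two] at h1
    exact h1
  have hS0 : 0 ≤ S := tsum_nonneg h0
  refine ⟨D, fun n => ?_, ?_, fun n => ?_⟩
  · have := hD0 (n + 1); linarith [hrec n]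
  · refine summable_of_sum_range_le (c := 4 * S) hD0 (fun n => ?_)
    have h1 : ∑ k ∈ Finset.range n, D k = ∑ k ∈ Finset.range n, δ k +
        (∑ k ∈ Finset.range n, D (k + 1)) / 2 := by
      rw [Finset.sum_div, ← Finset.sum_add_distrib]
      exact Finset.sum_congr rfl (fun k _ => hrec k)
    have h2 : ∑ k ∈ Finset.range n, D (k + 1) = ∑ k ∈ Finset.range n, D k + D n - D 0 := by
      have := Finset.sum_range_succ D n
      rw [Finset.sum_range_succ'] at this
      linarith
    have h3 : ∑ k ∈ Finset.range n, δ k ≤ S := hs.sum_le_tsum _ (fun j _ => h0 j)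
    have := hDb n
    have := hD0 0
    linarith
  · linarith [hrec n, h0 n]

lemma ctrl_exists {r : ℕ} (hr : 0 < r) {d : ℕ → ℕ → ℝ} (h0 : ∀ m n, 0 ≤ d m n)
    (hs : ∀ m ∈ Finset.Icc 1 r, Summable fun n => d m n ^ ((r : ℝ) / m)) :
    ∃ ε : ℕ → ℝ, Ctrl ε r ∧ (Summable fun n => ε n ^ r) ∧
      ∀ m ∈ Finset.Icc 1 r, ∀ n, d m n ≤ ε n ^ m := by
  obtain ⟨D, h1, h2, h3⟩ := smooth_majorant
    (δ := fun n => ∑ m ∈ Finset.Icc 1 r, d m n ^ ((r : ℝ) / m))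
    (fun n => Finset.sum_nonneg (fun m _ => rpow_nonneg (h0 m n) _)) (summable_sum hs)
  have hD0 : ∀ n, 0 ≤ D n := fun n =>
    (Finset.sum_nonneg (fun m _ => rpow_nonneg (h0 m n) _)).trans (h1 n)
  have hr' : (0 : ℝ) < r := by exact_mod_cast hr
  have hpow : ∀ n, (D n ^ ((1 : ℝ) / r)) ^ r = D n := by
    intro n
    rw [← rpow_natCast, ← rpow_mul (hD0 n), one_div_mul_cancel hr'.ne', rpow_one]
  refine ⟨fun n => D n ^ ((1 : ℝ) / r), ⟨fun n => rpow_nonneg (hD0 n) _, ?_, fun n => ?_, hr⟩, ?_, ?_⟩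
  · have := h2.tendsto_atTop_zero.rpow_const (p := (1 : ℝ) / r) (Or.inr (by positivity))
    rwa [zero_rpow (by positivity)] at this
  · refine (rpow_le_rpow (hD0 _) (h3 n) (by positivity)).trans ?_
    rw [mul_rpow (by norm_num) (hD0 n)]
    refine mul_le_mul_of_nonneg_right ?_ (rpow_nonneg (hD0 n) _)
    calc (2 : ℝ) ^ ((1 : ℝ) / r) ≤ 2 ^ (1 : ℝ) := by
          apply rpow_le_rpow_of_exponent_le (by norm_num)
          rw [div_le_one hr']
          exact_mod_cast hr
      _ = 2 := rpow_one 2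
  · simpa only [hpow] using h2
  · intro m hm n
    have hm1 : 1 ≤ m := (Finset.mem_Icc.1 hm).1
    have hm0 : (0 : ℝ) < m := by exact_mod_cast hm1
    have h4 : d m n ^ ((r : ℝ) / m) ≤ D n :=
      (Finset.single_le_sum (f := fun m : ℕ => d m n ^ ((r : ℝ) / m))
        (fun m _ => rpow_nonneg (h0 m n) _) hm).trans (h1 n)
    have h5 := rpow_le_rpow (rpow_nonneg (h0 m n) _) h4 (by positivity : 0 ≤ (m : ℝ) / r)
    rw [← rpow_mul (h0 m n), div_mul_div_cancel₀ hm0.ne', div_self hr'.ne', rpow_one] at h5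
    refine h5.trans (le_of_eq ?_)
    rw [← rpow_natCast, ← rpow_mul (hD0 n)]
    congr 1
    ring

/-- Extending control from orders `≤ r` to all orders. -/
lemma CA_of_le {E : Type*} [NormedCommRing E] {ε : ℕ → ℝ} {r : ℕ} (h : Ctrl ε r) {f : ℕ → E}
    (hf : ∀ m ≤ r, (fun n => iterDiff f m n) =O[atTop] (fun n => ε n ^ m)) : CA ε r 0 f := by
  have key : ∀ m, (fun n => iterDiff f m n) =O[atTop] (fun n => ε n ^ (min m r)) := by
    intro m
    induction m with
    | zero => simpa using hf 0 (Nat.zero_le _)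
    | succ m ih =>
      by_cases hm : m + 1 ≤ r
      · rw [min_eq_left hm]; exact hf _ hm
      · rw [show min (m + 1) r = min m r by omega]
        have h1 := (ih.comp_tendsto (tendsto_add_atTop_nat 1)).trans (h.shift_pow (min m r))
        exact h1.sub ih
  intro M m _
  simpa using key m

end CtrlEx

section Concrete

variable (a b : ℕ → ℝ)

lemma opoly_rec (ha : ∀ n, 0 < a n) (n : ℕ) (x : ℝ) :
    a (n + 1) * opoly a b (n + 2) x = (x - b (n + 1)) * opoly a b (n + 1) x - a n * opoly a b n x := by
  show a (n + 1) * (((x - b (n + 1)) * opoly a b (n + 1) x - a n * opoly a b n x) / a (n + 1)) = _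
  rw [mul_div_cancel₀ _ (ha (n + 1)).ne']

lemma opoly_not_both (ha : ∀ n, 0 < a n) (x : ℝ) : ∀ n, opoly a b n x ≠ 0 ∨ opoly a b (n + 1) x ≠ 0 := by
  intro n
  induction n with
  | zero => left; simp [opoly]
  | succ n ih =>
    by_contra! h
    obtain ⟨h1, h2⟩ := h
    have := opoly_rec a b ha n x
    rw [show n + 1 + 1 = n + 2 by ring] at h2
    rw [h1, h2] at this
    have h3 : opoly a b n x = 0 := by
      have h4 := (ha n).ne'
      have : a n * opoly a b n x = 0 := by linarith
      exact (mul_eq_zero.1 this).resolve_left h4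
    rcases ih with h | h
    · exact h h3
    · exact h h1

lemma opoly_cont (n : ℕ) : Continuous (opoly a b n) := by
  induction n using Nat.strong_induction_on with
  | _ n ih =>
    match n with
    | 0 => exact continuous_const
    | 1 => show Continuous fun x => (x - b 0) / a 0; fun_prop
    | (n + 2) =>
      have h1 := ih n (by omega)
      have h2 := ih (n + 1) (by omega)
      show Continuous fun x => ((x - b (n + 1)) * opoly a b (n + 1) x - a n * opoly a b n x) / a (n + 1)
      fun_prop

lemma Bmat_cont (n : ℕ) : Continuous (Bmat a b n) := by
  refine continuous_pi (fun j => continuous_pi (fun k => ?_))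
  unfold Bmat
  fin_cases j <;> fin_cases k <;> simp <;> fun_prop

lemma Xmat_cont (N n : ℕ) : Continuous (Xmat a b N n) := by
  unfold Xmat
  induction N with
  | zero => exact continuous_const
  | succ N ih => exact (Bmat_cont a b (n + N)).matrix_mul ih

lemma prodD_det (ha : ∀ n, 0 < a n) (m : ℕ) (hm : 1 ≤ m) (x : ℝ) (k : ℕ) :
    (Xmat a b k m x).det = a (m - 1) / a (m + k - 1) := by
  unfold Xmat
  induction k with
  | zero => simp [prodD, (ha (m - 1)).ne']
  | succ k ih =>
    rw [prodD, Matrix.det_mul, ih, Bmat, Matrix.det_fin_two_of]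
    rw [show m + (k + 1) - 1 = m + k by omega]
    have := (ha (m + k - 1)).ne'
    have := (ha (m + k)).ne'
    field_simp
    ring

lemma prodD_vec (ha : ∀ n, 0 < a n) (m : ℕ) (hm : 1 ≤ m) (x : ℝ) (k : ℕ) :
    opoly a b (m + k - 1) x = Xmat a b k m x 0 0 * opoly a b (m - 1) x + Xmat a b k m x 0 1 * opoly a b m x ∧
    opoly a b (m + k) x = Xmat a b k m x 1 0 * opoly a b (m - 1) x + Xmat a b k m x 1 1 * opoly a b m x := by
  unfold Xmat
  induction k with
  | zero => simp [prodD]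
  | succ k ih =>
    rw [prodD]
    simp only [Matrix.mul_apply, Fin.sum_univ_two, Bmat, Matrix.of_apply, Matrix.cons_val', Matrix.cons_val_zero,
      Matrix.cons_val_one, Matrix.cons_val_fin_one]
    rw [show m + (k + 1) - 1 = m + k by omega]
    obtain ⟨i1, i2⟩ := ih
    constructor
    · rw [i2]; simp only [Bmat]; ring
    · obtain ⟨l, hl⟩ : ∃ l, m + k = l + 1 := ⟨m + k - 1, by omega⟩
      have hr := opoly_rec a b ha l x
      rw [show m + (k + 1) = l + 2 by omega]
      rw [show m + k - 1 = l by omega] at i1 ⊢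
      rw [hl] at i2 ⊢
      have := (ha (l + 1)).ne'
      simp only [Bmat] at i1 i2 ⊢
      have e : opoly a b (l + 2) x = ((x - b (l + 1)) * opoly a b (l + 1) x - a l * opoly a b l x) / a (l + 1) := rfl
      rw [e, i1, i2]
      field_simp
      ring

lemma iterDiff_fun_cont (F : ℕ → ℝ → Mat2) (hF : ∀ n, Continuous (F n)) (m : ℕ) :
    ∀ n, Continuous (iterDiff F m n) := by
  induction m with
  | zero => exact hF
  | succ m ih => intro n; exact (ih (n + 1)).sub (ih n)

/-- entries of the transfer matrices as continuous functions -/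
def ent (N i : ℕ) (u v : ℝ) (j k : Fin 2) (n : ℕ) : C(Set.Icc u v, ℂ) :=
  ⟨fun x => ((Xmat a b N (n * N + i) (x : ℝ) j k : ℝ) : ℂ), by
    have := ((Xmat_cont a b N (n * N + i)).matrix_elem j k)
    fun_prop⟩

lemma ent_diff (N i : ℕ) (u v : ℝ) (j k : Fin 2) (m n : ℕ) (x : Set.Icc u v) :
    iterDiff (ent a b N i u v j k) m n x =
      ((iterDiff (fun j x => Xmat a b N (j * N + i) x) m n (x : ℝ) j k : ℝ) : ℂ) := by
  induction m generalizing n with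
  | zero => rfl
  | succ m ih =>
    show (iterDiff (ent a b N i u v j k) m (n + 1) - iterDiff (ent a b N i u v j k) m n) x = _
    rw [ContinuousMap.sub_apply, ih, ih]
    simp [iterDiff]

lemma ent_diff_le (N i : ℕ) (u v : ℝ) (j k : Fin 2) (m n : ℕ) :
    ‖iterDiff (ent a b N i u v j k) m n‖ ≤
      ⨆ x : Set.Icc u v, ‖iterDiff (fun j x => Xmat a b N (j * N + i) x) m n (x : ℝ)‖ := by
  have hc := iterDiff_fun_cont (fun j x => Xmat a b N (j * N + i) x)
    (fun n => Xmat_cont a b N (n * N + i)) m n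
  have hb : BddAbove (Set.range fun x : Set.Icc u v =>
      ‖iterDiff (fun j x => Xmat a b N (j * N + i) x) m n (x : ℝ)‖) := by
    apply IsCompact.bddAbove
    exact isCompact_range ((hc.comp continuous_subtype_val).norm)
  rw [ContinuousMap.norm_le _ (Real.iSup_nonneg (fun _ => norm_nonneg _))]
  intro x
  rw [ent_diff, Complex.norm_real]
  exact (Matrix.norm_entry_le_entrywise_sup_norm _).trans (le_ciSup hb x)

lemma ent_tendsto (N i : ℕ) (u v : ℝ) (j k : Fin 2) (XX : ℝ → Mat2)
    (hXX : TendstoUniformlyOn (fun j x => Xmat a b N (j * N + i) x) XX atTop (Set.Icc u v)) :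
    ∃ c : C(Set.Icc u v, ℝ), (∀ x, c x = XX x j k) ∧
      Tendsto (ent a b N i u v j k) atTop (𝓝 (cR c)) := by
  have h1 : TendstoUniformlyOn (fun n x => Xmat a b N (n * N + i) x j k) (fun x => XX x j k) atTop
      (Set.Icc u v) := by
    have hu : UniformContinuous (fun M : Mat2 => M j k) :=
      (Pi.uniformContinuous_proj (fun _ : Fin 2 => ℝ) k).comp
        (Pi.uniformContinuous_proj (fun _ : Fin 2 => Fin 2 → ℝ) j)
    exact hu.comp_tendstoUniformlyOn hXX
  have hc : ContinuousOn (fun x => XX x j k) (Set.Icc u v) :=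
    h1.continuousOn (Frequently.of_forall (fun n =>
      ((Xmat_cont a b N (n * N + i)).matrix_elem j k).continuousOn))
  refine ⟨⟨fun x => XX x j k, continuousOn_iff_continuous_domRestrict.1 hc⟩, fun x => rfl, ?_⟩
  rw [ContinuousMap.tendsto_iff_tendstoUniformly, Metric.tendstoUniformly_iff]
  intro ε hε
  filter_upwards [Metric.tendstoUniformlyOn_iff.1 h1 ε hε] with n hn x
  have := hn x x.2
  rw [dist_eq_norm] at this ⊢
  rw [← Complex.norm_real] at this
  push_cast at this
  exact this

end Concrete

section Abs

variable {T : Type*} [TopologicalSpace T] [CompactSpace T]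

lemma cR_apply (G : C(T, ℝ)) (x : T) : cR G x = ((G x : ℝ) : ℂ) := rfl

lemma star_cR (G : C(T, ℝ)) : star (cR G) = cR G := by
  ext x; simp [cR_apply]

def sqm : C(ℂ, ℂ) := ⟨fun z => ((√ (-z.re) : ℝ) : ℂ), by fun_prop⟩

lemma cesaro_part {V2 Z : ℕ → C(T, ℂ)} {l0 : C(T, ℂ)} {s0 G : C(T, ℝ)} {α : ℕ → ℝ}
    (hα : ∀ n, 0 < α n) (hratio : Tendsto (fun n => α (n + 1) / α n) atTop (𝓝 1))
    (hW : Tendsto (fun n => ∑ j ∈ Finset.range n, 1 / α j) atTop atTop)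
    (hs0 : ∀ x, 0 < s0 x)
    (hl : l0 * star l0 = 1) (hls : ∀ x, (l0 - star l0) x ≠ 0)
    (hZ : ∀ n, Z n - star (Z n) = ContinuousMap.const T Complex.I * cR s0 * ((√ (α n)) • V2 n))
    (tZ : Tendsto (fun n => Z n * star (Z n)) atTop (𝓝 (cR G)))
    (tZr : Tendsto (fun n => Z (n + 1) - l0 * Z n) atTop (𝓝 0)) :
    Tendsto (fun n => (∑ j ∈ Finset.range n, 1 / α j)⁻¹ • ∑ j ∈ Finset.range n, V2 j * V2 j) atTop
      (𝓝 (cR ⟨fun x => 2 * G x / (s0 x) ^ 2, by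
        apply Continuous.div (by fun_prop) (by fun_prop); intro x; exact (pow_pos (hs0 x) 2).ne'⟩)) := by
  have hw : ∀ n, 0 < 1 / α n := fun n => one_div_pos.2 (hα n)
  have hwr : Tendsto (fun n => (1 / α (n + 1)) / (1 / α n)) atTop (𝓝 1) := by
    have := hratio.inv₀ one_ne_zero
    rw [inv_one] at this
    refine this.congr (fun n => ?_)
    have := (hα n).ne'
    have := (hα (n + 1)).ne'
    field_simp
  have bZ := bdd_of_mul_star tZ
  have hb : (fun n => Z n * Z n) =O[atTop] (fun _ => (1 : ℝ)) := by simpa using bZ.mul bZ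
  have hh : Tendsto (fun n => Z (n + 1) * Z (n + 1) - (l0 * l0) * (Z n * Z n)) atTop (𝓝 0) := by
    have o1 := (isLittleO_one_iff ℝ).2 tZr
    have b1 : (fun n => Z (n + 1) + l0 * Z n) =O[atTop] (fun _ => (1 : ℝ)) := by
      have h1 : (fun n => Z (n + 1)) =O[atTop] (fun _ => (1 : ℝ)) :=
        bZ.comp_tendsto (tendsto_add_atTop_nat 1)
      exact h1.add (bZ.const_mul_left l0)
    have := o1.mul_isBigO b1
    simp only [one_mul] at this
    refine ((isLittleO_one_iff ℝ).1 this).congr (fun n => ?_)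
    ring
  have hκ : IsUnit (1 - l0 * l0) := by
    rw [show 1 - l0 * l0 = l0 * (-(l0 - star l0)) by rw [← hl]; ring]
    refine (IsUnit.of_mul_eq_one _ hl).mul ?_
    exact ((ContinuousMap.isUnit_iff_forall_ne_zero _).2 hls).neg
  have c1 := cesaro_osc hw hwr hW hb hh hκ
  have c2 : (fun n => ∑ j ∈ Finset.range n, (1 / α j) • star (Z j * Z j)) =o[atTop]
      (fun n => ∑ j ∈ Finset.range n, 1 / α j) := by
    refine IsLittleO.of_norm_left ?_
    refine c1.norm_left.congr_left (fun n => ?_)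
    rw [← norm_star]
    congr 1
    simp [star_sum]
  have c3 := cesaro_zero hw hW (h := fun n => Z n * star (Z n) - cR G) (by
    simpa using tZ.sub_const (cR G))
  have c4 := ((c3.add c3).sub c1).sub c2
  set W : ℕ → ℝ := fun n => ∑ j ∈ Finset.range n, 1 / α j with hWdef
  set S : ℕ → C(T, ℂ) := fun n => ∑ j ∈ Finset.range n, V2 j * V2 j with hS
  have hsq : ∀ j, Z j * star (Z j) - cR G + (Z j * star (Z j) - cR G) - Z j * Z j - star (Z j * Z j)
      = (α j) • (cR s0 * cR s0 * (V2 j * V2 j)) - (cR G + cR G) := by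
    intro j
    have h1 : (Z j - star (Z j)) * (Z j - star (Z j)) =
        -((α j) • (cR s0 * cR s0 * (V2 j * V2 j))) := by
      rw [hZ j]
      ext x
      simp only [ContinuousMap.mul_apply, ContinuousMap.const_apply, ContinuousMap.smul_apply,
        ContinuousMap.neg_apply, Complex.real_smul]
      have : ((√ (α j) : ℝ) : ℂ) * ((√ (α j) : ℝ) : ℂ) = ((α j : ℝ) : ℂ) := by
        rw [← Complex.ofReal_mul, Real.mul_self_sqrt (hα j).le]
      rw [← this]
      linear_combination ((cR s0 x) ^ 2 * (√ (α j) : ℝ) ^ 2 * (V2 j x) ^ 2) * Complex.I_mul_I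
    rw [star_mul']
    linear_combination -h1
  have c5 : (fun n => cR s0 * cR s0 * S n - (W n) • (cR G + cR G)) =o[atTop] W := by
    refine c4.congr_left (fun n => ?_)
    rw [← Finset.sum_add_distrib, ← Finset.sum_sub_distrib, ← Finset.sum_sub_distrib]
    simp only [← smul_add, ← smul_sub, hsq]
    simp only [hS, hWdef, Finset.mul_sum, Finset.sum_smul]
    rw [← Finset.sum_sub_distrib]
    refine Finset.sum_congr rfl (fun j _ => ?_)
    rw [smul_sub, smul_smul, one_div_mul_cancel (hα j).ne', one_smul]
  have c6 : Tendsto (fun n => (W n)⁻¹ • (cR s0 * cR s0 * S n - (W n) • (cR G + cR G))) atTop (𝓝 0) := by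
    rw [tendsto_zero_iff_norm_tendsto_zero]
    have := c5.norm_left.norm_right.tendsto_div_nhds_zero
    refine this.congr (fun n => ?_)
    rw [norm_smul, norm_inv, div_eq_inv_mul]
  have c7 : Tendsto (fun n => (W n)⁻¹ • (cR s0 * cR s0 * S n)) atTop (𝓝 (cR G + cR G)) := by
    have := c6.add_const (cR G + cR G)
    rw [zero_add] at this
    refine this.congr' ?_
    filter_upwards [hW.eventually_gt_atTop 0] with n hn
    rw [smul_sub, smul_smul, inv_mul_cancel₀ hn.ne', one_smul, sub_add_cancel]
  have c8 := c7.const_mul (cR ⟨fun x => 1 / (s0 x) ^ 2, by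
        apply Continuous.div (by fun_prop) (by fun_prop); intro x; exact (pow_pos (hs0 x) 2).ne'⟩)
  convert c8 using 1
  · ext n x
    have : (s0 x : ℂ) ≠ 0 := by exact_mod_cast (hs0 x).ne'
    simp only [ContinuousMap.mul_apply, ContinuousMap.smul_apply, cR_apply, ContinuousMap.coe_mk,
      Complex.real_smul]
    simp only [hWdef, hS]
    push_cast
    field_simp
  · congr 1
    ext x
    have : (s0 x : ℂ) ≠ 0 := by exact_mod_cast (hs0 x).ne'
    simp only [ContinuousMap.mul_apply, ContinuousMap.add_apply, cR_apply, ContinuousMap.coe_mk]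
    push_cast
    field_simp
    ring

lemma partA_abs {ε : ℕ → ℝ} {r : ℕ} (h : Ctrl ε r) (hsum : Summable fun n => ε n ^ r)
    {A B C D V1 V2 : ℕ → C(T, ℂ)} {A0 B0 C0 D0 : C(T, ℝ)} {α : ℕ → ℝ}
    (hA : ∀ n, star (A n) = A n) (hB : ∀ n, star (B n) = B n) (hC : ∀ n, star (C n) = C n)
    (hD : ∀ n, star (D n) = D n) (hV1 : ∀ n, star (V1 n) = V1 n) (hV2 : ∀ n, star (V2 n) = V2 n)
    (cA : CA ε r 0 A) (cB : CA ε r 0 B) (cC : CA ε r 0 C) (cD : CA ε r 0 D)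
    (tA : Tendsto A atTop (𝓝 (cR A0))) (tB : Tendsto B atTop (𝓝 (cR B0)))
    (tC : Tendsto C atTop (𝓝 (cR C0))) (tD : Tendsto D atTop (𝓝 (cR D0)))
    (hdisc : ∀ x, (A0 x + D0 x) ^ 2 - 4 * (A0 x * D0 x - B0 x * C0 x) < 0)
    (hα : ∀ n, 0 < α n) (hratio : Tendsto (fun n => α (n + 1) / α n) atTop (𝓝 1))
    (hdet : ∀ᶠ n in atTop, ∀ x, (A n * D n - B n * C n) x = ((α n / α (n + 1) : ℝ) : ℂ))
    (hV : ∀ᶠ n in atTop, V1 (n + 1) = A n * V1 n + B n * V2 n ∧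
      V2 (n + 1) = C n * V1 n + D n * V2 n)
    (hV0 : ∀ᶠ n in atTop, ∀ x, V1 n x ≠ 0 ∨ V2 n x ≠ 0)
    (hW : Tendsto (fun n => ∑ j ∈ Finset.range n, 1 / α j) atTop atTop) :
    ∃ (s0 G : C(T, ℝ)) (q0 : C(T, ℂ)) (g : C(T, ℝ)),
      (∀ x, s0 x = √ (-((A0 x + D0 x) ^ 2 - 4 * (A0 x * D0 x - B0 x * C0 x)))) ∧ (∀ x, 0 < s0 x) ∧
      (∀ x, 0 < G x) ∧ (∀ x, q0 x = ((D0 x - A0 x : ℝ) + Complex.I * (s0 x : ℝ)) / 2) ∧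
      (∀ x, g x = 2 * G x / (s0 x) ^ 2) ∧
      (fun n => (√ (α n)) • V1 n) =O[atTop] (fun _ => (1 : ℝ)) ∧
      (fun n => (√ (α n)) • V2 n) =O[atTop] (fun _ => (1 : ℝ)) ∧
      Tendsto (fun n => (cR C0 * ((√ (α n)) • V1 n) + q0 * ((√ (α n)) • V2 n)) *
        star (cR C0 * ((√ (α n)) • V1 n) + q0 * ((√ (α n)) • V2 n))) atTop (𝓝 (cR G)) ∧
      Tendsto (fun n => (∑ j ∈ Finset.range n, 1 / α j)⁻¹ • ∑ j ∈ Finset.range n, V2 j * V2 j) atTop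
        (𝓝 (cR g)) := by
  set ii : C(T, ℂ) := ContinuousMap.const T Complex.I with hii
  set hh : C(T, ℂ) := ContinuousMap.const T (1 / 2) with hhh
  have iimul : ii * ii = -1 := by ext x; simp [hii]
  have iist : star ii = -ii := by ext x; simp [hii]
  have hh2 : hh + hh = 1 := by ext x; simp [hhh]; norm_num
  have hhst : star hh = hh := by ext x; simp [hhh]
  set s0 : C(T, ℝ) := ⟨fun x => √ (-((A0 x + D0 x) ^ 2 - 4 * (A0 x * D0 x - B0 x * C0 x))), by fun_prop⟩ with hs0
  have s0pos : ∀ x, 0 < s0 x := fun x => Real.sqrt_pos.2 (by linarith [hdisc x])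
  have s0sq : ∀ x, s0 x ^ 2 = -((A0 x + D0 x) ^ 2 - 4 * (A0 x * D0 x - B0 x * C0 x)) :=
    fun x => Real.sq_sqrt (by linarith [hdisc x])
  have C0ne : ∀ x, C0 x ≠ 0 := by
    intro x h0
    have := hdisc x
    rw [h0] at this
    nlinarith [sq_nonneg (A0 x - D0 x)]
  set dn : ℕ → C(T, ℂ) := fun n => (A n + D n) * (A n + D n) - (4 : ℂ) • (A n * D n - B n * C n) with hdn
  set s : ℕ → C(T, ℂ) := fun n => sqm.comp (dn n) with hs
  have tdn : Tendsto dn atTop (𝓝 ((cR A0 + cR D0) * (cR A0 + cR D0) -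
      (4 : ℂ) • (cR A0 * cR D0 - cR B0 * cR C0))) :=
    ((tA.add tD).mul (tA.add tD)).sub (((tA.mul tD).sub (tB.mul tC)).const_smul _)
  have ts : Tendsto s atTop (𝓝 (cR s0)) := by
    have := ((ContinuousMap.continuous_postcomp sqm).tendsto _).comp tdn
    have e : cR s0 = sqm.comp ((cR A0 + cR D0) * (cR A0 + cR D0) -
      (4 : ℂ) • (cR A0 * cR D0 - cR B0 * cR C0)) := by
      ext x
      show ((√ (-((A0 x + D0 x) ^ 2 - 4 * (A0 x * D0 x - B0 x * C0 x))) : ℝ) : ℂ) =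
        ((√ (-(((A0 x : ℂ) + D0 x) * (A0 x + D0 x) - 4 * (A0 x * D0 x - B0 x * C0 x)).re) : ℝ) : ℂ)
      have e2 : ((A0 x : ℂ) + D0 x) * (A0 x + D0 x) - 4 * (A0 x * D0 x - B0 x * C0 x) =
        (((A0 x + D0 x) ^ 2 - 4 * (A0 x * D0 x - B0 x * C0 x) : ℝ) : ℂ) := by push_cast; ring
      rw [e2, Complex.ofReal_re]
    rw [e]
    exact this
  have us0 : IsUnit (cR s0) := (ContinuousMap.isUnit_iff_forall_ne_zero _).2 (fun x => by
    rw [cR_apply]; exact_mod_cast (s0pos x).ne')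
  have hss : ∀ᶠ n in atTop, s n * s n = -(dn n) := by
    filter_upwards [eventually_unit ts us0] with n hn
    ext x
    have h1 : s n x ≠ 0 := (ContinuousMap.isUnit_iff_forall_ne_zero _).1 hn x
    have hre : star (dn n) = dn n := by
      simp only [hdn, star_sub, star_mul', star_add, star_smul, hA, hB, hC, hD]
      congr 2
      simp
    have hrex : (((dn n x).re : ℝ) : ℂ) = dn n x := by
      have := congrArg (fun f : C(T, ℂ) => f x) hre
      simp only [ContinuousMap.star_apply] at this
      exact Complex.conj_eq_iff_re.1 this
    simp only [hs, ContinuousMap.comp_apply, sqm, ContinuousMap.coe_mk] at h1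
    have h2 : 0 < -(dn n x).re := by
      by_contra hneg
      apply h1
      rw [Real.sqrt_eq_zero_of_nonpos (not_lt.1 hneg)]
      simp
    simp only [hs, ContinuousMap.mul_apply, ContinuousMap.comp_apply, sqm, ContinuousMap.coe_mk,
      ContinuousMap.neg_apply]
    rw [← Complex.ofReal_mul, Real.mul_self_sqrt h2.le, Complex.ofReal_neg, hrex]
  have four : ∀ f : C(T, ℂ), (4 : ℂ) • f = ContinuousMap.const T 4 * f := by
    intro f; ext x; simp
  have cdn : CA ε r 0 dn := by
    have := ((cA.add cD).mul0 h (cA.add cD)).sub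
      ((CA.const (ContinuousMap.const T (4 : ℂ))).mul0 h ((cA.mul0 h cD).sub (cB.mul0 h cC)))
    simpa only [hdn, four] using this
  have cs : CA ε r 0 s := by
    refine cdn.neg.sqrt h ts ?_ hss
    refine (ContinuousMap.isUnit_iff_forall_ne_zero _).2 (fun x => ?_)
    have := s0pos x
    simp only [ContinuousMap.add_apply, cR_apply]
    norm_cast
    linarith
  have cii : CA ε r 0 (fun n => ii * s n) := (CA.const ii).mul0 h cs
  set q : ℕ → C(T, ℂ) := fun n => hh * (D n - A n + ii * s n) with hq
  have cq : CA ε r 0 q := (CA.const hh).mul0 h ((cD.sub cA).add cii)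
  set l : ℕ → C(T, ℂ) := fun n => A n + q n with hl
  have cl : CA ε r 0 l := cA.add cq
  set q0 : C(T, ℂ) := hh * (cR D0 - cR A0 + ii * cR s0) with hq0
  have tq : Tendsto q atTop (𝓝 q0) := ((tD.sub tA).add (ts.const_mul ii)).const_mul hh
  have tl : Tendsto l atTop (𝓝 (cR A0 + q0)) := tA.add tq
  have hq0s : q0 - star q0 = ii * cR s0 := by
    simp only [hq0, star_mul', star_add, star_sub, star_cR, iist, hhst]
    linear_combination ii * cR s0 * hh2
  have hl0s : (cR A0 + q0) - star (cR A0 + q0) = ii * cR s0 := by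
    rw [star_add, star_cR]
    linear_combination hq0s
  have iisne : ∀ x, (ii * cR s0) x ≠ 0 := by
    intro x
    have := (s0pos x).ne'
    simp [hii, cR_apply, this]
  have hdet1 : ∀ x, A0 x * D0 x - B0 x * C0 x = 1 := by
    intro x
    have h1 : Tendsto (fun n => (A n * D n - B n * C n) x) atTop
        (𝓝 ((cR A0 * cR D0 - cR B0 * cR C0) x)) :=
      ((continuous_eval_const x).tendsto _).comp ((tA.mul tD).sub (tB.mul tC))
    have h2 : Tendsto (fun n => ((α n / α (n + 1) : ℝ) : ℂ)) atTop (𝓝 ((1 : ℝ) : ℂ)) := by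
      refine (Complex.continuous_ofReal.tendsto _).comp ?_
      have := hratio.inv₀ one_ne_zero
      rw [inv_one] at this
      exact this.congr (fun n => inv_div _ _)
    have h3 := tendsto_nhds_unique (h1.congr' (hdet.mono (fun n hn => hn x))) h2
    simp only [ContinuousMap.sub_apply, ContinuousMap.mul_apply, cR_apply] at h3
    exact_mod_cast h3
  have hdet1' : cR A0 * cR D0 - cR B0 * cR C0 = 1 := by
    ext x
    simp only [ContinuousMap.sub_apply, ContinuousMap.mul_apply, cR_apply, ContinuousMap.one_apply]
    exact_mod_cast hdet1 x
  have hs0c : cR s0 * cR s0 = (1+1+1+1) - (cR A0 + cR D0) * (cR A0 + cR D0) := by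
    ext x
    have h1 := s0sq x
    rw [hdet1 x] at h1
    simp only [ContinuousMap.sub_apply, ContinuousMap.mul_apply, cR_apply, ContinuousMap.one_apply,
      ContinuousMap.add_apply]
    norm_cast
    rw [← sq, h1]
    push_cast
    ring
  have hl0n : (cR A0 + q0) * star (cR A0 + q0) = 1 := by
    have e1 : cR A0 + q0 = hh * (cR A0 + cR D0 + ii * cR s0) := by
      rw [hq0]; linear_combination (-cR A0) * hh2
    rw [e1]
    simp only [star_mul', star_add, star_cR, iist, hhst]
    have e3 : hh * hh * (1 + 1 + 1 + 1) = 1 := by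
      linear_combination (2 * hh + 1) * hh2
    linear_combination (-hh * hh * cR s0 * cR s0) * iimul + hh * hh * hs0c + e3
  have hl0 : ∀ x, ‖(cR A0 + q0) x‖ = 1 := by
    intro x
    have := congrArg (fun f : C(T, ℂ) => ‖f x‖) hl0n
    simp only [ContinuousMap.mul_apply, ContinuousMap.star_apply, norm_mul, norm_star,
      ContinuousMap.one_apply, norm_one] at this
    nlinarith [norm_nonneg ((cR A0 + q0) x)]
  have hdq : star (cR C0) * q0 - cR C0 * star q0 = cR C0 * (ii * cR s0) := by
    rw [star_cR, ← hq0s]; ring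
  have hdqne : ∀ x, (star (cR C0) * q0 - cR C0 * star q0) x ≠ 0 := by
    intro x
    rw [hdq, ContinuousMap.mul_apply]
    refine mul_ne_zero ?_ (iisne x)
    rw [cR_apply]; exact_mod_cast C0ne x
  have hu1 : IsUnit (cR C0 * star q0 - star (cR C0) * q0) := by
    rw [show cR C0 * star q0 - star (cR C0) * q0 = -(star (cR C0) * q0 - cR C0 * star q0) by ring]
    exact ((ContinuousMap.isUnit_iff_forall_ne_zero _).2 hdqne).neg
  have hrel : ∀ᶠ n in atTop, C n * A n + q n * C n = l n * C n ∧ C n * B n + q n * D n = l n * q n := by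
    filter_upwards [hss] with n hn
    constructor
    · simp only [hl]; ring
    · simp only [hl, hq]
      have e4 : dn n = (A n - D n) * (A n - D n) + (1+1+1+1) * (B n * C n) := by
        simp only [hdn]
        ext x
        simp
        ring
      rw [e4] at hn
      have e3 : hh * hh * (1 + 1 + 1 + 1) = 1 := by
        linear_combination (2 * hh + 1) * hh2
      linear_combination (-hh * hh * s n * s n) * iimul + hh * hh * hn - (B n * C n) * e3
        - hh * (D n - A n) * (D n - A n + ii * s n) * hh2
  have st1 := stage_one h cA cB cC cD cC cq cl tC tq tl tA tB tC tD hu1 hrel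
  have str := stage_all h hA hB hC hD (by
    rw [hl0s]; exact (ContinuousMap.isUnit_iff_forall_ne_zero _).2 iisne) st1
  obtain ⟨p', q', a', b', tp', tq', ta', -, cb', hrel'⟩ := str
  have hb' : Summable fun n => ‖b' n‖ := by
    have := cb' 0 0 le_rfl
    simp only [iterDiff, add_zero, min_self] at this
    exact summable_of_isBigO_nat hsum this.norm_left
  obtain ⟨G, G0, b1, b2, tZ, tZr⟩ := dyn1 hA hB hC hD hV1 hV2 tp' tq' ta' hb' hrel' hl0 hdqne hα hratio
    hdet hV hV0
  refine ⟨s0, G, q0, ⟨fun x => 2 * G x / (s0 x) ^ 2, by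
    apply Continuous.div (by fun_prop) (by fun_prop); intro x; exact (pow_pos (s0pos x) 2).ne'⟩, fun x => rfl, s0pos, G0, ?_, fun x => rfl, b1, b2, tZ, ?_⟩
  · intro x
    simp only [hq0, hhh, hii, ContinuousMap.mul_apply, ContinuousMap.const_apply,
      ContinuousMap.add_apply, ContinuousMap.sub_apply, cR_apply]
    push_cast
    ring
  · refine cesaro_part hα hratio hW s0pos hl0n (fun x => ?_) (fun n => ?_) tZ tZr
    · rw [hl0s]; exact iisne x
    · have e : star (√ (α n) • V1 n) = √ (α n) • V1 n := by rw [star_smul, star_trivial, hV1]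
      have e' : star (√ (α n) • V2 n) = √ (α n) • V2 n := by rw [star_smul, star_trivial, hV2]
      simp only [star_add, star_mul', star_cR, e, e']
      linear_combination (√ (α n) • V2 n) * hq0s

end Abs

section PartA

lemma cmap_tendsto_iff {T : Type*} [TopologicalSpace T] [CompactSpace T] {f : ℕ → C(T, ℂ)} {g : C(T, ℂ)}
    (h : Tendsto f atTop (𝓝 g)) {ε : ℝ} (hε : 0 < ε) : ∀ᶠ n in atTop, ∀ x, ‖f n x - g x‖ < ε := by
  filter_upwards [Metric.tendsto_nhds.1 h ε hε] with n hn x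
  rw [dist_eq_norm] at hn
  exact lt_of_le_of_lt ((f n - g).norm_coe_le_norm x) hn

def opC (a b : ℕ → ℝ) (u v : ℝ) (m : ℕ) : C(Set.Icc u v, ℂ) :=
  ⟨fun x => ((opoly a b m (x : ℝ) : ℝ) : ℂ), by have := opoly_cont a b m; fun_prop⟩

lemma opC_apply (a b : ℕ → ℝ) (u v : ℝ) (m : ℕ) (x : Set.Icc u v) :
    opC a b u v m x = ((opoly a b m (x : ℝ) : ℝ) : ℂ) := rfl

theorem partA
    (N : ℕ) (hN : 0 < N) (r : ℕ) (hr : 0 < r)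
    (a b : ℕ → ℝ) (ha : ∀ n, 0 < a n)
    (i : ℕ) (u v : ℝ)
    (hΛ : ∀ x ∈ Set.Icc u v, ∃ d < (0 : ℝ),
      Tendsto (fun j : ℕ => discr (Xmat a b N (j * N + i) x)) atTop (𝓝 d))
    (hratio : Tendsto (fun j : ℕ => a ((j + 1) * N + i - 1) / a (j * N + i - 1))
      atTop (𝓝 1))
    (hDr : memDK r (Set.Icc u v) (fun j x => Xmat a b N (j * N + i) x))
    (XX : ℝ → Mat2)
    (hXX : TendstoUniformlyOn (fun j x => Xmat a b N (j * N + i) x) XX atTop (Set.Icc u v))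
    (hCarleman : Tendsto (fun n : ℕ => ∑ j ∈ Finset.Icc 1 n, 1 / a (j * N + i - 1))
      atTop atTop) :
    ∃ (c s G : C(Set.Icc u v, ℝ)) (q : C(Set.Icc u v, ℂ)),
      (∀ x, c x = XX x 1 0) ∧ (∀ x, c x ≠ 0) ∧ (∀ x, s x = √ (-discr (XX x))) ∧ (∀ x, 0 < s x) ∧
      (∀ x, 0 < G x) ∧ (∀ x, (q x).im = s x / 2) ∧
      (∃ M : ℝ, ∀ᶠ n in atTop, ∀ x : Set.Icc u v,
        √ (a (n * N + i - 1)) * |opoly a b (n * N + i - 1) x| ≤ M ∧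
        √ (a (n * N + i - 1)) * |opoly a b (n * N + i) x| ≤ M) ∧
      (∀ ε > 0, ∀ᶠ n in atTop, ∀ x : Set.Icc u v,
        |a (n * N + i - 1) * ‖(c x : ℂ) * (opoly a b (n * N + i - 1) x : ℝ) +
          q x * (opoly a b (n * N + i) x : ℝ)‖ ^ 2 - G x| < ε) ∧
      (∀ ε > 0, ∀ᶠ n in atTop, ∀ x : Set.Icc u v,
        |(∑ j ∈ Finset.Icc 1 (n + 1), 1 / a (j * N + i - 1))⁻¹ *
          ∑ j ∈ Finset.range (n + 1), (opoly a b (j * N + i) x) ^ 2 - 2 * G x / (s x) ^ 2| < ε) := by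
  obtain ⟨hbd, -, hsum⟩ := hDr
  obtain ⟨ε, hε, hεs, hεd⟩ := ctrl_exists hr (d := fun m n => ⨆ x : Set.Icc u v,
    ‖iterDiff (fun j x => Xmat a b N (j * N + i) x) m n (x : ℝ)‖)
    (fun m n => Real.iSup_nonneg (fun _ => norm_nonneg _)) hsum
  obtain ⟨A0, eA, tA⟩ := ent_tendsto a b N i u v 0 0 XX hXX
  obtain ⟨B0, eB, tB⟩ := ent_tendsto a b N i u v 0 1 XX hXX
  obtain ⟨C0, eC, tC⟩ := ent_tendsto a b N i u v 1 0 XX hXX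
  obtain ⟨D0, eD, tD⟩ := ent_tendsto a b N i u v 1 1 XX hXX
  have hCA : ∀ (j k : Fin 2) (c : C(Set.Icc u v, ℂ)), Tendsto (ent a b N i u v j k) atTop (𝓝 c) →
      CA ε r 0 (ent a b N i u v j k) := by
    intro j k c hc
    refine CA_of_le hε (fun m hm => ?_)
    rcases Nat.eq_zero_or_pos m with rfl | hm0
    · simpa using! hc.isBigO_one ℝ
    · refine IsBigO.of_bound 1 (Eventually.of_forall (fun n => ?_))
      rw [one_mul, Real.norm_of_nonneg (pow_nonneg (hε.nonneg n) m)]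
      exact (ent_diff_le a b N i u v j k m n).trans (hεd m (Finset.mem_Icc.2 ⟨hm0, hm⟩) n)
  have hself : ∀ (j k : Fin 2) n, star (ent a b N i u v j k n) = ent a b N i u v j k n := by
    intro j k n; ext x; simp [ent]
  have hselfV : ∀ m, star (opC a b u v m) = opC a b u v m := by
    intro m; ext x; simp [opC]
  have hdd : ∀ x : Set.Icc u v, discr (XX x) = (A0 x + D0 x) ^ 2 - 4 * (A0 x * D0 x - B0 x * C0 x) := by
    intro x
    rw [discr, Matrix.trace_fin_two, Matrix.det_fin_two, eA, eB, eC, eD]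
  have hdisc : ∀ x : Set.Icc u v, (A0 x + D0 x) ^ 2 - 4 * (A0 x * D0 x - B0 x * C0 x) < 0 := by
    intro x
    obtain ⟨d, hd, td⟩ := hΛ x x.2
    have h1 : Tendsto (fun n => Xmat a b N (n * N + i) x) atTop (𝓝 (XX x)) :=
      hXX.tendsto_at x.2
    have h2 : Continuous discr := by
      unfold discr
      exact (continuous_id.matrix_trace.pow 2).sub (continuous_const.mul continuous_id.matrix_det)
    have h3 := (h2.tendsto _).comp h1
    have := tendsto_nhds_unique td h3
    rw [← hdd, ← this]
    exact hd
  have hidx : ∀ n, (n + 1) * N + i - 1 = n * N + i + N - 1 := by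
    intro n; congr 1; ring
  have hge : ∀ n ≥ 1, 1 ≤ n * N + i := by
    intro n hn
    have : 1 ≤ n * N := Nat.mul_pos hn hN
    omega
  have hW : Tendsto (fun n => ∑ j ∈ Finset.range n, 1 / a (j * N + i - 1)) atTop atTop := by
    rw [← tendsto_add_atTop_iff_nat 1]
    have := tendsto_atTop_add_const_left atTop (1 / a (0 * N + i - 1)) hCarleman
    refine this.congr (fun n => ?_)
    rw [Finset.sum_range_succ', add_comm]
    congr 1
    rw [Finset.range_eq_Ico, Finset.sum_Ico_add' (fun j => 1 / a (j * N + i - 1)) 0 n 1]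
    rfl
  obtain ⟨s, G, q, g, es, spos, Gpos, eq, eg, b1, b2, tZ, tg⟩ := partA_abs hε hεs
    (A := ent a b N i u v 0 0) (B := ent a b N i u v 0 1) (C := ent a b N i u v 1 0)
    (D := ent a b N i u v 1 1) (V1 := fun n => opC a b u v (n * N + i - 1))
    (V2 := fun n => opC a b u v (n * N + i)) (α := fun n => a (n * N + i - 1))
    (hself 0 0) (hself 0 1) (hself 1 0) (hself 1 1) (fun n => hselfV _) (fun n => hselfV _)
    (hCA _ _ _ tA) (hCA _ _ _ tB) (hCA _ _ _ tC) (hCA _ _ _ tD) tA tB tC tD hdisc (fun n => ha _)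
    hratio (by
      filter_upwards [eventually_ge_atTop 1] with n hn x
      have := prodD_det a b ha (n * N + i) (hge n hn) x N
      rw [Matrix.det_fin_two] at this
      rw [hidx, ← this]
      simp [ent]) (by
      filter_upwards [eventually_ge_atTop 1] with n hn
      have h1 := fun x => prodD_vec a b ha (n * N + i) (hge n hn) x N
      constructor
      · ext x
        rw [hidx]
        simp only [opC, ContinuousMap.coe_mk, (h1 x).1, ent, ContinuousMap.add_apply, ContinuousMap.mul_apply]
        push_cast; rfl
      · ext x
        rw [show (n + 1) * N + i = n * N + i + N by ring]
        simp only [opC, ContinuousMap.coe_mk, (h1 x).2, ent, ContinuousMap.add_apply, ContinuousMap.mul_apply]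
        push_cast; rfl) (by
      filter_upwards [eventually_ge_atTop 1] with n hn x
      have := opoly_not_both a b ha x (n * N + i - 1)
      rw [Nat.sub_add_cancel (hge n hn)] at this
      simpa [opC] using! this) hW
  refine ⟨C0, s, G, q, eC, ?_, ?_, spos, Gpos, ?_, ?_, ?_, ?_⟩
  · intro x h0
    have := hdisc x
    rw [h0] at this
    nlinarith [sq_nonneg (A0 x - D0 x)]
  · intro x
    rw [es, hdd]
  · intro x
    rw [eq]
    simp
  · obtain ⟨M1, h1⟩ := b1.bound
    obtain ⟨M2, h2⟩ := b2.bound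
    refine ⟨max M1 M2, ?_⟩
    filter_upwards [h1, h2] with n h1 h2 x
    have e1 := ((√ (a (n * N + i - 1)) • opC a b u v (n * N + i - 1)).norm_coe_le_norm x).trans h1
    have e2 := ((√ (a (n * N + i - 1)) • opC a b u v (n * N + i)).norm_coe_le_norm x).trans h2
    rw [ContinuousMap.smul_apply, norm_smul, norm_one, mul_one, Real.norm_of_nonneg (Real.sqrt_nonneg _)] at e1 e2
    simp only [opC, ContinuousMap.coe_mk, Complex.norm_real, Real.norm_eq_abs] at e1 e2
    exact ⟨e1.trans (le_max_left _ _), e2.trans (le_max_right _ _)⟩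
  · intro ε' hε'
    filter_upwards [cmap_tendsto_iff tZ hε'] with n hn x
    refine lt_of_eq_of_lt ?_ (hn x)
    rw [← Real.norm_eq_abs, ← Complex.norm_real]
    congr 1
    rw [cR_apply, Complex.ofReal_sub, Complex.ofReal_mul, Complex.ofReal_pow]
    congr 1
    simp only [ContinuousMap.mul_apply, ContinuousMap.star_apply, ContinuousMap.add_apply,
      ContinuousMap.smul_apply, opC_apply, Complex.real_smul, cR_apply]
    set z : ℂ := (C0 x : ℂ) * (opoly a b (n * N + i - 1) x : ℝ) +
          q x * (opoly a b (n * N + i) x : ℝ) with hz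
    have e1 : (C0 x : ℂ) * ((√ (a (n * N + i - 1)) : ℝ) * (opoly a b (n * N + i - 1) x : ℝ)) +
        q x * ((√ (a (n * N + i - 1)) : ℝ) * (opoly a b (n * N + i) x : ℝ)) =
        (√ (a (n * N + i - 1)) : ℝ) * z := by rw [hz]; ring
    rw [e1, star_mul', ← Complex.mul_conj']
    have e2 : star ((√ (a (n * N + i - 1)) : ℝ) : ℂ) = ((√ (a (n * N + i - 1)) : ℝ) : ℂ) :=
      Complex.conj_ofReal _
    rw [e2]
    have e3 : ((√ (a (n * N + i - 1)) : ℝ) : ℂ) * ((√ (a (n * N + i - 1)) : ℝ) : ℂ) =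
        (a (n * N + i - 1) : ℝ) := by
      rw [← Complex.ofReal_mul, Real.mul_self_sqrt (ha _).le]
    rw [← e3]
    show _ = _ * z * (_ * (starRingEnd ℂ) z)
    ring
  · have hw : ∀ n, 0 < 1 / a (n * N + i - 1) := fun n => one_div_pos.2 (ha _)
    have hwr : Tendsto (fun n => (1 / a ((n + 1) * N + i - 1)) / (1 / a (n * N + i - 1))) atTop (𝓝 1) := by
      have := hratio.inv₀ one_ne_zero
      rw [inv_one] at this
      refine this.congr (fun n => ?_)
      have := (ha (n * N + i - 1)).ne'
      have := (ha ((n + 1) * N + i - 1)).ne'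
      field_simp
    have hlo := weight_littleO hw hwr hW
    set w : ℕ → ℝ := fun n => 1 / a (n * N + i - 1) with hwdef
    set W : ℕ → ℝ := fun n => ∑ j ∈ Finset.range n, w j with hWdef
    have h3 : (fun _ : ℕ => w 0) =o[atTop] W := by
      rw [isLittleO_const_left]
      right
      exact tendsto_norm_atTop_atTop.comp hW
    have hW' : ∀ n, ∑ j ∈ Finset.Icc 1 n, w j = W n + w n - w 0 := by
      intro n
      have h1 : ∑ j ∈ Finset.range (n + 1), w j = W n + w n := Finset.sum_range_succ _ _
      rw [Finset.sum_range_succ', Finset.range_eq_Ico, Finset.sum_Ico_add' w 0 n 1] at h1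
      rw [← h1]
      rw [add_sub_cancel_right]; rfl
    have hq : Tendsto (fun n => (∑ j ∈ Finset.Icc 1 n, w j) / W n) atTop (𝓝 1) := by
      have h4 := ((hlo.sub h3).tendsto_div_nhds_zero).add_const 1
      rw [zero_add] at h4
      refine h4.congr' ?_
      filter_upwards [hW.eventually_gt_atTop 0] with n hn
      have : W n ≠ 0 := hn.ne'
      rw [hW']
      field_simp
      ring
    have hq2 : Tendsto (fun n => W n * (∑ j ∈ Finset.Icc 1 n, w j)⁻¹) atTop (𝓝 1) := by
      have := hq.inv₀ one_ne_zero
      rw [inv_one] at this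
      refine this.congr (fun n => ?_)
      rw [inv_div, div_eq_mul_inv]
    have hT := (hq2.smul tg).comp (tendsto_add_atTop_nat 1)
    rw [one_smul] at hT
    intro ε' hε'
    filter_upwards [cmap_tendsto_iff hT hε', (hW.comp (tendsto_add_atTop_nat 1)).eventually_gt_atTop 0] with n hn hn2 x
    refine lt_of_eq_of_lt ?_ (hn x)
    have hn2' : W (n + 1) ≠ 0 := hn2.ne'
    rw [← Real.norm_eq_abs, ← Complex.norm_real, ← eg]
    congr 1
    rw [cR_apply, Complex.ofReal_sub]
    congr 1
    simp only [Function.comp]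
    rw [smul_smul, mul_comm (W (n + 1)), mul_assoc]
    rw [show W (n + 1) * (∑ j ∈ Finset.range (n + 1), w j)⁻¹ = 1 from mul_inv_cancel₀ hn2', mul_one]
    rw [ContinuousMap.smul_apply, Complex.real_smul, ContinuousMap.coe_sum, Finset.sum_apply]
    push_cast
    congr 1
    refine Finset.sum_congr rfl (fun j _ => ?_)
    simp [opC, sq]

end PartA

section PartD1

lemma pk_eq (s y : ℝ) (hy : 0 < y) : (fun t : ℝ => y / ((t - s) ^ 2 + y ^ 2)) =
    fun t => y⁻¹ * (fun x : ℝ => (1 + x ^ 2)⁻¹) ((t - s) / y) := by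
  funext t
  have : (t - s) ^ 2 + y ^ 2 ≠ 0 := by positivity
  have h2 : 1 + ((t - s) / y) ^ 2 ≠ 0 := by positivity
  field_simp
  ring

lemma pk_int (s y : ℝ) (hy : 0 < y) : Integrable (fun t : ℝ => y / ((t - s) ^ 2 + y ^ 2)) := by
  rw [pk_eq s y hy]
  refine Integrable.const_mul ?_ _
  exact (integrable_inv_one_add_sq.comp_div hy.ne').comp_sub_right s

lemma pk_integral (s y : ℝ) (hy : 0 < y) : ∫ t : ℝ, y / ((t - s) ^ 2 + y ^ 2) = π := by
  rw [pk_eq s y hy, integral_const_mul]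
  rw [integral_sub_right_eq_self (fun t => (fun x : ℝ => (1 + x ^ 2)⁻¹) (t / y)) s,
    Measure.integral_comp_div (fun x : ℝ => (1 + x ^ 2)⁻¹) y, integral_univ_inv_one_add_sq, abs_of_pos hy, smul_eq_mul]
  field_simp

/-- Poisson formula in the upper half plane for bounded functions. -/
lemma poisson_uhp (f : ℂ → ℂ) (C : ℝ) (hC : ∀ z : ℂ, 0 ≤ z.im → ‖f z‖ ≤ C)
    (hf : ∀ z : ℂ, 0 ≤ z.im → DifferentiableAt ℂ f z) (s y : ℝ) (hy : 0 < y) :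
    Integrable (fun t : ℝ => f t * ((y / ((t - s) ^ 2 + y ^ 2) : ℝ) : ℂ)) ∧
    ∫ t : ℝ, f t * ((y / ((t - s) ^ 2 + y ^ 2) : ℝ) : ℂ) = π * f (s + y * Complex.I) := by
  set z : ℂ := s + y * Complex.I with hz
  have hzre : z.re = s := by simp [hz]
  have hzim : z.im = y := by simp [hz]
  have hC0 : 0 ≤ C := (norm_nonneg _).trans (hC z (by rw [hzim]; exact hy.le))
  have hcontf : Continuous (fun t : ℝ => f t) := by
    rw [continuous_iff_continuousAt]
    intro t
    exact (hf t (by simp)).continuousAt.comp (f := fun t : ℝ => (t : ℂ)) Complex.continuous_ofReal.continuousAt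
  have hcontk : Continuous (fun t : ℝ => ((y / ((t - s) ^ 2 + y ^ 2) : ℝ) : ℂ)) := by
    refine Complex.continuous_ofReal.comp ?_
    refine Continuous.div continuous_const (by fun_prop) ?_
    intro t; positivity
  have hk : Integrable (fun t : ℝ => ((y / ((t - s) ^ 2 + y ^ 2) : ℝ) : ℂ)) := (pk_int s y hy).ofReal
  have hI : Integrable (fun t : ℝ => f t * ((y / ((t - s) ^ 2 + y ^ 2) : ℝ) : ℂ)) :=
    hk.bdd_mul hcontf.aestronglyMeasurable (Eventually.of_forall fun t => hC t (by simp))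
  refine ⟨hI, ?_⟩
  set g : ℂ → ℂ := fun w => dslope f z w / (w - (starRingEnd ℂ) z) with hg
  have hne : ∀ w : ℂ, 0 ≤ w.im → w - (starRingEnd ℂ) z ≠ 0 := by
    intro w hw h
    have := congrArg Complex.im h
    simp [hzim] at this
    linarith
  have hgd : ∀ w : ℂ, 0 ≤ w.im → w ≠ z → DifferentiableAt ℂ g w := by
    intro w hw hwz
    refine DifferentiableAt.div ((differentiableAt_dslope_of_ne hwz).2 (hf w hw)) (by fun_prop) (hne w hw)
  have hgc : ∀ w : ℂ, 0 ≤ w.im → ContinuousAt g w := by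
    intro w hw
    by_cases hwz : w = z
    · subst hwz
      refine ContinuousAt.div (continuousAt_dslope_same.2 (hf _ hw)) (by fun_prop) (hne _ hw)
    · exact (hgd w hw hwz).continuousAt
  have hgb : ∀ w : ℂ, 0 ≤ w.im → 2 * ‖z‖ + 1 ≤ ‖w‖ → ‖g w‖ ≤ 8 * C / ‖w‖ ^ 2 := by
    intro w hw hwz
    have hz0 := norm_nonneg z
    have h1 : ‖w‖ / 2 ≤ ‖w - z‖ := by have := norm_sub_norm_le w z; linarith
    have h2 : ‖w‖ / 2 ≤ ‖w - (starRingEnd ℂ) z‖ := by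
      have := norm_sub_norm_le w ((starRingEnd ℂ) z)
      rw [RCLike.norm_conj] at this; linarith
    have hwne : w ≠ z := by
      rintro rfl; linarith
    have hw0 : 0 < ‖w‖ := by linarith
    have e : g w = (f w - f z) / ((w - z) * (w - (starRingEnd ℂ) z)) := by
      have h3 := sub_ne_zero.2 hwne
      have h4 := hne w hw
      simp only [hg, dslope_of_ne _ hwne, slope_def_field]
      field_simp
    rw [e, norm_div, norm_mul]
    calc ‖f w - f z‖ / (‖w - z‖ * ‖w - (starRingEnd ℂ) z‖) ≤ (2 * C) / (‖w‖ / 2 * (‖w‖ / 2)) := by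
          gcongr
          have := norm_sub_le (f w) (f z)
          have h5 := hC w hw
          have h6 := hC z (by rw [hzim]; exact hy.le)
          linarith
      _ = 8 * C / ‖w‖ ^ 2 := by field_simp; ring
  have hgreal : ∀ t : ℝ, g t = f t * (((y / ((t - s) ^ 2 + y ^ 2) : ℝ) : ℂ) / y) - f z * (((y / ((t - s) ^ 2 + y ^ 2) : ℝ) : ℂ) / y) := by
    intro t
    have hwne : (t : ℂ) ≠ z := by
      intro h; have := congrArg Complex.im h; simp [hzim] at this; linarith
    have h3 := sub_ne_zero.2 hwne
    have h4 := hne t (by simp)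
    have h5 : (((t - s) ^ 2 + y ^ 2 : ℝ) : ℂ) = (t - z) * (t - (starRingEnd ℂ) z) := by
      have e1 : (t : ℂ) - z = (t - s : ℝ) - y * Complex.I := by rw [hz]; push_cast; ring
      have e2 : (t : ℂ) - (starRingEnd ℂ) z = (t - s : ℝ) + y * Complex.I := by
        rw [hz]; simp; ring
      rw [e1, e2]
      push_cast
      linear_combination ((y : ℂ) ^ 2) * Complex.I_sq
    have h6 : (y : ℂ) ≠ 0 := by exact_mod_cast hy.ne'
    simp only [hg, dslope_of_ne _ hwne, slope_def_field]
    rw [Complex.ofReal_div, h5]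
    field_simp
  have hgint : Integrable (fun t : ℝ => g t) := by
    simp_rw [hgreal]
    have h1 := hI.div_const (y : ℂ)
    have h2 := (hk.const_mul (f z)).div_const (y : ℂ)
    refine (h1.sub h2).congr (Eventually.of_forall fun t => ?_)
    simp only [Pi.sub_apply]; ring
  have hzero : ∫ t : ℝ, g t = 0 := by
    have ht := intervalIntegral_tendsto_integral hgint (a := fun R : ℝ => -R) (b := fun R => R) (l := atTop)
      tendsto_neg_atTop_atBot tendsto_id
    refine tendsto_nhds_unique ht ?_
    rw [tendsto_zero_iff_norm_tendsto_zero]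
    have hlim : Tendsto (fun R : ℝ => 32 * C / R) atTop (𝓝 0) := tendsto_const_nhds.div_atTop tendsto_id
    refine squeeze_zero' (Eventually.of_forall fun _ => norm_nonneg _) ?_ hlim
    filter_upwards [eventually_ge_atTop (2 * ‖z‖ + 1)] with R hR
    have hz0 := norm_nonneg z
    have hR0 : 0 < R := by linarith
    have hrect := Complex.integral_boundary_rect_eq_zero_of_differentiable_on_off_countable g
      (-R : ℂ) (R + R * Complex.I) {z} (Set.countable_singleton z) ?_ ?_
    · simp at hrect
      have hb : ∀ w : ℂ, 0 ≤ w.im → R ≤ ‖w‖ → ‖g w‖ ≤ 8 * C / R ^ 2 := by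
        intro w hw hRw
        refine (hgb w hw (hR.trans hRw)).trans ?_
        gcongr
      have e1 : ‖∫ x in (-R)..R, g (x + R * Complex.I)‖ ≤ 8 * C / R ^ 2 * |R - -R| := by
        refine intervalIntegral.norm_integral_le_of_norm_le_const fun x _ => hb _ (by simp [hR0.le]) ?_
        have := Complex.abs_im_le_norm (x + R * Complex.I)
        simpa [abs_of_pos hR0] using this
      have e2 : ‖∫ x in (0:ℝ)..R, g (R + x * Complex.I)‖ ≤ 8 * C / R ^ 2 * |R - 0| := by
        refine intervalIntegral.norm_integral_le_of_norm_le_const fun x hx => hb _ ?_ ?_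
        · rw [Set.uIoc_of_le hR0.le] at hx; simp [hx.1.le]
        have := Complex.abs_re_le_norm (R + x * Complex.I)
        simpa [abs_of_pos hR0] using this
      have e3 : ‖∫ x in (0:ℝ)..R, g (-R + x * Complex.I)‖ ≤ 8 * C / R ^ 2 * |R - 0| := by
        refine intervalIntegral.norm_integral_le_of_norm_le_const fun x hx => hb _ ?_ ?_
        · rw [Set.uIoc_of_le hR0.le] at hx; simp [hx.1.le]
        have := Complex.abs_re_le_norm (-R + x * Complex.I)
        simpa [abs_of_pos hR0] using this
      have e4 : (∫ x in (-R)..R, g x) = (∫ x in (-R)..R, g (x + R * Complex.I)) -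
          Complex.I * (∫ x in (0:ℝ)..R, g (R + x * Complex.I)) + Complex.I * ∫ x in (0:ℝ)..R, g (-R + x * Complex.I) := by
        linear_combination hrect
      rw [e4]
      have e5 := norm_add_le ((∫ x in (-R)..R, g (x + R * Complex.I)) -
          Complex.I * (∫ x in (0:ℝ)..R, g (R + x * Complex.I))) (Complex.I * ∫ x in (0:ℝ)..R, g (-R + x * Complex.I))
      have e6 := norm_sub_le (∫ x in (-R)..R, g (x + R * Complex.I)) (Complex.I * (∫ x in (0:ℝ)..R, g (R + x * Complex.I)))
      rw [norm_mul, Complex.norm_I, one_mul] at e5 e6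
      have a1 : |R - -R| = 2 * R := by rw [abs_of_pos] <;> linarith
      have a2 : |R - 0| = R := by rw [abs_of_pos] <;> linarith
      rw [a1] at e1; rw [a2] at e2 e3
      have a3 : 32 * C / R = 8 * C / R ^ 2 * (2 * R) + 8 * C / R ^ 2 * R + 8 * C / R ^ 2 * R := by
        field_simp; ring
      linarith
    · intro w hw
      refine (hgc w ?_).continuousWithinAt
      have := hw.2
      simp [Set.uIcc_of_le hR0.le] at this
      exact this.1
    · intro w hw
      refine hgd w ?_ hw.2
      have := hw.1.2
      simp [hR0.le] at this
      exact this.1.le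
  have h6 : (y : ℂ) ≠ 0 := by exact_mod_cast hy.ne'
  have h1 := hI.div_const (y : ℂ)
  have h2 := (hk.const_mul (f z)).div_const (y : ℂ)
  have h7 : ∫ t : ℝ, g t = (∫ t : ℝ, f t * ((y / ((t - s) ^ 2 + y ^ 2) : ℝ) : ℂ) / y) - ∫ t : ℝ, f z * ((y / ((t - s) ^ 2 + y ^ 2) : ℝ) : ℂ) / y := by
    rw [← integral_sub h1 h2]
    refine integral_congr_ae (Eventually.of_forall fun t => ?_)
    simp only [hgreal]; ring
  rw [hzero, integral_div, integral_div, integral_const_mul, integral_complex_ofReal, pk_integral s y hy] at h7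
  field_simp at h7
  linear_combination -h7
end PartD1

section PartD2
variable (a b : ℕ → ℝ)

/-- Truncated continued fraction with terminal value `σ`. -/
def mf (σ : ℂ) : ℕ → ℕ → ℂ → ℂ
  | 0, _, _ => σ
  | (l + 1), k, z => ((b k : ℂ) - z - (a k : ℂ) ^ 2 * mf σ l (k + 1) z)⁻¹

/-- Pairs `(p_k(z), a_{k-1} p_{k-1}(z))` at complex `z`. -/
def cpp (z : ℂ) : ℕ → ℂ × ℂ
  | 0 => (1, 0)
  | (k + 1) => (((z - b k) * (cpp z k).1 - (cpp z k).2) / a k, a k * (cpp z k).1)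

lemma cpp_real (ha : ∀ n, 0 < a n) (x : ℝ) (k : ℕ) :
    cpp a b x (k + 1) = (((opoly a b (k + 1) x : ℝ) : ℂ), ((a k * opoly a b k x : ℝ) : ℂ)) := by
  induction k with
  | zero => simp [cpp, opoly]
  | succ k ih =>
    have h0 : (a (k + 1) : ℂ) ≠ 0 := by exact_mod_cast (ha _).ne'
    rw [cpp, ih]
    ext
    · simp only [opoly]
      push_cast
      rfl
    · simp

lemma sq_re_im (c : ℝ) (m : ℂ) : ((c : ℂ) ^ 2 * m).im = c ^ 2 * m.im := by
  rw [← Complex.ofReal_pow, Complex.im_ofReal_mul]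

lemma mf_im (ha : ∀ n, 0 < a n) (σ : ℂ) (hσ : 0 < σ.im) (z : ℂ) (hz : 0 ≤ z.im) (l : ℕ) : ∀ k, 0 < (mf a b σ l k z).im := by
  induction l with
  | zero => intro k; exact hσ
  | succ l ih =>
    intro k
    have h1 := ih (k + 1)
    have h2 := ha k
    have hd : ((b k : ℂ) - z - (a k : ℂ) ^ 2 * mf a b σ l (k + 1) z).im < 0 := by
      rw [Complex.sub_im, Complex.sub_im, sq_re_im, Complex.ofReal_im]
      have : 0 < a k ^ 2 * (mf a b σ l (k + 1) z).im := by positivity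
      linarith
    rw [mf, Complex.inv_im]
    refine div_pos (by linarith) (Complex.normSq_pos.2 ?_)
    intro h; rw [h] at hd; simp at hd

lemma mf_den (ha : ∀ n, 0 < a n) (σ : ℂ) (hσ : 0 < σ.im) (z : ℂ) (hz : 0 ≤ z.im) (l k : ℕ) :
    (b k : ℂ) - z - (a k : ℂ) ^ 2 * mf a b σ l (k + 1) z ≠ 0 := by
  intro h
  have h1 := mf_im a b ha σ hσ z hz (l + 1) k
  rw [mf, h] at h1; simp at h1

lemma mf_diff (ha : ∀ n, 0 < a n) (σ : ℂ) (hσ : 0 < σ.im) (z : ℂ) (hz : 0 ≤ z.im) (l : ℕ) :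
    ∀ k, DifferentiableAt ℂ (mf a b σ l k) z := by
  induction l with
  | zero =>
    intro k
    have : mf a b σ 0 k = fun _ => σ := by funext z; rfl
    rw [this]; fun_prop
  | succ l ih =>
    intro k
    have : mf a b σ (l + 1) k = fun z => ((b k : ℂ) - z - (a k : ℂ) ^ 2 * mf a b σ l (k + 1) z)⁻¹ := by
      funext z; rfl
    rw [this]
    have h1 := ih (k + 1)
    refine DifferentiableAt.inv (by fun_prop) (mf_den a b ha σ hσ z hz l k)

lemma mf_bdd (ha : ∀ n, 0 < a n) (σ : ℂ) (hσ : 0 < σ.im) (l : ℕ) :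
    ∀ k, ∃ C, ∀ z : ℂ, 0 ≤ z.im → ‖mf a b σ l k z‖ ≤ C := by
  induction l with
  | zero => intro k; exact ⟨‖σ‖, fun z _ => le_rfl⟩
  | succ l ih =>
    intro k
    obtain ⟨C, hC⟩ := ih (k + 1)
    set R := |b k| + a k ^ 2 * C + 1 with hR
    have hcomp : IsCompact (Metric.closedBall (0 : ℂ) R ∩ {z : ℂ | 0 ≤ z.im}) :=
      (isCompact_closedBall _ _).inter_right (isClosed_le continuous_const Complex.continuous_im)
    obtain ⟨M, hM⟩ := hcomp.exists_bound_of_continuousOn (f := mf a b σ (l + 1) k)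
      (fun z hz => (mf_diff a b ha σ hσ z hz.2 (l + 1) k).continuousAt.continuousWithinAt)
    refine ⟨max M 1, fun z hz => ?_⟩
    by_cases h : ‖z‖ ≤ R
    · exact (hM z ⟨by simpa using h, hz⟩).trans (le_max_left _ _)
    · refine le_trans ?_ (le_max_right _ _)
      rw [mf, norm_inv]
      refine inv_le_one_of_one_le₀ ?_
      push Not at h
      have h1 : ‖z‖ - ‖(b k : ℂ) - (a k : ℂ) ^ 2 * mf a b σ l (k + 1) z‖ ≤
          ‖(b k : ℂ) - z - (a k : ℂ) ^ 2 * mf a b σ l (k + 1) z‖ := by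
        have := norm_sub_norm_le z ((b k : ℂ) - (a k : ℂ) ^ 2 * mf a b σ l (k + 1) z)
        rw [norm_sub_rev z] at this
        have e : (b k : ℂ) - (a k : ℂ) ^ 2 * mf a b σ l (k + 1) z - z = (b k : ℂ) - z - (a k : ℂ) ^ 2 * mf a b σ l (k + 1) z := by ring
        rwa [e] at this
      have h2 := norm_sub_le (b k : ℂ) ((a k : ℂ) ^ 2 * mf a b σ l (k + 1) z)
      rw [norm_mul, norm_pow, Complex.norm_real, Complex.norm_real, norm_eq_abs, norm_eq_abs, sq_abs] at h2
      have h3 : a k ^ 2 * ‖mf a b σ l (k + 1) z‖ ≤ a k ^ 2 * C := by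
        gcongr; exact hC z hz
      linarith

lemma mf_le (ha : ∀ n, 0 < a n) (σ : ℂ) (hσ : 0 < σ.im) (z : ℂ) (hz : 0 < z.im) (l k : ℕ) :
    ‖mf a b σ (l + 1) k z‖ ≤ 1 / z.im := by
  have h1 := mf_im a b ha σ hσ z hz.le l (k + 1)
  rw [mf, norm_inv, one_div]
  gcongr
  have := Complex.abs_im_le_norm ((b k : ℂ) - z - (a k : ℂ) ^ 2 * mf a b σ l (k + 1) z)
  refine le_trans ?_ this
  rw [Complex.sub_im, Complex.sub_im, sq_re_im, Complex.ofReal_im]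
  have h2 : 0 < a k ^ 2 * (mf a b σ l (k + 1) z).im := by have := ha k; positivity
  rw [abs_of_neg] <;> linarith

lemma mf_real (ha : ∀ n, 0 < a n) (σ : ℂ) (hσ : 0 < σ.im) (x : ℝ) (n : ℕ) : ∀ k l, k + l = n →
    (mf a b σ n 0 x).im * Complex.normSq ((cpp a b x k).1 + (cpp a b x k).2 * mf a b σ l k x) = (mf a b σ l k x).im := by
  intro k
  induction k with
  | zero => intro l h; simp at h; subst h; simp [cpp]
  | succ k ih =>
    intro l h
    have h1 := ih (l + 1) (by omega)
    have hd := mf_den a b ha σ hσ x (by simp) l k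
    have e : mf a b σ (l + 1) k x = ((b k : ℂ) - x - (a k : ℂ) ^ 2 * mf a b σ l (k + 1) x)⁻¹ := rfl
    have hak := ha k
    have hak' : (a k : ℂ) ≠ 0 := by exact_mod_cast hak.ne'
    set d := (b k : ℂ) - x - (a k : ℂ) ^ 2 * mf a b σ l (k + 1) x with hdd
    have hdim : d.im = - (a k ^ 2 * (mf a b σ l (k + 1) x).im) := by
      rw [hdd, Complex.sub_im, Complex.sub_im, sq_re_im]; simp
    rw [e, Complex.inv_im, hdim] at h1
    set P := (cpp a b x k).1
    set Q := (cpp a b x k).2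
    have e2 : (cpp a b x (k + 1)).1 + (cpp a b x (k + 1)).2 * mf a b σ l (k + 1) x = - (d * (P + Q * d⁻¹)) / a k := by
      rw [cpp]
      simp only
      field_simp
      rw [hdd]; ring
    rw [e2, Complex.normSq_div, Complex.normSq_neg, Complex.normSq_mul, Complex.normSq_ofReal]
    have hn : 0 < Complex.normSq d := Complex.normSq_pos.2 hd
    field_simp at h1 ⊢
    linear_combination h1

/-- solution of the recurrence for the truncated problem -/
def psim (σ : ℂ) (n : ℕ) (z : ℂ) : ℕ → ℂ
  | 0 => mf a b σ n 0 z
  | (k + 1) => - (a k : ℂ) * mf a b σ (n - (k + 1)) (k + 1) z * psim σ n z k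

def kap (φ : ℕ → ℂ) : ℕ → ℂ
  | 0 => -1
  | (k + 1) => a k * φ k

lemma psim_kap (ha : ∀ n, 0 < a n) (σ : ℂ) (n : ℕ) (z : ℂ) (k : ℕ) :
    psim a b σ n z k = - kap a (psim a b σ n z) k * mf a b σ (n - k) k z := by
  cases k with
  | zero => simp [psim, kap]
  | succ k => simp only [psim, kap]; ring

lemma psim_rec (ha : ∀ n, 0 < a n) (σ : ℂ) (hσ : 0 < σ.im) (n : ℕ) (z : ℂ) (hz : 0 ≤ z.im) (k : ℕ) (hk : k + 1 ≤ n) :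
    a k * psim a b σ n z (k + 1) = (z - b k) * psim a b σ n z k - kap a (psim a b σ n z) k := by
  have h1 := psim_kap a b ha σ n z k
  have hd := mf_den a b ha σ hσ z hz (n - (k + 1)) k
  have e : mf a b σ (n - k) k z = ((b k : ℂ) - z - (a k : ℂ) ^ 2 * mf a b σ (n - (k + 1)) (k + 1) z)⁻¹ := by
    have : n - k = (n - (k + 1)) + 1 := by omega
    rw [this]; rfl
  rw [e] at h1
  have h2 : kap a (psim a b σ n z) k = - ((b k : ℂ) - z - (a k : ℂ) ^ 2 * mf a b σ (n - (k + 1)) (k + 1) z) * psim a b σ n z k := by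
    rw [h1]; field_simp
  rw [h2, psim]
  ring

lemma psim_sum (ha : ∀ n, 0 < a n) (σ : ℂ) (hσ : 0 < σ.im) (n : ℕ) (z : ℂ) (hz : 0 ≤ z.im) (k : ℕ) (hk : k ≤ n) :
    z.im * ∑ j ∈ Finset.range k, Complex.normSq (psim a b σ n z j) +
      Complex.normSq (kap a (psim a b σ n z) k) * (mf a b σ (n - k) k z).im = (mf a b σ n 0 z).im := by
  induction k with
  | zero => simp [kap]
  | succ k ih =>
    rw [← ih (by omega), Finset.sum_range_succ]
    have h1 := psim_kap a b ha σ n z k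
    have hd := mf_den a b ha σ hσ z hz (n - (k + 1)) k
    have e : mf a b σ (n - k) k z = ((b k : ℂ) - z - (a k : ℂ) ^ 2 * mf a b σ (n - (k + 1)) (k + 1) z)⁻¹ := by
      have : n - k = (n - (k + 1)) + 1 := by omega
      rw [this]; rfl
    set d := (b k : ℂ) - z - (a k : ℂ) ^ 2 * mf a b σ (n - (k + 1)) (k + 1) z with hdd
    have hdim : d.im = - (z.im + a k ^ 2 * (mf a b σ (n - (k + 1)) (k + 1) z).im) := by
      rw [hdd, Complex.sub_im, Complex.sub_im, sq_re_im]; simp; ring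
    have h2 : Complex.normSq (psim a b σ n z k) = Complex.normSq (kap a (psim a b σ n z) k) / Complex.normSq d := by
      rw [h1, e, Complex.normSq_mul, Complex.normSq_neg, Complex.normSq_inv]; rfl
    have h3 : kap a (psim a b σ n z) (k + 1) = a k * psim a b σ n z k := rfl
    rw [h3, Complex.normSq_mul, Complex.normSq_ofReal, h2, e, Complex.inv_im, hdim]
    ring

lemma psim_sum_le (ha : ∀ n, 0 < a n) (σ : ℂ) (hσ : 0 < σ.im) (n : ℕ) (z : ℂ) (hz : 0 < z.im) :
    ∑ j ∈ Finset.range (n + 1), Complex.normSq (psim a b σ (n + 1) z j) ≤ 1 / z.im ^ 2 := by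
  have h1 := psim_sum a b ha σ hσ (n + 1) z hz.le (n + 1) le_rfl
  have h2 := mf_le a b ha σ hσ z hz n 0
  have h3 := (le_abs_self _).trans (Complex.abs_im_le_norm (mf a b σ (n + 1) 0 z))
  have h4 := mf_im a b ha σ hσ z hz.le (n + 1 - (n + 1)) (n + 1)
  have h5 := mul_nonneg (Complex.normSq_nonneg (kap a (psim a b σ (n + 1) z) (n + 1))) h4.le
  have h6 : z.im * ∑ j ∈ Finset.range (n + 1), Complex.normSq (psim a b σ (n + 1) z j) ≤ 1 / z.im := by linarith
  calc _ = (z.im * ∑ j ∈ Finset.range (n + 1), Complex.normSq (psim a b σ (n + 1) z j)) / z.im := by field_simp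
    _ ≤ (1 / z.im) / z.im := by gcongr
    _ = _ := by field_simp

lemma rec_unique (ha : ∀ n, 0 < a n) (z : ℂ) (n : ℕ) (φ φ' : ℕ → ℂ)
    (h : ∀ k, k + 1 ≤ n → a k * φ (k + 1) = (z - b k) * φ k - kap a φ k)
    (h' : ∀ k, k + 1 ≤ n → a k * φ' (k + 1) = (z - b k) * φ' k - kap a φ' k) (k : ℕ) (hk : k ≤ n) :
    φ k - φ' k = (φ 0 - φ' 0) * (cpp a b z k).1 ∧ kap a φ k - kap a φ' k = (φ 0 - φ' 0) * (cpp a b z k).2 := by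
  induction k with
  | zero => simp [cpp, kap]
  | succ k ih =>
    obtain ⟨h1, h2⟩ := ih (by omega)
    have hak' : (a k : ℂ) ≠ 0 := by exact_mod_cast (ha k).ne'
    have h3 := h k hk
    have h4 := h' k hk
    constructor
    · rw [cpp]
      simp only
      field_simp
      linear_combination h3 - h4 + (z - b k) * h1 - h2
    · rw [cpp, kap, kap]
      simp only
      linear_combination a k * h1

lemma cpp_wr (ha : ∀ n, 0 < a n) (z : ℂ) (k : ℕ) :
    a k * ((cpp a b z (k + 1)).1 * (starRingEnd ℂ) (cpp a b z k).1).im =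
      z.im * ∑ j ∈ Finset.range (k + 1), Complex.normSq (cpp a b z j).1 := by
  induction k with
  | zero =>
    have := (ha 0).ne'
    simp [cpp]
    field_simp
  | succ k ih =>
    have h0 := (ha k).ne'
    have h1 := (ha (k + 1)).ne'
    have h1' : (a (k + 1) : ℂ) ≠ 0 := by exact_mod_cast h1
    rw [Finset.sum_range_succ, mul_add, ← ih]
    have e : cpp a b z (k + 1 + 1) = (((z - b (k + 1)) * (cpp a b z (k + 1)).1 - (cpp a b z (k + 1)).2) / a (k + 1), a (k + 1) * (cpp a b z (k + 1)).1) := rfl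
    have e2 : (cpp a b z (k + 1)).2 = a k * (cpp a b z k).1 := rfl
    rw [e, e2]
    generalize (cpp a b z (k + 1)).1 = p
    generalize (cpp a b z k).1 = q
    simp only
    have e3 : ((((z - b (k + 1)) * p - a k * q) / a (k + 1)) * (starRingEnd ℂ) p) =
       ((a (k + 1))⁻¹ : ℝ) * (((z - b (k + 1)) * p - a k * q) * (starRingEnd ℂ) p) := by
      push_cast; field_simp
    rw [e3, Complex.im_ofReal_mul]
    simp [Complex.normSq_apply]
    field_simp
    ring

lemma cpp_sum_ge (ha : ∀ n, 0 < a n) (z : ℂ) (hz : 0 < z.im) (n : ℕ) :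
    z.im * ∑ k ∈ Finset.range n, 1 / a k ≤ ∑ j ∈ Finset.range (n + 1), Complex.normSq (cpp a b z j).1 := by
  have key : ∀ k, z.im / a k * 2 ≤ Complex.normSq (cpp a b z (k + 1)).1 + Complex.normSq (cpp a b z k).1 := by
    intro k
    have h1 := cpp_wr a b ha z k
    have h2 : (1 : ℝ) ≤ ∑ j ∈ Finset.range (k + 1), Complex.normSq (cpp a b z j).1 := by
      rw [Finset.sum_range_succ']
      have : 0 ≤ ∑ j ∈ Finset.range k, Complex.normSq (cpp a b z (j + 1)).1 :=
        Finset.sum_nonneg fun _ _ => Complex.normSq_nonneg _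
      simp [cpp] at this ⊢
      linarith
    have h3 : z.im / a k ≤ ((cpp a b z (k + 1)).1 * (starRingEnd ℂ) (cpp a b z k).1).im := by
      rw [div_le_iff₀ (ha k)]
      nlinarith
    generalize (cpp a b z (k + 1)).1 = p at *
    generalize (cpp a b z k).1 = q at *
    simp [Complex.normSq_apply] at h3 ⊢
    nlinarith [sq_nonneg (p.im - q.re), sq_nonneg (p.re + q.im)]
  have h5 : ∑ k ∈ Finset.range n, z.im / a k * 2 ≤ ∑ k ∈ Finset.range n, (Complex.normSq (cpp a b z (k + 1)).1 + Complex.normSq (cpp a b z k).1) :=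
    Finset.sum_le_sum fun k _ => key k
  rw [Finset.sum_add_distrib, ← Finset.sum_mul] at h5
  have h6 := Finset.sum_range_succ (fun j => Complex.normSq (cpp a b z j).1) n
  have h7 := Finset.sum_range_succ' (fun j => Complex.normSq (cpp a b z j).1) n
  have h8 := Complex.normSq_nonneg (cpp a b z n).1
  have h9 := Complex.normSq_nonneg (cpp a b z 0).1
  have h10 : z.im * ∑ k ∈ Finset.range n, 1 / a k = ∑ k ∈ Finset.range n, z.im / a k := by
    rw [Finset.mul_sum]; refine Finset.sum_congr rfl fun _ _ => by ring
  rw [h10]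
  linarith
end PartD2

section PartE1
variable (a b : ℕ → ℝ)

def OrthoM (μ : Measure ℝ) : Prop :=
  ∀ n m : ℕ, ∫ x, opoly a b n x * opoly a b m x ∂μ = if n = m then 1 else 0

variable {a b}
variable {μ : Measure ℝ} [hμ : IsProbabilityMeasure μ]

lemma int_pp (ho : OrthoM a b μ) (n m : ℕ) : Integrable (fun x => opoly a b n x * opoly a b m x) μ := by
  have hsq : ∀ n, Integrable (fun x => opoly a b n x * opoly a b n x) μ := by
    intro n
    by_contra h
    have := ho n n
    rw [integral_undef h] at this
    simp at this
  refine Integrable.mono' ((hsq n).add (hsq m))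
    ((opoly_cont a b n).mul (opoly_cont a b m)).aestronglyMeasurable (Eventually.of_forall fun x => ?_)
  simp only [Pi.add_apply, norm_eq_abs]
  rw [abs_le]
  constructor <;> nlinarith [sq_nonneg (opoly a b n x + opoly a b m x), sq_nonneg (opoly a b n x - opoly a b m x),
    sq_nonneg (opoly a b n x), sq_nonneg (opoly a b m x)]

lemma int_p (ho : OrthoM a b μ) (n : ℕ) : Integrable (fun x => opoly a b n x) μ := by
  have := int_pp ho n 0
  simpa [opoly] using this

lemma bessel_real (ho : OrthoM a b μ) (g : ℝ → ℝ) (hg : Measurable g) (C : ℝ) (hC : ∀ x, |g x| ≤ C) (s : Finset ℕ) :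
    ∑ k ∈ s, (∫ x, g x * opoly a b k x ∂μ) ^ 2 ≤ ∫ x, g x ^ 2 ∂μ := by
  set c : ℕ → ℝ := fun k => ∫ x, g x * opoly a b k x ∂μ with hc
  have hgi : Integrable (fun x => g x ^ 2) μ := by
    refine Integrable.of_bound (hg.pow_const 2).aestronglyMeasurable (C ^ 2) (Eventually.of_forall fun x => ?_)
    rw [norm_eq_abs, abs_pow]
    exact pow_le_pow_left₀ (abs_nonneg _) (hC x) 2
  have hgp : ∀ k, Integrable (fun x => g x * opoly a b k x) μ := fun k =>
    (int_p ho k).bdd_mul hg.aestronglyMeasurable (Eventually.of_forall hC)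
  have hpos : 0 ≤ ∫ x, (g x - ∑ k ∈ s, c k * opoly a b k x) ^ 2 ∂μ := integral_nonneg fun x => sq_nonneg _
  have e : ∀ x, (g x - ∑ k ∈ s, c k * opoly a b k x) ^ 2 =
      g x ^ 2 - ∑ k ∈ s, (2 * c k) * (g x * opoly a b k x) +
        ∑ k ∈ s, ∑ l ∈ s, (c k * c l) * (opoly a b k x * opoly a b l x) := by
    intro x
    have : ∑ k ∈ s, ∑ l ∈ s, (c k * c l) * (opoly a b k x * opoly a b l x) = (∑ k ∈ s, c k * opoly a b k x) * ∑ k ∈ s, c k * opoly a b k x := by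
      rw [Finset.sum_mul_sum]
      refine Finset.sum_congr rfl fun k _ => Finset.sum_congr rfl fun l _ => by ring
    rw [this]
    have h2 : ∑ k ∈ s, (2 * c k) * (g x * opoly a b k x) = 2 * g x * ∑ k ∈ s, c k * opoly a b k x := by
      rw [Finset.mul_sum]
      refine Finset.sum_congr rfl fun k _ => by ring
    rw [h2]; ring
  simp_rw [e] at hpos
  have i1 : Integrable (fun x => ∑ k ∈ s, (2 * c k) * (g x * opoly a b k x)) μ :=
    integrable_finsetSum _ fun k _ => (hgp k).const_mul _
  have i2 : ∀ k, Integrable (fun x => ∑ l ∈ s, (c k * c l) * (opoly a b k x * opoly a b l x)) μ := fun k =>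
    integrable_finsetSum _ fun l _ => (int_pp ho k l).const_mul _
  have i0 : Integrable (fun x => g x ^ 2 - ∑ k ∈ s, (2 * c k) * (g x * opoly a b k x)) μ := hgi.sub i1
  rw [integral_add i0 (integrable_finsetSum _ fun k _ => i2 k), integral_sub hgi i1,
    integral_finsetSum _ (fun k _ => (hgp k).const_mul _), integral_finsetSum _ (fun k _ => i2 k)] at hpos
  have i3 : ∀ k ∈ s, ∫ x, ∑ l ∈ s, (c k * c l) * (opoly a b k x * opoly a b l x) ∂μ = c k ^ 2 := by
    intro k hk
    rw [integral_finsetSum _ (fun l _ => (int_pp ho k l).const_mul _)]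
    simp_rw [integral_const_mul, ho k]
    simp [hk, sq]
  rw [Finset.sum_congr rfl i3] at hpos
  simp_rw [integral_const_mul] at hpos
  have i4 : ∑ k ∈ s, 2 * c k * ∫ x, g x * opoly a b k x ∂μ = 2 * ∑ k ∈ s, c k ^ 2 := by
    rw [Finset.mul_sum]
    refine Finset.sum_congr rfl fun k _ => ?_
    simp only [hc]; ring
  rw [i4] at hpos
  linarith

def psi (a b : ℕ → ℝ) (μ : Measure ℝ) (z : ℂ) (k : ℕ) : ℂ := ∫ t, ((t : ℂ) - z)⁻¹ * (opoly a b k t : ℝ) ∂μ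

lemma res_norm (z : ℂ) (hz : 0 < z.im) (t : ℝ) : ‖((t : ℂ) - z)⁻¹‖ ≤ 1 / z.im := by
  rw [norm_inv, one_div]
  gcongr
  have := Complex.abs_im_le_norm ((t : ℂ) - z)
  simpa [abs_of_pos hz] using this

lemma res_ne (z : ℂ) (hz : 0 < z.im) (t : ℝ) : (t : ℂ) - z ≠ 0 := by
  intro h
  have := congrArg Complex.im h
  simp at this
  linarith

lemma res_cont (z : ℂ) (hz : 0 < z.im) : Continuous (fun t : ℝ => ((t : ℂ) - z)⁻¹) := by
  refine Continuous.inv₀ (by fun_prop) (res_ne z hz)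

lemma int_rp (ho : OrthoM a b μ) (z : ℂ) (hz : 0 < z.im) (k : ℕ) :
    Integrable (fun t : ℝ => ((t : ℂ) - z)⁻¹ * (opoly a b k t : ℝ)) μ :=
  (int_p ho k).ofReal.bdd_mul (res_cont z hz).aestronglyMeasurable (Eventually.of_forall (res_norm z hz))

lemma psi_rec (ha : ∀ n, 0 < a n) (ho : OrthoM a b μ) (z : ℂ) (hz : 0 < z.im) (k : ℕ) :
    a k * psi a b μ z (k + 1) = (z - b k) * psi a b μ z k - kap a (psi a b μ z) k := by
  have hak' : (a k : ℂ) ≠ 0 := by exact_mod_cast (ha k).ne'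
  have i1 := int_rp ho z hz k
  have ip : Integrable (fun t : ℝ => ((opoly a b k t : ℝ) : ℂ)) μ := (int_p ho k).ofReal
  have e0 : ∫ t : ℝ, ((opoly a b k t : ℝ) : ℂ) ∂μ = if k = 0 then 1 else 0 := by
    rw [integral_complex_ofReal]
    have := ho k 0
    simp only [opoly, mul_one] at this
    rw [this]; split_ifs <;> simp
  cases k with
  | zero =>
    rw [psi, ← integral_const_mul]
    have : ∀ t : ℝ, (a 0 : ℂ) * (((t : ℂ) - z)⁻¹ * (opoly a b (0 + 1) t : ℝ)) =
        ((opoly a b 0 t : ℝ) : ℂ) + (z - b 0) * (((t : ℂ) - z)⁻¹ * (opoly a b 0 t : ℝ)) := by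
      intro t
      have h1 := res_ne z hz t
      simp [opoly]
      field_simp
      ring
    simp_rw [this]
    rw [integral_add ip (i1.const_mul _), e0, integral_const_mul]
    simp [kap, psi]
    ring
  | succ k =>
    have i2 := int_rp ho z hz k
    rw [psi, ← integral_const_mul]
    have : ∀ t : ℝ, (a (k + 1) : ℂ) * (((t : ℂ) - z)⁻¹ * (opoly a b (k + 1 + 1) t : ℝ)) =
        (((opoly a b (k + 1) t : ℝ) : ℂ) + (z - b (k + 1)) * (((t : ℂ) - z)⁻¹ * (opoly a b (k + 1) t : ℝ))) - a k * (((t : ℂ) - z)⁻¹ * (opoly a b k t : ℝ)) := by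
      intro t
      have h1 := res_ne z hz t
      have h2 : (a (k + 1) : ℂ) * (opoly a b (k + 2) t : ℝ) = (t - b (k + 1)) * (opoly a b (k + 1) t : ℝ) - a k * (opoly a b k t : ℝ) := by
        exact_mod_cast congrArg (fun r : ℝ => (r : ℂ)) (opoly_rec a b ha k t)
      field_simp
      linear_combination h2
    simp_rw [this]
    have i3 : Integrable (fun t : ℝ => (((opoly a b (k + 1) t : ℝ) : ℂ) + (z - b (k + 1)) * (((t : ℂ) - z)⁻¹ * (opoly a b (k + 1) t : ℝ)))) μ :=
      ip.add (i1.const_mul _)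
    rw [integral_sub i3 (i2.const_mul _), integral_add ip (i1.const_mul _), e0, integral_const_mul, integral_const_mul]
    simp [kap, psi]

lemma psi_sum_le (ho : OrthoM a b μ) (z : ℂ) (hz : 0 < z.im) (s : Finset ℕ) :
    ∑ j ∈ s, Complex.normSq (psi a b μ z j) ≤ 1 / z.im ^ 2 := by
  have hc := res_cont z hz
  have hre : Continuous (fun t : ℝ => (((t : ℂ) - z)⁻¹).re) := Complex.continuous_re.comp hc
  have him : Continuous (fun t : ℝ => (((t : ℂ) - z)⁻¹).im) := Complex.continuous_im.comp hc
  have bre : ∀ t : ℝ, |(((t : ℂ) - z)⁻¹).re| ≤ 1 / z.im := fun t => (Complex.abs_re_le_norm _).trans (res_norm z hz t)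
  have bim : ∀ t : ℝ, |(((t : ℂ) - z)⁻¹).im| ≤ 1 / z.im := fun t => (Complex.abs_im_le_norm _).trans (res_norm z hz t)
  have h1 := bessel_real ho _ hre.measurable _ bre s
  have h2 := bessel_real ho _ him.measurable _ bim s
  have e : ∀ j, Complex.normSq (psi a b μ z j) = (∫ x : ℝ, (((x : ℂ) - z)⁻¹).re * opoly a b j x ∂μ) ^ 2 +
      (∫ x : ℝ, (((x : ℂ) - z)⁻¹).im * opoly a b j x ∂μ) ^ 2 := by
    intro j
    have i1 := int_rp ho z hz j
    have r1 : (psi a b μ z j).re = ∫ x : ℝ, (((x : ℂ) - z)⁻¹).re * opoly a b j x ∂μ := by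
      have := integral_re i1
      simp only [RCLike.re_to_complex, Complex.re_mul_ofReal] at this
      rw [psi, this]
    have r2 : (psi a b μ z j).im = ∫ x : ℝ, (((x : ℂ) - z)⁻¹).im * opoly a b j x ∂μ := by
      have := integral_im i1
      simp only [RCLike.im_to_complex, Complex.im_mul_ofReal] at this
      rw [psi, this]
    rw [Complex.normSq_apply, r1, r2]; ring
  simp_rw [e]
  rw [Finset.sum_add_distrib]
  refine (add_le_add h1 h2).trans ?_
  have sqi : ∀ g : ℝ → ℝ, Continuous g → (∀ t, |g t| ≤ 1 / z.im) → Integrable (fun x => g x ^ 2) μ := by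
    intro g hg hb
    refine Integrable.of_bound (hg.pow 2).aestronglyMeasurable ((1 / z.im) ^ 2) (Eventually.of_forall fun x => ?_)
    rw [norm_eq_abs, abs_pow]
    exact pow_le_pow_left₀ (abs_nonneg _) (hb x) 2
  rw [← integral_add (sqi _ hre bre) (sqi _ him bim)]
  calc ∫ t : ℝ, (((t : ℂ) - z)⁻¹).re ^ 2 + (((t : ℂ) - z)⁻¹).im ^ 2 ∂μ ≤ ∫ t : ℝ, 1 / z.im ^ 2 ∂μ := by
        refine integral_mono ((sqi _ hre bre).add (sqi _ him bim)) (integrable_const _) fun t => ?_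
        have h3 := res_norm z hz t
        have h4 := Complex.sq_norm (((t : ℂ) - z)⁻¹)
        rw [Complex.normSq_apply] at h4
        have h5 := pow_le_pow_left₀ (norm_nonneg _) h3 2
        rw [h4, div_pow, one_pow] at h5
        simp only
        linarith [h5]
    _ = 1 / z.im ^ 2 := by simp

lemma mf_tendsto (ha : ∀ n, 0 < a n) (ho : OrthoM a b μ)
    (hdiv : Tendsto (fun n : ℕ => ∑ k ∈ Finset.range n, 1 / a k) atTop atTop)
    (σ : ℕ → ℂ) (hσ : ∀ n, 0 < (σ n).im) (z : ℂ) (hz : 0 < z.im) :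
    Tendsto (fun n => mf a b (σ n) n 0 z) atTop (𝓝 (psi a b μ z 0)) := by
  rw [← tendsto_add_atTop_iff_nat 1]
  have key : ∀ n, Complex.normSq (mf a b (σ (n + 1)) (n + 1) 0 z - psi a b μ z 0) * (z.im * ∑ k ∈ Finset.range n, 1 / a k) ≤ 4 / z.im ^ 2 := by
    intro n
    have h1 := psim_sum_le a b ha (σ (n + 1)) (hσ _) n z hz
    have h2 := psi_sum_le ho z hz (Finset.range (n + 1))
    have h3 := cpp_sum_ge a b ha z hz n
    have h4 := rec_unique a b ha z (n + 1) (psim a b (σ (n + 1)) (n + 1) z) (psi a b μ z)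
      (fun k hk => psim_rec a b ha (σ (n + 1)) (hσ _) (n + 1) z hz.le k hk) (fun k _ => psi_rec ha ho z hz k)
    set D := mf a b (σ (n + 1)) (n + 1) 0 z - psi a b μ z 0
    have h5 : ∑ j ∈ Finset.range (n + 1), Complex.normSq D * Complex.normSq (cpp a b z j).1 ≤
        ∑ j ∈ Finset.range (n + 1), (2 * Complex.normSq (psim a b (σ (n + 1)) (n + 1) z j) + 2 * Complex.normSq (psi a b μ z j)) := by
      refine Finset.sum_le_sum fun j hj => ?_
      have := (h4 j (by have := Finset.mem_range.1 hj; omega)).1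
      rw [← Complex.normSq_mul]
      have e : D * (cpp a b z j).1 = psim a b (σ (n + 1)) (n + 1) z j - psi a b μ z j := this.symm
      rw [e]
      simp only [Complex.normSq_apply, Complex.sub_re, Complex.sub_im]
      nlinarith [sq_nonneg ((psim a b (σ (n + 1)) (n + 1) z j).re + (psi a b μ z j).re), sq_nonneg ((psim a b (σ (n + 1)) (n + 1) z j).im + (psi a b μ z j).im)]
    rw [← Finset.mul_sum, Finset.sum_add_distrib, ← Finset.mul_sum, ← Finset.mul_sum] at h5
    have h6 := mul_le_mul_of_nonneg_left h3 (Complex.normSq_nonneg D)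
    have h7 : 4 / z.im ^ 2 = 2 * (1 / z.im ^ 2) + 2 * (1 / z.im ^ 2) := by ring
    linarith
  rw [tendsto_iff_norm_sub_tendsto_zero]
  have h8 : Tendsto (fun n => ‖mf a b (σ (n + 1)) (n + 1) 0 z - psi a b μ z 0‖ ^ 2) atTop (𝓝 0) := by
    have hlim : Tendsto (fun n : ℕ => 4 / z.im ^ 2 / (z.im * ∑ k ∈ Finset.range n, 1 / a k)) atTop (𝓝 0) :=
      tendsto_const_nhds.div_atTop (hdiv.const_mul_atTop hz)
    refine squeeze_zero' (Eventually.of_forall fun _ => by positivity) ?_ hlim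
    filter_upwards [hdiv.eventually_gt_atTop 0] with n hn
    rw [le_div_iff₀ (by positivity), Complex.sq_norm]
    exact key n
  have h9 := h8.sqrt
  simpa [Real.sqrt_sq] using h9

end PartE1

section PartE2
variable {a b : ℕ → ℝ} {μ : Measure ℝ} [hμ : IsProbabilityMeasure μ]

lemma pk_nonneg (s y t : ℝ) (hy : 0 < y) : 0 ≤ y / ((t - s) ^ 2 + y ^ 2) := by positivity

lemma poisson_mf (ha : ∀ n, 0 < a n) (σ : ℂ) (hσ : 0 < σ.im) (n : ℕ) (s y : ℝ) (hy : 0 < y) :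
    Integrable (fun t : ℝ => (mf a b σ n 0 t).im * (y / ((t - s) ^ 2 + y ^ 2))) ∧
    ∫ t : ℝ, (mf a b σ n 0 t).im * (y / ((t - s) ^ 2 + y ^ 2)) = π * (mf a b σ n 0 (s + y * Complex.I)).im := by
  obtain ⟨C, hC⟩ := mf_bdd a b ha σ hσ n 0
  obtain ⟨h1, h2⟩ := poisson_uhp (mf a b σ n 0) C hC (fun z hz => mf_diff a b ha σ hσ z hz n 0) s y hy
  have h3 := h1.im
  simp only [RCLike.im_to_complex, Complex.im_mul_ofReal] at h3
  refine ⟨h3, ?_⟩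
  have h4 := integral_im h1
  simp only [RCLike.im_to_complex, Complex.im_mul_ofReal] at h4
  rw [h4, h2, Complex.im_ofReal_mul]

lemma local_est (ρ : ℝ → ℝ) (hρ : ∀ t, 0 ≤ ρ t) (h : ℝ → ℝ) (s : ℝ)
    (hI : ∀ y : ℝ, 0 < y → Integrable (fun t : ℝ => ρ t * (y / ((t - s) ^ 2 + y ^ 2))) ∧
      ∫ t : ℝ, ρ t * (y / ((t - s) ^ 2 + y ^ 2)) = π * h y) (h1 : h 1 ≤ 1)
    (W ε δ : ℝ) (hW : 0 ≤ W) (hδ : 0 < δ) (hε : 0 ≤ ε)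
    (hc : ∀ t, |t - s| ≤ δ → |ρ t - W| ≤ ε) (y : ℝ) (hy : 0 < y) :
    |h y - W| ≤ ε + y * (1 + 1 / δ ^ 2) * (1 + W) := by
  obtain ⟨i1, e1⟩ := hI y hy
  obtain ⟨i2, e2⟩ := hI 1 one_pos
  have k1 := pk_int s y hy
  have k2 := pk_int s 1 one_pos
  have f1 := pk_integral s y hy
  have f2 := pk_integral s 1 one_pos
  have hpi := Real.pi_pos
  have e3 : π * (h y - W) = ∫ t : ℝ, (ρ t * (y / ((t - s) ^ 2 + y ^ 2)) - W * (y / ((t - s) ^ 2 + y ^ 2))) := by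
    rw [integral_sub i1 (k1.const_mul W), e1, integral_const_mul, f1]; ring
  set A := y * (1 + 1 / δ ^ 2) with hA
  have hA0 : 0 < A := by positivity
  have j : Integrable (fun t : ℝ => ε * (y / ((t - s) ^ 2 + y ^ 2)) + A * (ρ t * (1 / ((t - s) ^ 2 + 1 ^ 2)) + W * (1 / ((t - s) ^ 2 + 1 ^ 2)))) :=
    (k1.const_mul ε).add ((i2.add (k2.const_mul W)).const_mul A)
  have b1 : |π * (h y - W)| ≤ ∫ t : ℝ, (ε * (y / ((t - s) ^ 2 + y ^ 2)) + A * (ρ t * (1 / ((t - s) ^ 2 + 1 ^ 2)) + W * (1 / ((t - s) ^ 2 + 1 ^ 2)))) := by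
    rw [e3, ← norm_eq_abs]
    refine norm_integral_le_of_norm_le j (Eventually.of_forall fun t => ?_)
    have hp := pk_nonneg s y t hy
    have hq := pk_nonneg s 1 t one_pos
    have hr := hρ t
    rw [← sub_mul, norm_eq_abs, abs_mul, abs_of_nonneg hp]
    by_cases ht : |t - s| ≤ δ
    · have := mul_le_mul_of_nonneg_right (hc t ht) hp
      have h5 : 0 ≤ A * (ρ t * (1 / ((t - s) ^ 2 + 1 ^ 2)) + W * (1 / ((t - s) ^ 2 + 1 ^ 2))) := by positivity
      linarith
    · push Not at ht
      have h6 : δ ^ 2 ≤ (t - s) ^ 2 := by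
        rw [← sq_abs (t - s)]; exact pow_le_pow_left₀ hδ.le ht.le 2
      have h7 : y / ((t - s) ^ 2 + y ^ 2) ≤ A * (1 / ((t - s) ^ 2 + 1 ^ 2)) := by
        have hd2 : 0 < δ ^ 2 := by positivity
        have hpos : 0 < (t - s) ^ 2 := lt_of_lt_of_le hd2 h6
        have : y / ((t - s) ^ 2 + y ^ 2) ≤ y / (t - s) ^ 2 := by
          gcongr; nlinarith
        refine this.trans ?_
        have e : A * (1 / ((t - s) ^ 2 + 1 ^ 2)) = y * (1 + 1 / δ ^ 2) / ((t - s) ^ 2 + 1) := by rw [hA]; ring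
        rw [e, div_le_div_iff₀ hpos (by positivity)]
        have h8 : (1 : ℝ) ≤ 1 / δ ^ 2 * (t - s) ^ 2 := by
          rw [div_mul_eq_mul_div, le_div_iff₀ hd2]; linarith
        nlinarith
      have h9 : |ρ t - W| ≤ ρ t + W := by rw [abs_le]; constructor <;> linarith
      calc |ρ t - W| * (y / ((t - s) ^ 2 + y ^ 2)) ≤ (ρ t + W) * (A * (1 / ((t - s) ^ 2 + 1 ^ 2))) := by
            gcongr
        _ ≤ _ := by
            have : 0 ≤ ε * (y / ((t - s) ^ 2 + y ^ 2)) := by positivity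
            nlinarith
  have i3 : Integrable (fun t : ℝ => ρ t * (1 / ((t - s) ^ 2 + 1 ^ 2)) + W * (1 / ((t - s) ^ 2 + 1 ^ 2))) := i2.add (k2.const_mul W)
  rw [integral_add (k1.const_mul ε) (i3.const_mul A), integral_const_mul, integral_const_mul, integral_add i2 (k2.const_mul W),
    integral_const_mul, e2, f1, f2, abs_mul, abs_of_pos hpi] at b1
  have b2 : π * |h y - W| ≤ π * (ε + A * (1 + W)) := by
    refine b1.trans ?_
    have : A * (π * h 1 + W * π) ≤ A * (π * 1 + W * π) := by gcongr
    linarith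
  exact le_of_mul_le_mul_left b2 hpi

lemma H_close (ha : ∀ n, 0 < a n) (ho : OrthoM a b μ)
    (hdiv : Tendsto (fun n : ℕ => ∑ k ∈ Finset.range n, 1 / a k) atTop atTop)
    (σ : ℕ → ℂ) (hσ : ∀ n, 0 < (σ n).im) (φ : ℕ → ℕ) (hφ : Tendsto φ atTop atTop) (s : ℝ)
    (W ε δ : ℝ) (hW : 0 ≤ W) (hδ : 0 < δ) (hε : 0 ≤ ε)
    (hc : ∀ᶠ j in atTop, ∀ t : ℝ, |t - s| ≤ δ → |(mf a b (σ (φ j)) (φ j) 0 t).im - W| ≤ ε) (y : ℝ) (hy : 0 < y) :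
    |(psi a b μ (s + y * Complex.I) 0).im - W| ≤ ε + y * (1 + 1 / δ ^ 2) * (1 + W) := by
  have h1 := (mf_tendsto ha ho hdiv σ hσ (s + y * Complex.I) (by simpa using hy)).comp hφ
  have h2 : Tendsto (fun j => |(mf a b (σ (φ j)) (φ j) 0 (s + y * Complex.I)).im - W|) atTop
      (𝓝 |(psi a b μ (s + y * Complex.I) 0).im - W|) :=
    (((Complex.continuous_im.tendsto _).comp h1).sub_const W).abs
  refine le_of_tendsto h2 ?_
  filter_upwards [hc, hφ.eventually_ge_atTop 1] with j hj hj1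
  refine local_est (fun t => (mf a b (σ (φ j)) (φ j) 0 t).im) (fun t => (mf_im a b ha _ (hσ _) t (by simp) _ _).le)
    (fun y => (mf a b (σ (φ j)) (φ j) 0 (s + y * Complex.I)).im) s (fun y hy => poisson_mf ha _ (hσ _) _ s y hy)
    ?_ W ε δ hW hδ hε hj y hy
  obtain ⟨m, hm⟩ : ∃ m, φ j = m + 1 := ⟨φ j - 1, by omega⟩
  rw [hm]
  have := mf_le a b ha (σ (m + 1)) (hσ _) (s + (1 : ℝ) * Complex.I) (by simp) m 0
  refine ((le_abs_self _).trans (Complex.abs_im_le_norm _)).trans (this.trans ?_)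
  simp

lemma psi_im (s y : ℝ) (hy : 0 < y) : (psi a b μ (s + y * Complex.I) 0).im = ∫ t, y / ((s - t) ^ 2 + y ^ 2) ∂μ := by
  have hz : 0 < ((s : ℂ) + y * Complex.I).im := by simpa using hy
  have hIntg : Integrable (fun t : ℝ => ((t : ℂ) - (s + y * Complex.I))⁻¹) μ :=
    Integrable.of_bound (res_cont _ hz).aestronglyMeasurable _ (Eventually.of_forall (res_norm _ hz))
  have h1 := integral_im hIntg
  simp only [RCLike.im_to_complex] at h1
  rw [psi]
  simp only [opoly, Complex.ofReal_one, mul_one]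
  rw [← h1]
  refine integral_congr_ae (Eventually.of_forall fun t => ?_)
  simp [Complex.inv_im, Complex.normSq_apply]
  congr 1; ring

lemma stieltjes_inv (f : ℝ → ℝ) (hf : Continuous f) (C c d : ℝ) (hC : ∀ t, |f t| ≤ C) (h0 : ∀ t, t ∉ Set.Icc c d → f t = 0)
    (W : ℝ → ℝ) (M : ℝ) (hM : ∀ s ∈ Set.Icc c d, ∀ y : ℝ, 0 < y → y ≤ 1 → |(psi a b μ (s + y * Complex.I) 0).im| ≤ M)
    (hW : ∀ s ∈ Set.Icc c d, Tendsto (fun y : ℝ => (psi a b μ (s + y * Complex.I) 0).im) (𝓝[>] 0) (𝓝 (W s))) :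
    π * ∫ t, f t ∂μ = ∫ s, f s * W s := by
  have hfi : Integrable f := hf.integrable_of_hasCompactSupport (HasCompactSupport.intro isCompact_Icc h0)
  have hy : ∀ k : ℕ, (0 : ℝ) < 1 / (k + 1) := fun k => by positivity
  have hy1 : ∀ k : ℕ, (1 : ℝ) / (k + 1) ≤ 1 := fun k => by
    rw [div_le_one (by positivity)]; have : (0:ℝ) ≤ k := by positivity
    linarith
  have hyt : Tendsto (fun k : ℕ => (1 : ℝ) / (k + 1)) atTop (𝓝[>] 0) :=
    tendsto_nhdsWithin_iff.2 ⟨tendsto_one_div_add_atTop_nhds_zero_nat, Eventually.of_forall hy⟩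
  have hC0 : 0 ≤ C := (abs_nonneg _).trans (hC 0)
  have swap : ∀ y : ℝ, 0 < y → ∫ t, (∫ s, f s * (y / ((s - t) ^ 2 + y ^ 2))) ∂μ = ∫ s, f s * (psi a b μ (s + y * Complex.I) 0).im := by
    intro y hy
    rw [integral_integral_swap]
    · refine integral_congr_ae (Eventually.of_forall fun s => ?_)
      simp only
      rw [integral_const_mul, psi_im s y hy]
    · have h1 : Integrable (fun p : ℝ × ℝ => ‖f p.2‖ * (1 / y)) (μ.prod volume) := (hfi.norm.comp_snd μ).mul_const _
      refine h1.mono' ?_ (Eventually.of_forall fun p => ?_)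
      · refine Continuous.aestronglyMeasurable ?_
        simp only [Function.uncurry_def]
        refine (hf.comp continuous_snd).mul (Continuous.div continuous_const (by fun_prop) ?_)
        intro p; positivity
      · simp only [Function.uncurry_def]
        rw [norm_mul]
        gcongr
        rw [norm_eq_abs, abs_of_nonneg (pk_nonneg _ _ _ hy), div_le_div_iff₀ (by positivity) hy]
        nlinarith [sq_nonneg (p.2 - p.1)]
  have L1 : Tendsto (fun k : ℕ => ∫ s, f s * (psi a b μ (s + ((1 / (k + 1) : ℝ) : ℂ) * Complex.I) 0).im) atTop (𝓝 (∫ s, f s * W s)) := by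
    refine tendsto_integral_of_dominated_convergence (fun s => ‖f s‖ * M) ?_ (hfi.norm.mul_const M) ?_ ?_
    · intro k
      have h2 : StronglyMeasurable (fun s : ℝ => ∫ t, (1 / (k + 1) : ℝ) / ((s - t) ^ 2 + (1 / (k + 1) : ℝ) ^ 2) ∂μ) := by
        refine StronglyMeasurable.integral_prod_right' (f := fun p : ℝ × ℝ => (1 / (k + 1) : ℝ) / ((p.1 - p.2) ^ 2 + (1 / (k + 1) : ℝ) ^ 2)) ?_
        refine Continuous.stronglyMeasurable (Continuous.div continuous_const (by fun_prop) ?_)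
        intro p; have := hy k; positivity
      simp_rw [psi_im _ _ (hy k)]
      exact hf.aestronglyMeasurable.mul h2.aestronglyMeasurable
    · intro k
      refine Eventually.of_forall fun s => ?_
      by_cases hs : s ∈ Set.Icc c d
      · rw [norm_mul]
        gcongr
        exact hM s hs _ (hy k) (hy1 k)
      · simp [h0 s hs]
    · refine Eventually.of_forall fun s => ?_
      by_cases hs : s ∈ Set.Icc c d
      · exact ((hW s hs).comp hyt).const_mul _
      · simp [h0 s hs]
  have conv : ∀ (y : ℝ), 0 < y → ∀ t, ∫ s, f s * (y / ((s - t) ^ 2 + y ^ 2)) = ∫ x, f (t + y * x) * (1 + x ^ 2)⁻¹ := by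
    intro y hy t
    have e1 := Measure.integral_comp_mul_left (fun x => f (t + x) * (y / (x ^ 2 + y ^ 2))) y
    rw [integral_add_left_eq_self (fun x => f x * (y / ((x - t) ^ 2 + y ^ 2))) t |>.symm]
    have e2 : ∀ x, f (t + y * x) * (y / ((y * x) ^ 2 + y ^ 2)) = y⁻¹ * (f (t + y * x) * (1 + x ^ 2)⁻¹) := by
      intro x
      have : 1 + x ^ 2 ≠ 0 := by positivity
      have h3 : (y * x) ^ 2 + y ^ 2 ≠ 0 := by positivity
      field_simp; ring
    simp_rw [e2] at e1
    rw [integral_const_mul, abs_of_pos (inv_pos.2 hy), smul_eq_mul] at e1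
    have := mul_left_cancel₀ (inv_pos.2 hy).ne' e1
    rw [this]
    simp
  have bnd : ∀ t y x : ℝ, ‖f (t + y * x) * (1 + x ^ 2)⁻¹‖ ≤ C * (1 + x ^ 2)⁻¹ := by
    intro t y x
    rw [norm_mul, norm_eq_abs, norm_eq_abs, abs_of_nonneg (by positivity : 0 ≤ (1 + x ^ 2)⁻¹)]
    gcongr; exact hC _
  have contx : ∀ t y : ℝ, Continuous (fun x : ℝ => f (t + y * x) * (1 + x ^ 2)⁻¹) := by
    intro t y
    refine (hf.comp (by fun_prop)).mul (Continuous.inv₀ (by fun_prop) ?_)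
    intro x; positivity
  have L2 : Tendsto (fun k : ℕ => ∫ t, (∫ s, f s * ((1 / (k + 1) : ℝ) / ((s - t) ^ 2 + (1 / (k + 1) : ℝ) ^ 2))) ∂μ) atTop (𝓝 (∫ t, π * f t ∂μ)) := by
    simp_rw [conv _ (hy _)]
    refine tendsto_integral_of_dominated_convergence (fun t => C * π) ?_ (integrable_const _) ?_ ?_
    · intro k
      refine (StronglyMeasurable.integral_prod_right' (f := fun p : ℝ × ℝ => f (p.1 + (1 / (k + 1) : ℝ) * p.2) * (1 + p.2 ^ 2)⁻¹) ?_).aestronglyMeasurable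
      refine Continuous.stronglyMeasurable ((hf.comp (by fun_prop)).mul (Continuous.inv₀ (by fun_prop) ?_))
      intro p; positivity
    · intro k
      refine Eventually.of_forall fun t => ?_
      refine (norm_integral_le_of_norm_le (integrable_inv_one_add_sq.const_mul C) (Eventually.of_forall (bnd t _))).trans ?_
      rw [integral_const_mul, integral_univ_inv_one_add_sq]
    · refine Eventually.of_forall fun t => ?_
      have : π * f t = ∫ x : ℝ, f t * (1 + x ^ 2)⁻¹ := by
        rw [integral_const_mul, integral_univ_inv_one_add_sq]; ring
      rw [this]
      refine tendsto_integral_of_dominated_convergence (fun x => C * (1 + x ^ 2)⁻¹) (fun k => (contx t _).aestronglyMeasurable)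
        (integrable_inv_one_add_sq.const_mul C) (fun k => Eventually.of_forall (bnd t _)) (Eventually.of_forall fun x => ?_)
      refine Tendsto.mul_const _ ?_
      refine (hf.tendsto t).comp ?_
      have := (tendsto_one_div_add_atTop_nhds_zero_nat (𝕜 := ℝ)).mul_const x
      simpa using this.const_add t
  simp_rw [swap _ (hy _)] at L2
  rw [← integral_const_mul]
  exact tendsto_nhds_unique L2 L1
end PartE2

section PartF1
variable {a b : ℕ → ℝ} {μ : Measure ℝ} [hμ : IsProbabilityMeasure μ]

lemma div_of_carleman (N : ℕ) (hN : 0 < N) (ha : ∀ n, 0 < a n) (i : ℕ)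
    (hCarleman : Tendsto (fun n : ℕ => ∑ j ∈ Finset.Icc 1 n, 1 / a (j * N + i - 1)) atTop atTop) :
    Tendsto (fun n : ℕ => ∑ k ∈ Finset.range n, 1 / a k) atTop atTop := by
  have hmono : Monotone (fun n : ℕ => ∑ k ∈ Finset.range n, 1 / a k) := by
    refine monotone_nat_of_le_succ fun n => ?_
    rw [Finset.sum_range_succ]
    have := one_div_pos.2 (ha n)
    linarith
  refine tendsto_atTop_of_monotone_of_subseq (φ := fun n => n * N + i) hmono (l := atTop) ?_
  refine tendsto_atTop_mono (fun n => ?_) hCarleman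
  have hinj : Set.InjOn (fun j : ℕ => j * N + i - 1) (Finset.Icc 1 n : Finset ℕ) := by
    intro j hj k hk h
    simp only [Finset.coe_Icc, Set.mem_Icc] at hj hk
    simp only at h
    have h1 : 1 * N ≤ j * N := Nat.mul_le_mul_right N hj.1
    have h2 : 1 * N ≤ k * N := Nat.mul_le_mul_right N hk.1
    have h3 : j * N = k * N := by omega
    exact Nat.eq_of_mul_eq_mul_right hN h3
  have e : ∑ j ∈ Finset.Icc 1 n, 1 / a (j * N + i - 1) = ∑ k ∈ (Finset.Icc 1 n).image (fun j : ℕ => j * N + i - 1), 1 / a k :=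
    (Finset.sum_image (f := fun k => 1 / a k) hinj).symm
  rw [e]
  refine Finset.sum_le_sum_of_subset_of_nonneg ?_ fun k _ _ => (one_div_pos.2 (ha k)).le
  intro k hk
  obtain ⟨j, hj, rfl⟩ := Finset.mem_image.1 hk
  rw [Finset.mem_Icc] at hj
  have h1 : 1 * N ≤ j * N := Nat.mul_le_mul_right N hj.1
  have h2 : j * N ≤ n * N := Nat.mul_le_mul_right N hj.2
  refine Finset.mem_range.2 ?_
  show j * N + i - 1 < n * N + i
  omega

lemma no_atom (ho : OrthoM a b μ) (x : ℝ) (N : ℕ) (hN : 0 < N) (i : ℕ)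
    (h : Tendsto (fun n : ℕ => ∑ j ∈ Finset.range (n + 1), (opoly a b (j * N + i) x) ^ 2) atTop atTop) : μ {x} = 0 := by
  have hm : MeasurableSet ({x} : Set ℝ) := measurableSet_singleton x
  have e : ∀ F : ℝ → ℝ, ∫ t, Set.indicator {x} (fun _ => (1 : ℝ)) t * F t ∂μ = μ.real {x} * F x := by
    intro F
    have : (fun t => Set.indicator {x} (fun _ => (1 : ℝ)) t * F t) = Set.indicator {x} (fun _ => F x) := by
      funext t
      by_cases ht : t = x
      · subst ht; simp
      · simp [ht]
    rw [this, integral_indicator hm, setIntegral_const, smul_eq_mul]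
  by_contra hne
  have hpos : 0 < μ.real {x} := by
    rw [measureReal_def]; exact ENNReal.toReal_pos hne (measure_ne_top _ _)
  have key : ∀ n : ℕ, ∑ j ∈ Finset.range (n + 1), (opoly a b (j * N + i) x) ^ 2 ≤ 1 / μ.real {x} := by
    intro n
    have h1 := bessel_real ho (Set.indicator {x} (fun _ => (1 : ℝ))) (measurable_const.indicator hm) 1 (fun t => by
      by_cases ht : t = x
      · subst ht; simp
      · simp [ht]) ((Finset.range (n + 1)).image (fun j => j * N + i))
    simp_rw [e, sq (Set.indicator _ _ _), e] at h1
    rw [Finset.sum_image (fun j _ k _ h => by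
      exact Nat.eq_of_mul_eq_mul_right hN (by omega))] at h1
    simp_rw [mul_pow] at h1
    rw [← Finset.mul_sum] at h1
    simp only [Set.mem_singleton_iff, Set.indicator_of_mem, mul_one] at h1
    rw [le_div_iff₀ hpos]
    have h2 : μ.real {x} * (μ.real {x} * ∑ j ∈ Finset.range (n + 1), (opoly a b (j * N + i) x) ^ 2) ≤ μ.real {x} * 1 := by
      linarith
    have := le_of_mul_le_mul_left h2 hpos
    linarith
  obtain ⟨n, hn⟩ := (h.eventually_gt_atTop (1 / μ.real {x})).exists
  exact absurd (key n) (not_le.2 hn)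

lemma mf_density (ha : ∀ n, 0 < a n) (n : ℕ) (κ : ℂ) (hκ : 0 < κ.im) (t : ℝ) :
    (mf a b (κ / a n) (n + 1) 0 t).im * (a n * Complex.normSq ((opoly a b (n + 1) t : ℝ) + (opoly a b n t : ℝ) * κ)) = κ.im := by
  have h0 := ha n
  have h0' : (a n : ℂ) ≠ 0 := by exact_mod_cast h0.ne'
  have him : (κ / a n).im = κ.im / a n := Complex.div_ofReal_im κ (a n)
  have h1 := mf_real a b ha (κ / a n) (by rw [him]; positivity) t (n + 1) (n + 1) 0 rfl
  rw [cpp_real a b ha] at h1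
  have h3 : mf a b (κ / a n) 0 (n + 1) t = κ / a n := rfl
  rw [h3] at h1
  have e : ((opoly a b (n + 1) t : ℝ) : ℂ) + ((a n * opoly a b n t : ℝ) : ℂ) * (κ / a n) = (opoly a b (n + 1) t : ℝ) + (opoly a b n t : ℝ) * κ := by
    push_cast; field_simp
  rw [e, him] at h1
  rw [eq_div_iff h0.ne'] at h1
  rw [← h1]
  ring

lemma kappa_exists (c : ℝ) (q : ℂ) (hc : c ≠ 0) (hq : 0 < q.im) : ∃ κ : ℂ, κ.im = |c| * q.im / Complex.normSq q ∧
    ∀ v w : ℝ, Complex.normSq q * Complex.normSq ((w : ℂ) + v * κ) = Complex.normSq (c * v + q * w) := by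
  have hq0 : q ≠ 0 := by rintro rfl; simp at hq
  have hn : 0 < Complex.normSq q := Complex.normSq_pos.2 hq0
  have base : ∀ v w : ℝ, Complex.normSq q * Complex.normSq ((w : ℂ) + v * (c / q)) = Complex.normSq (c * v + q * w) := by
    intro v w
    rw [← Complex.normSq_mul]
    congr 1
    field_simp; ring
  have him : ((c : ℂ) / q).im = - c * q.im / Complex.normSq q := by
    rw [Complex.div_im]; simp [neg_div]
  rcases lt_or_gt_of_ne hc with h | h
  · exact ⟨c / q, by rw [him, abs_of_neg h], base⟩
  · refine ⟨(starRingEnd ℂ) (c / q), by rw [Complex.conj_im, him, abs_of_pos h]; ring, fun v w => ?_⟩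
    rw [← base, ← Complex.normSq_conj ((w : ℂ) + v * (c / q))]
    simp

lemma dens_local (N : ℕ) (hN : 0 < N) (i : ℕ) (ha : ∀ n, 0 < a n) (ho : OrthoM a b μ)
    (hdiv : Tendsto (fun n : ℕ => ∑ k ∈ Finset.range n, 1 / a k) atTop atTop)
    (u v : ℝ) (c s G : C(Set.Icc u v, ℝ)) (q : C(Set.Icc u v, ℂ))
    (hc : ∀ x, c x ≠ 0) (hs : ∀ x, 0 < s x) (hG : ∀ x, 0 < G x) (hq : ∀ x, (q x).im = s x / 2)
    (hM : ∃ M, ∀ᶠ n : ℕ in atTop, ∀ x : Set.Icc u v, √(a (n*N+i-1)) * |opoly a b (n*N+i-1) x| ≤ M ∧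
      √(a (n*N+i-1)) * |opoly a b (n*N+i) x| ≤ M)
    (hlim : ∀ ε > 0, ∀ᶠ n : ℕ in atTop, ∀ x : Set.Icc u v, |a (n*N+i-1) * ‖(c x:ℂ) * (opoly a b (n*N+i-1) x : ℝ) +
      q x * (opoly a b (n*N+i) x : ℝ)‖^2 - G x| < ε)
    (s0 : Set.Icc u v) (hs0 : (s0 : ℝ) ∈ Set.Ioo u v) (ε : ℝ) (hε : 0 < ε) :
    ∃ δ > 0, ∀ x : ℝ, |x - s0| ≤ δ → ∀ y : ℝ, 0 < y →
      |(psi a b μ (x + y * Complex.I) 0).im - |c s0| * s s0 / (2 * G s0)| ≤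
        ε + y * (1 + 1 / δ ^ 2) * (1 + |c s0| * s s0 / (2 * G s0)) := by
  obtain ⟨M, hM⟩ := hM
  have hG0 := hG s0
  have hss := hs s0
  have hqi : 0 < (q s0).im := by rw [hq]; linarith
  obtain ⟨κ, hκ1, hκ2⟩ := kappa_exists (c s0) (q s0) (hc s0) hqi
  have hq0 : q s0 ≠ 0 := by intro h; rw [h] at hqi; simp at hqi
  have hn : 0 < Complex.normSq (q s0) := Complex.normSq_pos.2 hq0
  have hc0 : 0 < |c s0| := abs_pos.2 (hc s0)
  have hκ : 0 < κ.im := by rw [hκ1]; positivity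
  set L := |c s0| * s s0 with hL
  have hcont : ContinuousAt (fun r : ℝ => L / (2 * r)) (G s0) := by
    refine ContinuousAt.div continuousAt_const (by fun_prop) (by positivity)
  obtain ⟨η, hη, hη2⟩ := Metric.continuousAt_iff.1 hcont ε hε
  -- bounds
  set M1 := max M 0 + 1 with hM1
  have hM1pos : 0 < M1 := by have := le_max_right M 0; linarith
  set B := (‖c‖ + ‖q‖) * M1 with hB
  have hB0 : 0 ≤ B := by positivity
  set θ := η / 3 / (2 * (B + 1) * M1 * 2) with hθ
  have hθ0 : 0 < θ := by positivity
  obtain ⟨δc, hδc, hδc2⟩ := Metric.continuousAt_iff.1 (c.continuous.continuousAt (x := s0)) θ hθ0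
  obtain ⟨δq, hδq, hδq2⟩ := Metric.continuousAt_iff.1 (q.continuous.continuousAt (x := s0)) θ hθ0
  obtain ⟨δG, hδG, hδG2⟩ := Metric.continuousAt_iff.1 (G.continuous.continuousAt (x := s0)) (η / 3) (by positivity)
  obtain ⟨δu, hδu, hδu2⟩ : ∃ δu > 0, δu < s0 - u ∧ δu < v - s0 := by
    refine ⟨min (s0 - u) (v - s0) / 2, ?_, ?_, ?_⟩
    · have : 0 < min ((s0 : ℝ) - u) (v - s0) := lt_min (by linarith [hs0.1]) (by linarith [hs0.2])
      linarith
    · have := min_le_left ((s0 : ℝ) - u) (v - s0); linarith [hs0.1]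
    · have := min_le_right ((s0 : ℝ) - u) (v - s0); linarith [hs0.2]
  obtain ⟨d, hd, hd1, hd2, hd3, hd4⟩ : ∃ d > 0, d < δc ∧ d < δq ∧ d < δG ∧ d < δu := by
    refine ⟨min (min δc δq) (min δG δu) / 2, by positivity, ?_, ?_, ?_, ?_⟩
    all_goals
      have h0 : 0 < min (min δc δq) (min δG δu) := by positivity
      have h1 := min_le_left (min δc δq) (min δG δu)
      have h2 := min_le_right (min δc δq) (min δG δu)
      have h3 := min_le_left δc δq
      have h4 := min_le_right δc δq
      have h5 := min_le_left δG δu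
      have h6 := min_le_right δG δu
      linarith
  refine ⟨d / 2, by positivity, fun x hx y hy => ?_⟩
  refine H_close ha ho hdiv (fun n => κ / a (n - 1)) (fun n => ?_) (fun j => j * N + i) ?_ x _ ε (d / 2)
    (by positivity) (by positivity) hε.le ?_ y hy
  · have : (κ / a (n - 1)).im = κ.im / a (n - 1) := Complex.div_ofReal_im κ _
    rw [this]; exact div_pos hκ (ha _)
  · refine tendsto_atTop_mono (fun n => ?_) tendsto_id
    have := Nat.le_mul_of_pos_right n hN
    simp only [id]; omega
  · filter_upwards [hM, hlim (η / 3) (by positivity), eventually_ge_atTop 1] with j hj1 hj2 hj3 t ht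
    have htd : |t - s0| ≤ d := by
      have e : t - s0 = (t - x) + (x - s0) := by ring
      rw [e]; exact (abs_add_le _ _).trans (by linarith)
    have htK : t ∈ Set.Icc u v := by
      rw [abs_le] at htd
      constructor <;> linarith [hδu2.1, hδu2.2]
    set T : Set.Icc u v := ⟨t, htK⟩ with hT
    have hdist : dist T s0 ≤ d := by rw [Subtype.dist_eq, Real.dist_eq]; exact htd
    have c1 := hδc2 (lt_of_le_of_lt hdist hd1)
    have c2 := hδq2 (lt_of_le_of_lt hdist hd2)
    have c3 := hδG2 (lt_of_le_of_lt hdist hd3)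
    rw [Real.dist_eq] at c1 c3
    rw [dist_eq_norm] at c2
    obtain ⟨n, hn1⟩ : ∃ n, j * N + i = n + 1 := by
      have := Nat.mul_le_mul hj3 hN
      exact ⟨j * N + i - 1, by omega⟩
    have hj1' := hj1 T
    have hj2' := hj2 T
    rw [hn1] at hj1' hj2' ⊢
    simp only [Nat.add_sub_cancel] at hj1' hj2' ⊢
    have hden := mf_density (b := b) ha n κ hκ t
    have hval : (T : ℝ) = t := rfl
    rw [hval] at hj1' hj2'
    set V1 := opoly a b n t
    set V2 := opoly a b (n + 1) t
    have han := ha n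
    have hsq : (0:ℝ) < √(a n) := Real.sqrt_pos.2 han
    set A : ℂ := √(a n) * ((c T : ℂ) * V1 + q T * V2) with hA
    set D : ℂ := √(a n) * ((c s0 : ℂ) * V1 + q s0 * V2) with hD
    have b1 : √(a n) * |V1| ≤ M1 := hj1'.1.trans (by rw [hM1]; linarith [le_max_left M 0])
    have b2 : √(a n) * |V2| ≤ M1 := hj1'.2.trans (by rw [hM1]; linarith [le_max_left M 0])
    have gen : ∀ (x1 : ℝ) (x2 : ℂ), ‖(√(a n) : ℂ) * ((x1 : ℂ) * V1 + x2 * V2)‖ ≤ (|x1| + ‖x2‖) * M1 := by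
      intro x1 x2
      have h1 : (√(a n) : ℂ) * ((x1 : ℂ) * V1 + x2 * V2) = x1 * ((√(a n) * V1 : ℝ) : ℂ) + x2 * ((√(a n) * V2 : ℝ) : ℂ) := by
        push_cast; ring
      rw [h1]
      refine (norm_add_le _ _).trans ?_
      rw [norm_mul, norm_mul, Complex.norm_real, Complex.norm_real, Complex.norm_real, norm_eq_abs, norm_eq_abs, norm_eq_abs,
        abs_mul, abs_mul, abs_of_pos hsq, add_mul]
      gcongr
    have nA : ‖A‖ ≤ B := by
      refine (gen _ _).trans ?_
      have h1 := c.norm_coe_le_norm T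
      have h2 := q.norm_coe_le_norm T
      rw [norm_eq_abs] at h1
      rw [hB]; gcongr
    have nD : ‖D‖ ≤ B := by
      refine (gen _ _).trans ?_
      have h1 := c.norm_coe_le_norm s0
      have h2 := q.norm_coe_le_norm s0
      rw [norm_eq_abs] at h1
      rw [hB]; gcongr
    have nAD : ‖A - D‖ ≤ (2 * θ) * M1 := by
      have e : A - D = √(a n) * (((c T - c s0 : ℝ) : ℂ) * V1 + (q T - q s0) * V2) := by
        rw [hA, hD]; push_cast; ring
      rw [e]
      refine (gen _ _).trans ?_
      gcongr
      linarith
    have hAG : |‖A‖ ^ 2 - G T| < η / 3 := by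
      have e : ‖A‖ ^ 2 = a n * ‖(c T:ℂ) * (V1 : ℝ) + q T * (V2 : ℝ)‖^2 := by
        rw [hA, norm_mul, Complex.norm_real, norm_eq_abs, abs_of_pos hsq, mul_pow, Real.sq_sqrt han.le]
      rw [e]; exact hj2'
    have hAD : |‖D‖ ^ 2 - ‖A‖ ^ 2| < η / 3 + 0 := by
      have e : ‖D‖ ^ 2 - ‖A‖ ^ 2 = (‖D‖ - ‖A‖) * (‖D‖ + ‖A‖) := by ring
      have h1 : |‖D‖ - ‖A‖| ≤ ‖A - D‖ := by rw [norm_sub_rev]; exact abs_norm_sub_norm_le D A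
      rw [e, abs_mul, abs_of_nonneg (by positivity : 0 ≤ ‖D‖ + ‖A‖)]
      have h2 : |‖D‖ - ‖A‖| * (‖D‖ + ‖A‖) ≤ (2 * θ * M1) * (2 * B) := by
        have := h1.trans nAD
        gcongr
        linarith
      have h3 : (2 * θ * M1) * (2 * B) < (2 * θ * M1) * (2 * (B + 1)) := by
        gcongr; linarith
      have h4 : (2 * θ * M1) * (2 * (B + 1)) = η / 3 := by
        rw [hθ]; field_simp
      linarith
    have hDG : |‖D‖ ^ 2 - G s0| < η := by
      rw [abs_lt] at *
      constructor <;> linarith [hAG.1, hAG.2, hAD.1, hAD.2, c3.1, c3.2]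
    have hfin := hη2 (x := ‖D‖ ^ 2) (by rw [Real.dist_eq]; exact hDG)
    rw [Real.dist_eq] at hfin
    have hm : (mf a b (κ / a n) (n + 1) 0 t).im = L / (2 * ‖D‖ ^ 2) := by
      have e2 : ‖D‖ ^ 2 = a n * (Complex.normSq (q s0) * Complex.normSq ((V2 : ℂ) + V1 * κ)) := by
        rw [hκ2, hD, norm_mul, Complex.norm_real, norm_eq_abs, abs_of_pos hsq, mul_pow, Real.sq_sqrt han.le, Complex.sq_norm]
      have e3 : a n * Complex.normSq ((V2 : ℂ) + V1 * κ) ≠ 0 := by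
        intro h; rw [h, mul_zero] at hden; exact hκ.ne hden
      have e4 : ‖D‖ ^ 2 = Complex.normSq (q s0) * (a n * Complex.normSq ((V2 : ℂ) + V1 * κ)) := by rw [e2]; ring
      rw [e4, eq_div_iff (by have := mul_ne_zero hn.ne' e3; positivity)]
      have e5 : (mf a b (κ / a n) (n + 1) 0 t).im * (2 * (Complex.normSq (q s0) * (a n * Complex.normSq ((V2 : ℂ) + V1 * κ)))) =
        2 * Complex.normSq (q s0) * ((mf a b (κ / a n) (n + 1) 0 t).im * (a n * Complex.normSq ((V2 : ℂ) + V1 * κ))) := by ring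
      rw [e5, hden, hκ1, hq, hL]
      field_simp
    rw [hm]
    exact hfin.le
end PartF1

section PartF2
variable {a b : ℕ → ℝ} {μ : Measure ℝ} [hμ : IsProbabilityMeasure μ]

def cutf (u v : ℝ) (k : ℕ) (t : ℝ) : ℝ := max 0 (min 1 ((k + 1 : ℝ) * min (t - u) (v - t) - 1))

lemma cutf_cont (u v : ℝ) (k : ℕ) : Continuous (cutf u v k) := by
  unfold cutf; fun_prop

lemma cutf_nonneg (u v : ℝ) (k : ℕ) (t : ℝ) : 0 ≤ cutf u v k t := le_max_left _ _

lemma cutf_le (u v : ℝ) (k : ℕ) (t : ℝ) : cutf u v k t ≤ 1 := max_le zero_le_one (min_le_left _ _)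

lemma cutf_zero (u v : ℝ) (k : ℕ) (t : ℝ) (ht : t ∉ Set.Icc (u + 1 / (k + 1 : ℝ)) (v - 1 / (k + 1 : ℝ))) : cutf u v k t = 0 := by
  have hk : (0 : ℝ) < k + 1 := by positivity
  refine max_eq_left ((min_le_right _ _).trans ?_)
  by_contra h
  push Not at h
  apply ht
  have h1 : 1 / (k + 1 : ℝ) < min (t - u) (v - t) := by
    rw [div_lt_iff₀ hk]; linarith
  have h2 := min_le_left (t - u) (v - t)
  have h3 := min_le_right (t - u) (v - t)
  constructor <;> linarith

lemma cutf_tendsto (u v t : ℝ) : Tendsto (fun k => cutf u v k t) atTop (𝓝 (Set.indicator (Set.Ioo u v) (fun _ => (1 : ℝ)) t)) := by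
  by_cases ht : t ∈ Set.Ioo u v
  · rw [Set.indicator_of_mem ht]
    refine tendsto_const_nhds.congr' ?_
    have hm : 0 < min (t - u) (v - t) := lt_min (by linarith [ht.1]) (by linarith [ht.2])
    obtain ⟨n, hn⟩ := exists_nat_gt (2 / min (t - u) (v - t))
    filter_upwards [eventually_ge_atTop n] with k hk
    have h1 : (n : ℝ) ≤ k := by exact_mod_cast hk
    rw [div_lt_iff₀ hm] at hn
    have h2 : 1 ≤ (k + 1 : ℝ) * min (t - u) (v - t) - 1 := by nlinarith
    rw [cutf, min_eq_left h2, max_eq_right zero_le_one]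
  · rw [Set.indicator_of_notMem ht]
    refine tendsto_const_nhds.congr' (Eventually.of_forall fun k => ?_)
    refine (cutf_zero u v k t ?_).symm
    intro h
    apply ht
    have hk : (0 : ℝ) < 1 / (k + 1) := by positivity
    exact ⟨by linarith [h.1], by linarith [h.2]⟩

lemma ident (u v : ℝ) (w : ℝ → ℝ) (hw : Continuous w) (hw0 : ∀ t, 0 ≤ w t)
    (h : ∀ f : ℝ → ℝ, Continuous f → ∀ C c d : ℝ, (∀ t, |f t| ≤ C) → u < c → d < v → (∀ t, t ∉ Set.Icc c d → f t = 0) →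
      ∫ t, f t ∂μ = ∫ t, f t * w t) :
    μ.restrict (Set.Ioo u v) = (volume.restrict (Set.Ioo u v)).withDensity (fun x => ENNReal.ofReal (w x)) := by
  have hwint : IntegrableOn w (Set.Ioo u v) := (hw.integrableOn_Icc (a := u) (b := v)).mono_set Set.Ioo_subset_Icc_self
  obtain ⟨Cw, hCw⟩ := isCompact_Icc.exists_bound_of_continuousOn (s := Set.Icc u v) hw.continuousOn
  haveI : IsFiniteMeasure ((volume.restrict (Set.Ioo u v)).withDensity (fun x => ENNReal.ofReal (w x))) :=
    isFiniteMeasure_withDensity_ofReal hwint.2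
  refine ext_of_forall_integral_eq_of_IsFiniteMeasure fun g => ?_
  have e2 : ∫ x, g x ∂((volume.restrict (Set.Ioo u v)).withDensity (fun x => ENNReal.ofReal (w x))) =
      ∫ x in Set.Ioo u v, g x * w x := by
    rw [integral_withDensity_eq_integral_toReal_smul hw.measurable.ennreal_ofReal (Eventually.of_forall fun x => ENNReal.ofReal_lt_top)]
    refine integral_congr_ae (Eventually.of_forall fun x => ?_)
    simp only [ENNReal.toReal_ofReal (hw0 x), smul_eq_mul]; ring
  rw [e2, ← integral_indicator measurableSet_Ioo, ← integral_indicator measurableSet_Ioo]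
  have hg : ∀ t, |g t| ≤ ‖g‖ := fun t => g.norm_coe_le_norm t
  have hgc : ∀ k, Continuous (fun t => g t * cutf u v k t) := fun k => g.continuous.mul (cutf_cont u v k)
  have hgb : ∀ k t, |g t * cutf u v k t| ≤ ‖g‖ := by
    intro k t
    rw [abs_mul, abs_of_nonneg (cutf_nonneg u v k t)]
    calc |g t| * cutf u v k t ≤ ‖g‖ * 1 := by gcongr; exacts [cutf_nonneg u v k t, hg t, cutf_le u v k t]
      _ = ‖g‖ := mul_one _
  have heq : ∀ k, ∫ t, g t * cutf u v k t ∂μ = ∫ t, g t * cutf u v k t * w t := by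
    intro k
    have hk : (0 : ℝ) < 1 / (k + 1) := by positivity
    refine h _ (hgc k) ‖g‖ (u + 1 / (k + 1 : ℝ)) (v - 1 / (k + 1 : ℝ)) (hgb k) (by linarith) (by linarith) fun t ht => ?_
    simp [cutf_zero u v k t ht]
  have L1 : Tendsto (fun k => ∫ t, g t * cutf u v k t ∂μ) atTop (𝓝 (∫ t, (Set.Ioo u v).indicator (fun x => g x) t ∂μ)) := by
    refine tendsto_integral_of_dominated_convergence (fun _ => ‖g‖) (fun k => (hgc k).aestronglyMeasurable) (integrable_const _)
      (fun k => Eventually.of_forall (hgb k)) (Eventually.of_forall fun t => ?_)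
    have := (cutf_tendsto u v t).const_mul (g t)
    convert this using 2
    by_cases ht : t ∈ Set.Ioo u v
    · simp [ht]
    · simp [Set.indicator_of_notMem ht]
  have L2 : Tendsto (fun k => ∫ t, g t * cutf u v k t * w t) atTop (𝓝 (∫ t, (Set.Ioo u v).indicator (fun x => g x * w x) t)) := by
    refine tendsto_integral_of_dominated_convergence ((Set.Icc u v).indicator (fun _ => ‖g‖ * Cw)) (fun k => ((hgc k).mul hw).aestronglyMeasurable)
      ?_ (fun k => Eventually.of_forall fun t => ?_) (Eventually.of_forall fun t => ?_)
    · rw [integrable_indicator_iff measurableSet_Icc]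
      exact integrableOn_const (by simp)
    · by_cases ht : t ∈ Set.Icc u v
      · rw [Set.indicator_of_mem ht, norm_mul]
        gcongr
        · exact hgb k t
        · exact hCw t ht
      · have : cutf u v k t = 0 := by
          refine cutf_zero u v k t fun h' => ht ?_
          have hk : (0 : ℝ) < 1 / (k + 1) := by positivity
          exact ⟨by linarith [h'.1], by linarith [h'.2]⟩
        simp [this, Set.indicator_of_notMem ht]
    · have := ((cutf_tendsto u v t).const_mul (g t)).mul_const (w t)
      convert this using 2
      by_cases ht : t ∈ Set.Ioo u v
      · simp [ht]
      · simp [Set.indicator_of_notMem ht]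
  simp_rw [heq] at L1
  exact tendsto_nhds_unique L1 L2

end PartF2

theorem christoffel_main
    (N : ℕ) (hN : 0 < N) (r : ℕ) (hr : 0 < r)
    (a b : ℕ → ℝ) (ha : ∀ n, 0 < a n)
    (i : ℕ) (hi : i < N) (u v : ℝ) (huv : u < v)
    (hΛ : ∀ x ∈ Set.Icc u v, ∃ d < (0 : ℝ),
      Tendsto (fun j : ℕ => discr (Xmat a b N (j * N + i) x)) atTop (𝓝 d))
    (hratio : Tendsto (fun j : ℕ => a ((j + 1) * N + i - 1) / a (j * N + i - 1))
      atTop (𝓝 1))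
    (hDr : memDK r (Set.Icc u v) (fun j x => Xmat a b N (j * N + i) x))
    (XX : ℝ → Mat2)
    (hXX : TendstoUniformlyOn (fun j x => Xmat a b N (j * N + i) x) XX atTop (Set.Icc u v))
    (hCarleman : Tendsto (fun n : ℕ => ∑ j ∈ Finset.Icc 1 n, 1 / a (j * N + i - 1))
      atTop atTop)
    (μ : Measure ℝ) (hμ : IsProbabilityMeasure μ)
    (horth : ∀ n m : ℕ, ∫ x, opoly a b n x * opoly a b m x ∂μ = if n = m then 1 else 0) :
    ∃ w : ℝ → ℝ, ContinuousOn w (Set.Icc u v) ∧ (∀ x ∈ Set.Icc u v, 0 < w x) ∧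
      μ.restrict (Set.Icc u v) =
        (volume.restrict (Set.Icc u v)).withDensity (fun x => ENNReal.ofReal (w x)) ∧
      TendstoUniformlyOn
        (fun n x => (∑ j ∈ Finset.Icc 1 (n + 1), 1 / a (j * N + i - 1))⁻¹ *
          ∑ j ∈ Finset.range (n + 1), (opoly a b (j * N + i) x) ^ 2)
        (fun x => |XX x 1 0| / (π * w x * Real.sqrt (-discr (XX x))))
        atTop (Set.Icc u v) := by
  obtain ⟨c, s, G, q, hc, hc0, hs, hs0, hG, hq, hM, hlim, hces⟩ :=
    partA N hN r hr a b ha i u v hΛ hratio hDr XX hXX hCarleman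
  have ho : OrthoM a b μ := horth
  have hdiv := div_of_carleman N hN ha i hCarleman
  have hloc := dens_local N hN i ha ho hdiv u v c s G q hc0 hs0 hG hq hM hlim
  have hpi := Real.pi_pos
  set W : Set.Icc u v → ℝ := fun x => |c x| * s x / (2 * G x) with hW
  have hWc : Continuous W := by
    refine Continuous.div (c.continuous.abs.mul s.continuous) (continuous_const.mul G.continuous) fun x => ?_
    have := hG x; positivity
  have hWpos : ∀ x, 0 < W x := fun x => by
    have h1 := hG x; have h2 := hs0 x; have h3 := abs_pos.2 (hc0 x)
    simp only [hW]; positivity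
  set w : ℝ → ℝ := fun t => Set.IccExtend huv.le W t / π with hw
  have hwc : Continuous w := (hWc.Icc_extend').div_const π
  have hwpos : ∀ t, 0 < w t := fun t => div_pos (hWpos _) hpi
  have hwK : ∀ x (hx : x ∈ Set.Icc u v), w x = W ⟨x, hx⟩ / π := fun x hx => by
    simp only [hw, Set.IccExtend_of_mem huv.le W hx]
  refine ⟨w, hwc.continuousOn, fun x _ => hwpos x, ?_, ?_⟩
  · -- identification of the measure
    have hat : ∀ x ∈ Set.Icc u v, μ {x} = 0 := by
      intro x hx
      refine no_atom ho x N hN i ?_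
      have hl : 0 < 2 * G ⟨x, hx⟩ / (s ⟨x, hx⟩) ^ 2 := by
        have h1 := hG ⟨x, hx⟩; have h2 := hs0 ⟨x, hx⟩; positivity
      set l := 2 * G ⟨x, hx⟩ / (s ⟨x, hx⟩) ^ 2 with hldef
      have hS : Tendsto (fun n : ℕ => ∑ j ∈ Finset.Icc 1 (n + 1), 1 / a (j * N + i - 1)) atTop atTop :=
        hCarleman.comp (tendsto_add_atTop_nat 1)
      refine tendsto_atTop_mono' atTop ?_ (hS.const_mul_atTop (half_pos hl))
      filter_upwards [hces (l / 2) (half_pos hl), hS.eventually_gt_atTop 0] with n hn hn2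
      have h1 := (abs_lt.1 (hn ⟨x, hx⟩)).1
      have h2 : l / 2 < (∑ j ∈ Finset.Icc 1 (n+1), 1/a (j*N+i-1))⁻¹ * ∑ j ∈ Finset.range (n+1), (opoly a b (j*N+i) x)^2 := by
        linarith
      rw [inv_mul_eq_div, lt_div_iff₀ hn2] at h2
      exact h2.le
    have hu := hat u (Set.left_mem_Icc.2 huv.le)
    have hv := hat v (Set.right_mem_Icc.2 huv.le)
    rw [← Measure.restrict_congr_set (Ioo_ae_eq_Icc' hu hv), ← Measure.restrict_congr_set (Ioo_ae_eq_Icc (μ := volume) (a := u) (b := v))]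
    refine ident u v w hwc (fun t => (hwpos t).le) fun f hf C c' d' hC hc' hd' h0 => ?_
    have hsub : ∀ x ∈ Set.Icc c' d', x ∈ Set.Ioo u v := fun x hx => ⟨by linarith [hx.1], by linarith [hx.2]⟩
    have hbound : ∃ M, ∀ x ∈ Set.Icc c' d', ∀ y : ℝ, 0 < y → y ≤ 1 → |(psi a b μ (x + y * Complex.I) 0).im| ≤ M := by
      refine isCompact_Icc.induction_on (p := fun S : Set ℝ => ∃ M, ∀ x ∈ S, ∀ y : ℝ, 0 < y → y ≤ 1 → |(psi a b μ (x + y * Complex.I) 0).im| ≤ M)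
        ⟨0, fun x hx => absurd hx (Set.notMem_empty x)⟩ ?_ ?_ ?_
      · rintro S T hST ⟨M, hM⟩
        exact ⟨M, fun x hx => hM x (hST hx)⟩
      · rintro S T ⟨M, hM⟩ ⟨M', hM'⟩
        refine ⟨max M M', fun x hx y hy hy1 => ?_⟩
        rcases hx with hx | hx
        · exact (hM x hx y hy hy1).trans (le_max_left _ _)
        · exact (hM' x hx y hy hy1).trans (le_max_right _ _)
      · intro x0 hx0
        have hx0' := hsub x0 hx0
        obtain ⟨δ, hδ, hδ2⟩ := hloc ⟨x0, Set.Ioo_subset_Icc_self hx0'⟩ hx0' 1 one_pos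
        refine ⟨Metric.closedBall x0 δ, mem_nhdsWithin_of_mem_nhds (Metric.closedBall_mem_nhds x0 hδ), ?_⟩
        have hW0 := hWpos ⟨x0, Set.Ioo_subset_Icc_self hx0'⟩
        set W0 := W ⟨x0, Set.Ioo_subset_Icc_self hx0'⟩ with hW0d
        refine ⟨1 + (1 + 1 / δ ^ 2) * (1 + W0) + W0, fun x hx y hy hy1 => ?_⟩
        have h1 : |(psi a b μ (x + y * Complex.I) 0).im - W0| ≤ 1 + y * (1 + 1 / δ ^ 2) * (1 + W0) :=
          hδ2 x (by simpa [Real.dist_eq] using hx) y hy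
        have h2 : y * (1 + 1 / δ ^ 2) * (1 + W0) ≤ 1 * (1 + 1 / δ ^ 2) * (1 + W0) := by gcongr
        have h3 := abs_sub_abs_le_abs_sub (psi a b μ (x + y * Complex.I) 0).im W0
        rw [abs_of_pos hW0] at h3
        linarith
    obtain ⟨M, hMb⟩ := hbound
    have hst := stieltjes_inv (a := a) (b := b) (μ := μ) f hf C c' d' hC h0 (Set.IccExtend huv.le W) M hMb ?_
    · have e : ∫ t, f t * w t = (∫ t, f t * Set.IccExtend huv.le W t) / π := by
        rw [← integral_div]
        refine integral_congr_ae (Eventually.of_forall fun t => ?_)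
        simp only [hw]; ring
      rw [e, ← hst]; field_simp
    · intro x hx
      have hx' := hsub x hx
      have hxK := Set.Ioo_subset_Icc_self hx'
      rw [Set.IccExtend_of_mem huv.le W hxK, Metric.tendsto_nhds]
      intro ε hε
      obtain ⟨δ, hδ, hδ2⟩ := hloc ⟨x, hxK⟩ hx' (ε / 2) (half_pos hε)
      have h4 : Tendsto (fun y : ℝ => y * (1 + 1 / δ ^ 2) * (1 + W ⟨x, hxK⟩)) (𝓝[>] 0) (𝓝 0) := by
        have : Tendsto (fun y : ℝ => y * (1 + 1 / δ ^ 2) * (1 + W ⟨x, hxK⟩)) (𝓝 0) (𝓝 (0 * (1 + 1 / δ ^ 2) * (1 + W ⟨x, hxK⟩))) :=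
          Continuous.tendsto (by fun_prop) 0
        simp only [zero_mul] at this
        exact this.mono_left nhdsWithin_le_nhds
      filter_upwards [h4.eventually_lt_const (half_pos hε), self_mem_nhdsWithin] with y hy1 hy2
      rw [Real.dist_eq]
      have h5 : |(psi a b μ (x + y * Complex.I) 0).im - W ⟨x, hxK⟩| ≤ ε / 2 + y * (1 + 1 / δ ^ 2) * (1 + W ⟨x, hxK⟩) :=
        hδ2 x (by simpa using hδ.le) y hy2
      linarith
  · rw [Metric.tendstoUniformlyOn_iff]
    intro ε hε
    filter_upwards [hces ε hε] with n hn x hx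
    have h1 := hn ⟨x, hx⟩
    rw [dist_comm, Real.dist_eq]
    have e : |XX x 1 0| / (π * w x * √(-discr (XX x))) = 2 * G ⟨x, hx⟩ / (s ⟨x, hx⟩) ^ 2 := by
      rw [hwK x hx]
      have e1 := hc ⟨x, hx⟩
      have e2 := hs ⟨x, hx⟩
      have e3 := abs_pos.2 (hc0 ⟨x, hx⟩)
      have e4 := hs0 ⟨x, hx⟩
      have e5 := hG ⟨x, hx⟩
      simp only at e1 e2
      rw [← e1, ← e2]
      simp only [hW]
      field_simp
    rw [e]
    exact h1

end

/-- Theorem 6 of the paper. Asymptotics of the Christoffel function along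
an arithmetic progression, in the `𝒟_r` setting. -/
theorem christoffel_asymptotics_Dr
    (N : ℕ) (hN : 0 < N) (r : ℕ) (hr : 0 < r)
    (a b : ℕ → ℝ) (ha : ∀ n, 0 < a n)
    (i : ℕ) (hi : i < N) (u v : ℝ) (huv : u < v)
    (hΛ : ∀ x ∈ Set.Icc u v, ∃ d < (0 : ℝ),
      Tendsto (fun j : ℕ => discr (Xmat a b N (j * N + i) x)) atTop (𝓝 d))
    (hratio : Tendsto (fun j : ℕ => a ((j + 1) * N + i - 1) / a (j * N + i - 1))
      atTop (𝓝 1))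
    (hDr : memDK r (Set.Icc u v) (fun j x => Xmat a b N (j * N + i) x))
    (XX : ℝ → Mat2)
    (hXX : TendstoUniformlyOn (fun j x => Xmat a b N (j * N + i) x) XX atTop (Set.Icc u v))
    (hCarleman : Tendsto (fun n : ℕ => ∑ j ∈ Finset.Icc 1 n, 1 / a (j * N + i - 1))
      atTop atTop)
    (μ : Measure ℝ) (hμ : IsProbabilityMeasure μ)
    (horth : ∀ n m : ℕ, ∫ x, opoly a b n x * opoly a b m x ∂μ = if n = m then 1 else 0) :
    ∃ w : ℝ → ℝ, ContinuousOn w (Set.Icc u v) ∧ (∀ x ∈ Set.Icc u v, 0 < w x) ∧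
      μ.restrict (Set.Icc u v) =
        (volume.restrict (Set.Icc u v)).withDensity (fun x => ENNReal.ofReal (w x)) ∧
      TendstoUniformlyOn
        (fun n x => (∑ j ∈ Finset.Icc 1 (n + 1), 1 / a (j * N + i - 1))⁻¹ *
          ∑ j ∈ Finset.range (n + 1), (opoly a b (j * N + i) x) ^ 2)
        (fun x => |XX x 1 0| / (π * w x * Real.sqrt (-discr (XX x))))
        atTop (Set.Icc u v) := by
  exact christoffel_main N hN r hr a b ha i hi u v huv hΛ hratio hDr XX hXX hCarleman μ hμ horth
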